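/- It holds that liminf_{M→∞} S(R_M)/s(|R_M|) < 1 < limsup_{M→∞} S(R_M)/s(|R_M|), where the liminf and limsup are over positive integers M tending to infinity. -/

import Mathlib

open Finset

/-- The set of quadratic residues modulo `M`, as a finset of `ZMod M`. -/
def QR (M : ℕ) : Finset (ZMod M) := (Finset.range M).image (fun a : ℕ => ((a : ZMod M)) ^ 2)

/-- The "universe" finset of `ZMod M` (all residues), valid for any `M ≥ 1`. -/
def univM (M : ℕ) : Finset (ZMod M) := (Finset.range M).image (fun a : ℕ => (a : ZMod M))

/-- The cyclic gap from `u` to the next element of `U`: the least `k ≥ 1` with `u + k ∈ U`. -/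
noncomputable def cycGap (M : ℕ) (U : Finset (ZMod M)) (u : ZMod M) : ℕ :=
  sInf {k : ℕ | 0 < k ∧ u + (k : ZMod M) ∈ U}

/-- The stochasticity parameter `S(U)`: the sum of the squares of the consecutive
(cyclic) distances between elements of `U`. -/
noncomputable def stoch (M : ℕ) (U : Finset (ZMod M)) : ℕ :=
  ∑ u ∈ U, (cycGap M U u) ^ 2

/-- `s(k) = s(k, Z_M)`: the average of `S(U)` over all subsets `U ⊆ Z_M` of size `k`. -/
noncomputable def savg (M k : ℕ) : ℚ :=
  (∑ U ∈ (univM M).powersetCard k, (stoch M U : ℚ)) / (Nat.choose M k : ℚ)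

section Gaps

variable {M : ℕ} [NeZero M]

lemma univM_eq_univ : univM M = (Finset.univ : Finset (ZMod M)) := by
  ext x
  simp only [univM, mem_image, mem_range, mem_univ, iff_true]
  exact ⟨x.val, ZMod.val_lt x, ZMod.natCast_zmod_val x⟩

/-- The number of `x` such that none of `x+1, …, x+t` lies in `U`. -/
def emptyCount (M : ℕ) [NeZero M] (U : Finset (ZMod M)) (t : ℕ) : ℕ :=
  #{x : ZMod M | ∀ i ∈ Finset.Icc 1 t, x + (i : ZMod M) ∉ U}

lemma cycGap_spec {U : Finset (ZMod M)} (hU : U.Nonempty) (x : ZMod M) :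
    0 < cycGap M U x ∧ x + (cycGap M U x : ZMod M) ∈ U ∧ cycGap M U x ≤ M := by
  obtain ⟨u, hu⟩ := hU
  have hM : 0 < M := Nat.pos_of_ne_zero (NeZero.ne M)
  have key : ∃ k, k ≤ M ∧ 0 < k ∧ x + (k : ZMod M) ∈ U := by
    by_cases h : (u - x).val = 0
    · refine ⟨M, le_rfl, hM, ?_⟩
      have : u - x = 0 := (ZMod.val_eq_zero _).1 h
      have : u = x := sub_eq_zero.1 this
      simpa [← this] using hu
    · refine ⟨(u - x).val, (ZMod.val_lt _).le, Nat.pos_of_ne_zero h, ?_⟩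
      simpa using hu
  obtain ⟨k, hk, hk'⟩ := key
  have hs := Nat.sInf_mem (s := {k : ℕ | 0 < k ∧ x + (k : ZMod M) ∈ U}) ⟨k, hk'⟩
  exact ⟨hs.1, hs.2, (Nat.sInf_le (show k ∈ {k : ℕ | 0 < k ∧ x + (k : ZMod M) ∈ U} from hk')).trans hk⟩

lemma lt_cycGap_iff {U : Finset (ZMod M)} (hU : U.Nonempty) (x : ZMod M) (t : ℕ) :
    t < cycGap M U x ↔ ∀ i ∈ Finset.Icc 1 t, x + (i : ZMod M) ∉ U := by
  obtain ⟨h0, h1, h2⟩ := cycGap_spec hU x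
  constructor
  · intro h i hi hx
    rw [Finset.mem_Icc] at hi
    have : cycGap M U x ≤ i := Nat.sInf_le ⟨by omega, hx⟩
    omega
  · intro h
    by_contra hlt
    exact h _ (Finset.mem_Icc.2 ⟨h0, not_lt.1 hlt⟩) h1

lemma cycGap_eq_one {U : Finset (ZMod M)} (hU : U.Nonempty) {x : ZMod M} (hx : x + 1 ∈ U) :
    cycGap M U x = 1 := by
  have h0 := (cycGap_spec hU x).1
  have : cycGap M U x ≤ 1 := Nat.sInf_le ⟨one_pos, by simpa using hx⟩
  omega

lemma cycGap_succ {U : Finset (ZMod M)} (hU : U.Nonempty) {x : ZMod M} (hx : x + 1 ∉ U) :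
    cycGap M U x = cycGap M U (x + 1) + 1 := by
  obtain ⟨h0, h1, h2⟩ := cycGap_spec hU x
  obtain ⟨h0', h1', h2'⟩ := cycGap_spec hU (x + 1)
  apply le_antisymm
  · refine Nat.sInf_le ⟨by omega, ?_⟩
    push_cast
    rwa [add_comm (cycGap M U (x + 1) : ZMod M) 1, ← add_assoc]
  · have : cycGap M U x ≠ 1 := by
      intro h; rw [h] at h1; exact hx (by simpa using h1)
    have h3 : cycGap M U (x + 1) ≤ cycGap M U x - 1 := by
      refine Nat.sInf_le ⟨by omega, ?_⟩
      rw [Nat.cast_sub h0]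
      simpa using h1
    omega

lemma stoch_eq_sum_cycGap {U : Finset (ZMod M)} (hU : U.Nonempty) :
    (stoch M U : ℤ) = ∑ x : ZMod M, (2 * (cycGap M U x : ℤ) - 1) := by
  have h1 : ∑ x : ZMod M, (cycGap M U (x + 1) : ℤ) ^ 2 = ∑ x : ZMod M, (cycGap M U x : ℤ) ^ 2 :=
    Fintype.sum_equiv (Equiv.addRight (1 : ZMod M)) _ _ (fun x => rfl)
  have h2 : (stoch M U : ℤ) =
      ∑ x : ZMod M, if x + 1 ∈ U then (cycGap M U (x + 1) : ℤ) ^ 2 else 0 := by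
    rw [Fintype.sum_equiv (Equiv.addRight (1 : ZMod M))
      (fun x => if x + 1 ∈ U then (cycGap M U (x + 1) : ℤ) ^ 2 else 0)
      (fun x => if x ∈ U then (cycGap M U x : ℤ) ^ 2 else 0) (fun x => rfl)]
    rw [Finset.sum_ite_mem, Finset.univ_inter]
    simp [stoch]
  rw [h2, ← sub_eq_zero, ← Finset.sum_sub_distrib]
  have h3 : ∀ x : ZMod M, ((if x + 1 ∈ U then (cycGap M U (x + 1) : ℤ) ^ 2 else 0) -
      (2 * (cycGap M U x : ℤ) - 1)) =
      (cycGap M U (x + 1) : ℤ) ^ 2 - (cycGap M U x : ℤ) ^ 2 := by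
    intro x
    split_ifs with h
    · rw [cycGap_eq_one hU h]; norm_num
    · rw [cycGap_succ hU h]; push_cast; ring
  rw [Finset.sum_congr rfl (fun x _ => h3 x), Finset.sum_sub_distrib, h1, sub_self]

lemma sum_cycGap_eq {U : Finset (ZMod M)} (hU : U.Nonempty) :
    ∑ x : ZMod M, cycGap M U x = ∑ t ∈ range M, emptyCount M U t := by
  have h : ∀ x : ZMod M, cycGap M U x =
      ∑ t ∈ range M, if (∀ i ∈ Finset.Icc 1 t, x + (i : ZMod M) ∉ U) then 1 else 0 := by
    intro x
    have h2 := (cycGap_spec hU x).2.2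
    simp_rw [← lt_cycGap_iff hU x]
    rw [Finset.sum_boole]
    have : (filter (fun t => t < cycGap M U x) (range M)) = range (cycGap M U x) := by
      ext t; simp only [mem_filter, mem_range]; omega
    rw [this]; simp
  rw [Finset.sum_congr rfl (fun x _ => h x), Finset.sum_comm]
  refine Finset.sum_congr rfl fun t _ => ?_
  rw [Finset.sum_boole]; rfl

/-- `S(U)` in terms of the numbers of empty windows. -/
lemma stoch_eq_emptyCount {U : Finset (ZMod M)} (hU : U.Nonempty) :
    (stoch M U : ℤ) = 2 * (∑ t ∈ range M, (emptyCount M U t : ℤ)) - M := by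
  rw [stoch_eq_sum_cycGap hU, Finset.sum_sub_distrib, ← Finset.mul_sum]
  have := sum_cycGap_eq hU
  have h : (∑ x : ZMod M, (cycGap M U x : ℤ)) = ∑ t ∈ range M, (emptyCount M U t : ℤ) := by
    exact_mod_cast this
  rw [h]
  simp [ZMod.card]

lemma emptyCount_anti {U V : Finset (ZMod M)} (h : U ⊆ V) (t : ℕ) :
    emptyCount M V t ≤ emptyCount M U t := by
  apply Finset.card_le_card
  intro x hx
  simp only [mem_filter, mem_univ, true_and] at hx ⊢
  exact fun i hi hxi => hx i hi (h hxi)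

lemma stoch_anti {U V : Finset (ZMod M)} (hU : U.Nonempty) (h : U ⊆ V) :
    stoch M V ≤ stoch M U := by
  have h1 := stoch_eq_emptyCount hU
  have h2 := stoch_eq_emptyCount (hU.mono h)
  have h3 : ∑ t ∈ range M, (emptyCount M V t : ℤ) ≤ ∑ t ∈ range M, (emptyCount M U t : ℤ) :=
    Finset.sum_le_sum fun t _ => by exact_mod_cast emptyCount_anti h t
  have : (stoch M V : ℤ) ≤ stoch M U := by rw [h1, h2]; linarith
  exact_mod_cast this

lemma sum_range_sub_choose (n : ℕ) {k : ℕ} (hk : 1 ≤ k) :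
    ∑ t ∈ range n, (n - t).choose k = (n + 1).choose (k + 1) := by
  induction n with
  | zero => rw [Nat.choose_eq_zero_of_lt (by omega)]; simp
  | succ n ih =>
    rw [Finset.sum_range_succ', Nat.choose_succ_succ (n + 1) k]
    simp only [Nat.add_sub_add_right, ih, Nat.sub_zero]
    ring

lemma sum_stoch_powersetCard (k : ℕ) (hk : 1 ≤ k) :
    ∑ U ∈ (univM M).powersetCard k, (stoch M U : ℤ) =
      2 * M * (M + 1).choose (k + 1) - M * M.choose k := by
  rw [univM_eq_univ]
  have h1 : ∀ U ∈ (univ : Finset (ZMod M)).powersetCard k,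
      (stoch M U : ℤ) = 2 * (∑ t ∈ range M, (emptyCount M U t : ℤ)) - M := by
    intro U hU
    rw [mem_powersetCard] at hU
    exact stoch_eq_emptyCount (Finset.card_pos.1 (by omega))
  rw [Finset.sum_congr rfl h1, Finset.sum_sub_distrib, ← Finset.mul_sum, Finset.sum_comm]
  have h2 : ∀ t ∈ range M, ∑ U ∈ (univ : Finset (ZMod M)).powersetCard k,
      (emptyCount M U t : ℤ) = M * ((M - t).choose k : ℕ) := by
    intro t ht
    have h3 : ∀ U : Finset (ZMod M), (emptyCount M U t : ℤ) =
        ∑ x : ZMod M, if (∀ i ∈ Finset.Icc 1 t, x + (i : ZMod M) ∉ U) then (1:ℤ) else 0 := by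
      intro U; rw [Finset.sum_boole]; rfl
    simp_rw [h3]
    rw [Finset.sum_comm]
    have h4 : ∀ x : ZMod M, (∑ U ∈ (univ : Finset (ZMod M)).powersetCard k,
        if (∀ i ∈ Finset.Icc 1 t, x + (i : ZMod M) ∉ U) then (1:ℤ) else 0) =
        ((M - t).choose k : ℕ) := by
      intro x
      rw [Finset.sum_boole]
      set W : Finset (ZMod M) := (Finset.Icc 1 t).image (fun i : ℕ => x + (i : ZMod M)) with hW
      have hWc : W.card = t := by
        rw [hW, Finset.card_image_of_injOn]
        · simp
        · intro i hi j hj hij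
          simp only [coe_Icc, Set.mem_Icc] at hi hj
          rw [mem_range] at ht
          have : (i : ZMod M) = j := add_left_cancel hij
          rw [ZMod.natCast_eq_natCast_iff'] at this
          rwa [Nat.mod_eq_of_lt (by omega), Nat.mod_eq_of_lt (by omega)] at this
      have h5 : filter (fun U : Finset (ZMod M) => ∀ i ∈ Finset.Icc 1 t, x + (i : ZMod M) ∉ U)
          ((univ : Finset (ZMod M)).powersetCard k) = (Wᶜ).powersetCard k := by
        ext U
        simp only [mem_filter, mem_powersetCard, subset_univ, true_and]
        rw [and_comm]
        refine and_congr_left fun _ => ?_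
        constructor
        · intro h u hu
          rw [mem_compl, hW, mem_image]
          rintro ⟨i, hi, rfl⟩
          exact h i hi hu
        · intro h i hi hu
          have := h hu
          rw [mem_compl, hW] at this
          exact this (mem_image_of_mem _ hi)
      rw [h5, card_powersetCard, card_compl, hWc, ZMod.card]
    rw [Finset.sum_congr rfl fun x _ => h4 x]
    simp [ZMod.card]
  rw [Finset.sum_congr rfl h2, ← Finset.mul_sum]
  have h5 : ∑ t ∈ range M, ((M - t).choose k : ℤ) = ((M + 1).choose (k + 1) : ℕ) := by
    exact_mod_cast sum_range_sub_choose M hk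
  rw [h5]
  simp only [sum_const, card_powersetCard, card_univ, ZMod.card, nsmul_eq_mul]
  ring

lemma savg_eq {k : ℕ} (hk : 1 ≤ k) (hkM : k ≤ M) :
    (savg M k : ℚ) = M * (2 * M + 1 - k) / (k + 1) := by
  have h := sum_stoch_powersetCard (M := M) k hk
  have h' : ∑ U ∈ (univM M).powersetCard k, (stoch M U : ℚ) =
      2 * M * (M + 1).choose (k + 1) - M * M.choose k := by exact_mod_cast congrArg (Int.cast : ℤ → ℚ) h
  have hc : (M.choose k : ℚ) ≠ 0 := by exact_mod_cast (Nat.choose_pos hkM).ne'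
  have h2 : ((M + 1 : ℕ) : ℚ) * M.choose k = (M + 1).choose (k + 1) * ((k + 1 : ℕ) : ℚ) := by
    exact_mod_cast Nat.add_one_mul_choose_eq M k
  push_cast at h2
  have hk1 : (k : ℚ) + 1 ≠ 0 := by positivity
  rw [savg, h', div_eq_div_iff hc hk1]
  linear_combination (-2 * (M : ℚ)) * h2

lemma savg_le {k : ℕ} (hk : 1 ≤ k) (hkM : k ≤ M) :
    ((savg M k : ℚ) : ℝ) ≤ M * (2 * M - k) / k := by
  rw [savg_eq hk hkM]
  push_cast
  have hk0 : (1 : ℝ) ≤ k := by exact_mod_cast hk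
  have hM0 : (k : ℝ) ≤ M := by exact_mod_cast hkM
  rw [div_le_div_iff₀ (by positivity) (by positivity)]
  have : 0 ≤ (M : ℝ) * (2 * (M - k)) := by
    apply mul_nonneg <;> linarith
  nlinarith

lemma le_savg {k : ℕ} (hk : 1 ≤ k) (hkM : k ≤ M) :
    (M : ℝ) ^ 2 / k / 2 ≤ ((savg M k : ℚ) : ℝ) := by
  rw [savg_eq hk hkM]
  push_cast
  have hk0 : (1 : ℝ) ≤ k := by exact_mod_cast hk
  have hM0 : (k : ℝ) ≤ M := by exact_mod_cast hkM
  rw [div_div, div_le_div_iff₀ (by positivity) (by positivity)]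
  have h1 : (k : ℝ) + 1 ≤ 2 * k := by linarith
  have h2 : (M : ℝ) ^ 2 ≤ M * (2 * M + 1 - k) := by nlinarith
  have h3 : (M : ℝ) ^ 2 * (k + 1) ≤ (M * (2 * M + 1 - k)) * (2 * k) :=
    mul_le_mul h2 h1 (by positivity) (le_trans (by positivity) h2)
  nlinarith

end Gaps

section SquaresModuloPrimePowers

lemma exists_sq_modEq_odd_prime_pow {p : ℕ} (hp : p.Prime) (hp2 : p ≠ 2) {x y : ℤ}
    (hy : ¬ (p : ℤ) ∣ y) (hxy : (p : ℤ) ∣ y ^ 2 - x) (a : ℕ) :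
    ∃ z : ℤ, ((p : ℤ) ^ (a + 1) ∣ z ^ 2 - x) ∧ ¬ (p : ℤ) ∣ z := by
  induction a with
  | zero => exact ⟨y, by simpa using hxy, hy⟩
  | succ a ih =>
    obtain ⟨z, ⟨w, hw⟩, hz⟩ := ih
    have hpi : Prime (p : ℤ) := Nat.prime_iff_prime_int.1 hp
    have hcop : IsCoprime (p : ℤ) (2 * z) := by
      refine (hpi.coprime_iff_not_dvd).2 fun h => ?_
      rcases hpi.dvd_or_dvd h with h | h
      · have : p ∣ 2 := by exact_mod_cast h
        exact hp2 ((Nat.prime_dvd_prime_iff_eq hp Nat.prime_two).1 this)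
      · exact hz h
    obtain ⟨u, v, huv⟩ := hcop
    refine ⟨z + (-v * w) * p ^ (a + 1), ⟨w * u + (v * w) ^ 2 * p ^ a, ?_⟩, ?_⟩
    · have hx : x = z ^ 2 - p ^ (a + 1) * w := by linarith
      rw [hx]
      have : (w : ℤ) = w * (u * p + v * (2 * z)) := by rw [huv, mul_one]
      linear_combination ((p : ℤ) ^ (a + 1)) * this
    · intro h
      apply hz
      have h2 : (p : ℤ) ∣ (-v * w) * p ^ (a + 1) := Dvd.dvd.mul_left (dvd_pow_self _ (by omega)) _
      exact (dvd_add_left h2).1 h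

lemma exists_sq_modEq_two_pow {x : ℤ} (hx : (8 : ℤ) ∣ x - 1) (a : ℕ) :
    ∃ z : ℤ, ((2 : ℤ) ^ (a + 3) ∣ z ^ 2 - x) ∧ Odd z := by
  induction a with
  | zero =>
    refine ⟨1, ?_, odd_one⟩
    have := (dvd_neg (α := ℤ)).2 hx
    norm_num
    simpa using this
  | succ a ih =>
    obtain ⟨z, ⟨w, hw⟩, ⟨k, hk⟩⟩ := ih
    refine ⟨z + w * 2 ^ (a + 2), ⟨w * (k + 1) + w ^ 2 * 2 ^ a, ?_⟩, ?_⟩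
    · have hx : x = z ^ 2 - 2 ^ (a + 3) * w := by linarith
      rw [hx, hk]
      ring
    · exact ⟨k + w * 2 ^ (a + 1), by rw [hk]; ring⟩

/-- `x` is a square modulo `M`. -/
def IsSqMod (M : ℕ) (x : ℤ) : Prop := ∃ z : ℤ, (M : ℤ) ∣ z ^ 2 - x

lemma isSqMod_of_dvd {M N : ℕ} {x : ℤ} (h : N ∣ M) (hx : IsSqMod M x) : IsSqMod N x := by
  obtain ⟨z, hz⟩ := hx
  exact ⟨z, (Int.natCast_dvd_natCast.2 h).trans hz⟩

lemma isSqMod_mul {a b : ℕ} (hab : a.Coprime b) {x : ℤ} (ha : IsSqMod a x) (hb : IsSqMod b x) :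
    IsSqMod (a * b) x := by
  obtain ⟨y, hy⟩ := ha
  obtain ⟨z, hz⟩ := hb
  obtain ⟨u, v, huv⟩ := (Nat.isCoprime_iff_coprime.2 hab)
  refine ⟨y * (v * b) + z * (u * a), ?_⟩
  push_cast
  refine IsCoprime.mul_dvd (Nat.isCoprime_iff_coprime.2 hab) ?_ ?_
  · obtain ⟨c, hc⟩ := hy
    have h1 : y * (v * b) + z * (u * a) = y + (z - y) * (u * a) := by
      linear_combination y * huv
    rw [h1]
    exact ⟨c + 2 * y * (z - y) * u + (z - y) ^ 2 * u ^ 2 * a, by linear_combination hc⟩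
  · obtain ⟨c, hc⟩ := hz
    have h1 : y * (v * b) + z * (u * a) = z + (y - z) * (v * b) := by
      linear_combination z * huv
    rw [h1]
    exact ⟨c + 2 * z * (y - z) * v + (y - z) ^ 2 * v ^ 2 * b, by linear_combination hc⟩

lemma isSqMod_of_prime_pow {M : ℕ} (hM : 0 < M) {x : ℤ}
    (h : ∀ p k : ℕ, p.Prime → p ^ k ∣ M → IsSqMod (p ^ k) x) : IsSqMod M x := by
  induction M using Nat.recOnPosPrimePosCoprime with
  | zero => omega
  | one => exact ⟨0, by simp⟩
  | prime_pow p n hp hn => exact h p n hp dvd_rfl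
  | coprime a b ha hb hab iha ihb =>
    exact isSqMod_mul hab (iha (by omega) fun p k hp hk => h p k hp (hk.mul_right b))
      (ihb (by omega) fun p k hp hk => h p k hp (hk.mul_left a))

lemma mem_QR_iff {M : ℕ} [NeZero M] (x : ℤ) : (x : ZMod M) ∈ QR M ↔ IsSqMod M x := by
  simp only [QR, mem_image, mem_range]
  constructor
  · rintro ⟨a, _, ha⟩
    refine ⟨a, ?_⟩
    rw [← ZMod.intCast_zmod_eq_zero_iff_dvd]
    push_cast
    rw [ha, sub_self]
  · rintro ⟨z, hz⟩
    rw [← ZMod.intCast_zmod_eq_zero_iff_dvd] at hz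
    push_cast at hz
    refine ⟨(z : ZMod M).val, ZMod.val_lt _, ?_⟩
    rw [ZMod.natCast_zmod_val]
    exact sub_eq_zero.1 hz

end SquaresModuloPrimePowers

section Pullback

variable {M p : ℕ} [NeZero M] [NeZero p]

/-- The preimage in `ZMod M` of a set of residues modulo a divisor `p` of `M`. -/
def pullback (h : p ∣ M) (B : Finset (ZMod p)) : Finset (ZMod M) :=
  {x | ZMod.castHom h (ZMod p) x ∈ B}

omit [NeZero p] in
lemma mem_pullback (h : p ∣ M) (B : Finset (ZMod p)) (x : ZMod M) :
    x ∈ pullback h B ↔ ZMod.castHom h (ZMod p) x ∈ B := by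
  rw [pullback, mem_filter]
  exact and_iff_right (mem_univ x)

lemma card_pullback (h : p ∣ M) (B : Finset (ZMod p)) : #(pullback h B) * p = M * #B := by
  classical
  set φ := ZMod.castHom h (ZMod p)
  have hsurj : Function.Surjective φ := ZMod.castHom_surjective h
  set c := #{x : ZMod M | φ x = 0}
  have hfib : ∀ b : ZMod p, #{x : ZMod M | φ x = b} = c := by
    intro b
    obtain ⟨y, rfl⟩ := hsurj b
    refine Finset.card_bij (fun x _ => x - y) ?_ ?_ ?_
    · intro x hx
      simp only [mem_filter, mem_univ, true_and] at hx ⊢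
      rw [map_sub, hx, sub_self]
    · intro x _ x' _ hxx
      exact sub_left_injective hxx
    · intro z hz
      simp only [mem_filter, mem_univ, true_and] at hz
      exact ⟨z + y, by simp [hz], by simp⟩
  have hB : ∀ B : Finset (ZMod p), #(pullback h B) = #B * c := by
    intro B
    rw [Finset.card_eq_sum_card_fiberwise (f := φ) (t := B)]
    · rw [Finset.sum_const_nat]
      intro b hb
      rw [← hfib b]
      congr 1
      ext x
      simp only [pullback, mem_filter, mem_univ, true_and, φ]
      exact ⟨fun h => h.2, fun h => ⟨h ▸ hb, h⟩⟩
    · intro x hx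
      exact (mem_pullback h B x).1 hx
  have h1 := hB univ
  have h2 : pullback h (univ : Finset (ZMod p)) = univ := by ext; simp [pullback]
  rw [h2, card_univ, card_univ, ZMod.card, ZMod.card] at h1
  rw [hB, h1]; ring

lemma emptyCount_pullback (h : p ∣ M) (B : Finset (ZMod p)) (t : ℕ) :
    emptyCount M (pullback h B) t * p = M * emptyCount p B t := by
  rw [emptyCount, emptyCount, ← card_pullback h]
  congr 2
  ext x
  rw [mem_pullback, mem_filter, mem_filter]
  simp only [mem_pullback, map_add, map_natCast, mem_univ, true_and]

lemma emptyCount_eq_zero {U : Finset (ZMod M)} (hU : U.Nonempty) {t : ℕ} (ht : M ≤ t) :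
    emptyCount M U t = 0 := by
  rw [emptyCount, card_eq_zero, filter_eq_empty_iff]
  intro x _ hx
  have := (lt_cycGap_iff hU x t).2 hx
  have := (cycGap_spec hU x).2.2
  omega

omit [NeZero p] in
lemma pullback_nonempty (h : p ∣ M) {B : Finset (ZMod p)} (hB : B.Nonempty) :
    (pullback h B).Nonempty := by
  obtain ⟨b, hb⟩ := hB
  obtain ⟨x, rfl⟩ := ZMod.castHom_surjective h b
  exact ⟨x, (mem_pullback h B x).2 hb⟩

lemma stoch_pullback (h : p ∣ M) {B : Finset (ZMod p)} (hB : B.Nonempty) :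
    (stoch M (pullback h B) : ℤ) * p = M * (2 * (∑ t ∈ range p, (emptyCount p B t : ℤ)) - p) := by
  rw [stoch_eq_emptyCount (pullback_nonempty h hB)]
  have hle : p ≤ M := Nat.le_of_dvd (Nat.pos_of_ne_zero (NeZero.ne M)) h
  have h1 : ∀ t, (emptyCount M (pullback h B) t : ℤ) * p = M * emptyCount p B t := by
    intro t; exact_mod_cast emptyCount_pullback h B t
  have h2 : ∑ t ∈ range M, (emptyCount p B t : ℤ) = ∑ t ∈ range p, (emptyCount p B t : ℤ) := by
    symm
    apply Finset.sum_subset (range_subset_range.2 hle)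
    intro t _ ht
    rw [mem_range, not_lt] at ht
    exact_mod_cast emptyCount_eq_zero hB ht
  rw [sub_mul, mul_assoc, Finset.sum_mul, Finset.sum_congr rfl fun t _ => h1 t, ← Finset.mul_sum, h2]
  ring

lemma QR_subset_pullback (h : p ∣ M) : QR M ⊆ pullback h (QR p) := by
  intro x hx
  rw [mem_pullback]
  have hx' : ((x.val : ℤ) : ZMod M) = x := by simp
  rw [← hx', mem_QR_iff] at hx
  have := (mem_QR_iff (M := p) _).2 (isSqMod_of_dvd h hx)
  rw [← hx', map_intCast]
  exact this

end Pullback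

lemma ratio_nonneg (M k : ℕ) (U : Finset (ZMod M)) :
    0 ≤ (stoch M U : ℝ) / ((savg M k : ℚ) : ℝ) := by
  have : 0 ≤ savg M k := by
    unfold savg
    positivity
  have : (0 : ℝ) ≤ ((savg M k : ℚ) : ℝ) := by exact_mod_cast this
  positivity

lemma QR_nonempty (M : ℕ) [NeZero M] : (QR M).Nonempty :=
  ⟨_, (mem_QR_iff 0).2 ⟨0, by simp⟩⟩

lemma card_QR_le (M : ℕ) [NeZero M] : #(QR M) ≤ M := by
  simpa [ZMod.card] using Finset.card_le_univ (QR M)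

lemma ratio_pow_three (a : ℕ) :
    (stoch (3 ^ (a + 4)) (QR (3 ^ (a + 4))) : ℝ) /
      ((savg (3 ^ (a + 4)) (QR (3 ^ (a + 4))).card : ℚ) : ℝ) ≤ 9 / 10 := by
  set M := 3 ^ (a + 4) with hM
  have : NeZero M := ⟨by positivity⟩
  have h3 : 3 ∣ M := dvd_pow_self 3 (by omega)
  have h9 : 9 ∣ M := ⟨9 * 3 ^ a, by rw [hM]; ring⟩
  have hsub : pullback h3 {1} ⊆ QR M := by
    intro x hx
    have hx' : ((x.val : ℤ) : ZMod M) = x := by simp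
    rw [mem_pullback, ← hx', map_intCast, mem_singleton] at hx
    rw [← hx', mem_QR_iff]
    have hd : (3 : ℤ) ∣ 1 ^ 2 - (x.val : ℤ) := by
      have : (((1 ^ 2 - (x.val : ℤ) : ℤ)) : ZMod 3) = 0 := by
        push_cast at hx ⊢
        rw [hx]; norm_num
      exact_mod_cast (ZMod.intCast_zmod_eq_zero_iff_dvd _ 3).1 this
    obtain ⟨z, hz, _⟩ := exists_sq_modEq_odd_prime_pow (p := 3) Nat.prime_three (by norm_num)
      (x := x.val) (y := 1) (by norm_num) (by exact_mod_cast hd) (a + 3)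
    have hMz : (M : ℤ) = ((3 : ℕ) : ℤ) ^ (a + 3 + 1) := by rw [hM]; push_cast; rfl
    exact ⟨z, hMz ▸ hz⟩
  have hS : (stoch M (QR M) : ℤ) * 3 ≤ M * 9 := by
    have h1 := stoch_anti (pullback_nonempty h3 ⟨1, by simp⟩) hsub
    have h2 := stoch_pullback h3 (B := {1}) ⟨1, by simp⟩
    have h6 : ∑ t ∈ range 3, (emptyCount 3 {1} t : ℤ) = 6 := by decide
    rw [h6] at h2
    have h1' : (stoch M (QR M) : ℤ) ≤ stoch M (pullback ‹3 ∣ M› {1}) := by exact_mod_cast h1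
    push_cast at h2
    linarith
  have hk : #(QR M) * 9 ≤ M * 4 := by
    have h1 := Finset.card_le_card (QR_subset_pullback h9)
    have h2 := card_pullback h9 (QR 9)
    have h3 : #(QR 9) = 4 := by decide
    rw [h3] at h2
    linarith
  have hk1 : 1 ≤ #(QR M) := Finset.card_pos.2 (QR_nonempty M)
  have hM9 : 81 ≤ M := Nat.le_of_dvd (by positivity) ⟨3 ^ a, by rw [hM]; ring⟩
  rw [savg_eq hk1 (card_QR_le M)]
  push_cast
  have hSr : (stoch M (QR M) : ℝ) * 3 ≤ M * 9 := by exact_mod_cast hS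
  have hkr : (#(QR M) : ℝ) * 9 ≤ M * 4 := by exact_mod_cast hk
  have hk1r : (1 : ℝ) ≤ #(QR M) := by exact_mod_cast hk1
  have hMr : (81 : ℝ) ≤ M := by exact_mod_cast hM9
  set k : ℝ := ((#(QR M) : ℕ) : ℝ)
  set m : ℝ := ((M : ℕ) : ℝ)
  have hpos : 0 < m * (2 * m + 1 - k) / (k + 1) := by
    apply div_pos (mul_pos _ _) <;> linarith
  rw [div_le_iff₀ hpos]
  have hm0 : 0 ≤ m := by linarith
  have hlow : m * (10 / 3) ≤ m * (2 * m + 1 - k) / (k + 1) := by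
    rw [le_div_iff₀ (by linarith), mul_assoc]
    apply mul_le_mul_of_nonneg_left _ (by linarith)
    linarith
  linarith

lemma ratio_pow_fifty_three (a : ℕ) :
    1.01 ≤ (stoch (53 ^ (a + 1)) (QR (53 ^ (a + 1))) : ℝ) /
      ((savg (53 ^ (a + 1)) (QR (53 ^ (a + 1))).card : ℚ) : ℝ) := by
  set M := 53 ^ (a + 1) with hM
  have : NeZero M := ⟨by positivity⟩
  have hp : Nat.Prime 53 := by norm_num
  have h53 : 53 ∣ M := dvd_pow_self 53 (by omega)
  have hsub : pullback h53 ((QR 53).erase 0) ⊆ QR M := by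
    intro x hx
    have hx' : ((x.val : ℤ) : ZMod M) = x := by simp
    rw [mem_pullback, ← hx', map_intCast, mem_erase, mem_QR_iff] at hx
    rw [← hx', mem_QR_iff]
    obtain ⟨hx0, y, hy⟩ := hx
    have hy0 : ¬ ((53 : ℕ) : ℤ) ∣ y := by
      intro h
      apply hx0
      rw [ZMod.intCast_zmod_eq_zero_iff_dvd]
      have h2 : ((53 : ℕ) : ℤ) ∣ y ^ 2 := h.trans (dvd_pow_self y two_ne_zero)
      exact (dvd_sub_right h2).1 hy
    obtain ⟨z, hz, _⟩ := exists_sq_modEq_odd_prime_pow (p := 53) hp (by norm_num) hy0 hy a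
    have hMz : (M : ℤ) = ((53 : ℕ) : ℤ) ^ (a + 1) := by rw [hM]; push_cast; rfl
    exact ⟨z, hMz ▸ hz⟩
  have hS : (M : ℤ) * 171 ≤ (stoch M (QR M) : ℤ) * 53 := by
    have h1 := stoch_anti (QR_nonempty M) (QR_subset_pullback h53)
    have h2 := stoch_pullback h53 (B := QR 53) (QR_nonempty 53)
    have h3 : ∑ t ∈ range 53, (emptyCount 53 (QR 53) t : ℤ) = 112 := by decide +kernel
    rw [h3] at h2
    have h1' : (stoch M (pullback h53 (QR 53)) : ℤ) ≤ stoch M (QR M) := by exact_mod_cast h1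
    push_cast at h2
    linarith
  have hk : M * 26 ≤ #(QR M) * 53 := by
    have h1 := Finset.card_le_card hsub
    have h2 := card_pullback h53 ((QR 53).erase 0)
    have h3 : #((QR 53).erase 0) = 26 := by decide +kernel
    rw [h3] at h2
    linarith
  have hk1 : 1 ≤ #(QR M) := Finset.card_pos.2 (QR_nonempty M)
  have hs := savg_le hk1 (card_QR_le M)
  have hs' := le_savg hk1 (card_QR_le M)
  have hSr : (M : ℝ) * 171 ≤ stoch M (QR M) * 53 := by exact_mod_cast hS
  have hkr : (M : ℝ) * 26 ≤ #(QR M) * 53 := by exact_mod_cast hk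
  have hk1r : (1 : ℝ) ≤ #(QR M) := by exact_mod_cast hk1
  have hMr : (1 : ℝ) ≤ M := by exact_mod_cast Nat.pos_of_ne_zero (NeZero.ne M)
  have hpos : 0 < ((savg M #(QR M) : ℚ) : ℝ) := lt_of_lt_of_le (by positivity) hs'
  rw [le_div_iff₀ hpos]
  have : (M : ℝ) * (2 * M - #(QR M)) / #(QR M) ≤ M * (80 / 26) := by
    rw [div_le_iff₀ (by linarith), mul_assoc]
    apply mul_le_mul_of_nonneg_left _ (by linarith)
    linarith
  linarith

theorem main_of_bounded (hbd : ∃ C : ℝ, ∀ M : ℕ, 0 < M →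
      (stoch M (QR M) : ℝ) ≤ C * ((M : ℝ) ^ 2 / #(QR M))) :
    Filter.liminf
        (fun M : ℕ => (stoch M (QR M) : ℝ) / ((savg M (QR M).card : ℚ) : ℝ)) Filter.atTop < 1 ∧
    1 < Filter.limsup
        (fun M : ℕ => (stoch M (QR M) : ℝ) / ((savg M (QR M).card : ℚ) : ℝ)) Filter.atTop := by
  obtain ⟨C, hC⟩ := hbd
  have htend : ∀ b c : ℕ, 2 ≤ b → Filter.Tendsto (fun a : ℕ => b ^ (a + c)) Filter.atTop Filter.atTop := by
    intro b c hb
    exact (tendsto_pow_atTop_atTop_of_one_lt (by omega : 1 < b)).comp (Filter.tendsto_add_atTop_nat c)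
  have hle : Filter.IsBoundedUnder (· ≤ ·) Filter.atTop
      (fun M : ℕ => (stoch M (QR M) : ℝ) / ((savg M (QR M).card : ℚ) : ℝ)) := by
    refine ⟨2 * C, ?_⟩
    rw [Filter.eventually_map]
    filter_upwards [Filter.eventually_gt_atTop 0] with M hM
    have : NeZero M := ⟨hM.ne'⟩
    have hk1 : 1 ≤ #(QR M) := Finset.card_pos.2 (QR_nonempty M)
    have hk1r : (1 : ℝ) ≤ #(QR M) := by exact_mod_cast hk1
    have hMr : (1 : ℝ) ≤ M := by exact_mod_cast hM
    have hs' := le_savg hk1 (card_QR_le M)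
    have hpos : 0 < (M : ℝ) ^ 2 / #(QR M) := by positivity
    have hC0 : 0 ≤ C := by
      have := (Nat.cast_nonneg (stoch M (QR M))).trans (hC M hM)
      exact nonneg_of_mul_nonneg_left this hpos
    rw [div_le_iff₀ (lt_of_lt_of_le (by positivity) hs')]
    calc _ ≤ C * ((M : ℝ) ^ 2 / #(QR M)) := hC M hM
      _ = 2 * C * ((M : ℝ) ^ 2 / #(QR M) / 2) := by ring
      _ ≤ _ := mul_le_mul_of_nonneg_left hs' (by positivity)
  constructor
  · refine lt_of_le_of_lt (Filter.liminf_le_of_frequently_le  ?_ ?_) (show (9 / 10 : ℝ) < 1 by norm_num)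
    · exact (htend 3 4 (by norm_num)).frequently (Filter.Frequently.of_forall ratio_pow_three)
    · exact ⟨0, Filter.eventually_map.2 (Filter.Eventually.of_forall fun M => ratio_nonneg M _ _)⟩
  · refine lt_of_lt_of_le (by norm_num : (1 : ℝ) < 1.01) (Filter.le_limsup_of_frequently_le ?_ hle)
    exact (htend 53 1 (by norm_num)).frequently (Filter.Frequently.of_forall ratio_pow_fifty_three)

section Stepanov

open Polynomial

variable {p : ℕ} [Fact p.Prime]

/-- The operator `r ↦ f^(k-e) D^k (f^e r)`. -/
noncomputable def stepOp (f : (ZMod p)[X]) (e : ℕ) : ℕ → ((ZMod p)[X] →ₗ[ZMod p] (ZMod p)[X])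
  | 0 => LinearMap.id
  | k + 1 => (LinearMap.mulLeft (ZMod p) (C ((e : ZMod p) - k) * derivative f)) ∘ₗ stepOp f e k +
      (LinearMap.mulLeft (ZMod p) f) ∘ₗ derivative ∘ₗ stepOp f e k

lemma stepOp_succ (f : (ZMod p)[X]) (e k : ℕ) (r : (ZMod p)[X]) :
    stepOp f e (k + 1) r = C ((e : ZMod p) - k) * derivative f * stepOp f e k r +
      f * derivative (stepOp f e k r) := rfl

lemma iterate_derivative_pow_mul (f : (ZMod p)[X]) (e : ℕ) {k : ℕ} (hk : k ≤ e) (j : ℕ)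
    (r : (ZMod p)[X]) :
    derivative^[k] (f ^ e * r * X ^ (p * j)) = f ^ (e - k) * stepOp f e k r * X ^ (p * j) := by
  induction k with
  | zero => simp [stepOp]
  | succ k ih =>
    rw [Function.iterate_succ_apply', ih (by omega), stepOp_succ]
    obtain ⟨d, hd⟩ : ∃ d, e - k = d + 1 := ⟨e - k - 1, by omega⟩
    have h2 : e - (k + 1) = d := by omega
    have h3 : (e : ZMod p) - k = ((d + 1 : ℕ) : ZMod p) := by
      rw [← Nat.cast_sub (by omega), hd]
    have h4 : derivative (X ^ (p * j) : (ZMod p)[X]) = 0 := by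
      rw [derivative_X_pow]; simp
    rw [hd, h2, h3, derivative_mul, h4, derivative_mul, derivative_pow_succ]
    push_cast
    simp only [C_add, C_1, map_natCast]
    ring

lemma natDegree_stepOp_le {f : (ZMod p)[X]} (hf : f.natDegree ≤ 3) (e k : ℕ) (r : (ZMod p)[X]) :
    (stepOp f e k r).natDegree ≤ r.natDegree + 2 * k := by
  induction k with
  | zero => simp [stepOp]
  | succ k ih =>
    rw [stepOp_succ]
    refine natDegree_add_le_of_degree_le ?_ ?_
    · refine (natDegree_mul_le).trans ?_
      have h1 : (C ((e : ZMod p) - k) * derivative f).natDegree ≤ 2 :=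
        (natDegree_C_mul_le _ _).trans ((natDegree_derivative_le f).trans (by omega))
      omega
    · by_cases h : (stepOp f e k r).natDegree = 0
      · rw [derivative_of_natDegree_zero h]; simp
      · refine (natDegree_mul_le).trans ?_
        have := natDegree_derivative_lt h
        omega

/-- The auxiliary polynomial (before multiplication by a power of `f`). -/
noncomputable def stepAux (f : (ZMod p)[X]) (n J : ℕ) (r s : Fin J → (ZMod p)[X]) : (ZMod p)[X] :=
  ∑ j : Fin J, (r j + s j * f ^ n) * X ^ (p * j)

lemma eq_zero_of_sq_mul_eq {f r s : (ZMod p)[X]} (hf : f.natDegree = 3) {c : ZMod p} (hc : c ≠ 0)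
    (h : r ^ 2 * f = C c * s ^ 2) : r = 0 ∧ s = 0 := by
  have hf0 : f ≠ 0 := by rintro rfl; simp at hf
  by_cases hr : r = 0
  · refine ⟨hr, ?_⟩
    rw [hr] at h
    have : C c * s ^ 2 = 0 := by rw [← h]; ring
    rcases mul_eq_zero.1 this with h | h
    · exact absurd (C_eq_zero.1 h) hc
    · exact pow_eq_zero_iff two_ne_zero |>.1 h
  · exfalso
    have h1 := congrArg natDegree h
    rw [natDegree_mul (pow_ne_zero _ hr) hf0, natDegree_C_mul hc, natDegree_pow, natDegree_pow, hf] at h1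
    omega

lemma stepAux_ne_zero {f : (ZMod p)[X]} {n J : ℕ} (hp : p = 2 * n + 1) (hf : f.natDegree = 3)
    (hf0 : f.eval 0 ≠ 0) {r s : Fin J → (ZMod p)[X]} (hr : ∀ j, (r j).natDegree + 2 ≤ n)
    (hs : ∀ j, (s j).natDegree + 2 ≤ n) (h : stepAux f n J r s = 0) : ∀ j, r j = 0 ∧ s j = 0 := by
  by_contra hcon
  push Not at hcon
  have hex : ∃ k : ℕ, ∃ hk : k < J, ¬ (r ⟨k, hk⟩ = 0 ∧ s ⟨k, hk⟩ = 0) := by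
    obtain ⟨j, hj⟩ := hcon
    exact ⟨j, j.2, fun h => hj h.1 h.2⟩
  classical
  obtain ⟨hk, hne⟩ := Nat.find_spec hex
  set k := Nat.find hex
  have hmin : ∀ j : Fin J, (j : ℕ) < k → r j = 0 ∧ s j = 0 := by
    intro j hj
    have := Nat.find_min hex hj
    push Not at this
    by_contra hc
    exact hc ⟨(this j.2).1, (this j.2).2⟩
  have hdvd : (X : (ZMod p)[X]) ^ p ∣ r ⟨k, hk⟩ + s ⟨k, hk⟩ * f ^ n := by
    have h1 : (X : (ZMod p)[X]) ^ (p * k) * X ^ p ∣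
        (r ⟨k, hk⟩ + s ⟨k, hk⟩ * f ^ n) * X ^ (p * k) := by
      have h2 : (r ⟨k, hk⟩ + s ⟨k, hk⟩ * f ^ n) * X ^ (p * k) =
          - ∑ j ∈ univ.erase (⟨k, hk⟩ : Fin J), (r j + s j * f ^ n) * X ^ (p * j) := by
        rw [eq_neg_iff_add_eq_zero, ← h, stepAux]
        exact Finset.add_sum_erase univ (fun j : Fin J => (r j + s j * f ^ n) * X ^ (p * (j : ℕ)))
          (mem_univ (⟨k, hk⟩ : Fin J))
      rw [h2, dvd_neg]
      refine Finset.dvd_sum fun j hj => ?_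
      rcases lt_trichotomy (j : ℕ) k with hlt | heq | hgt
      · rw [(hmin j hlt).1, (hmin j hlt).2]; simp
      · exact absurd (Fin.ext heq) (ne_of_mem_erase hj)
      · refine Dvd.dvd.mul_left ?_ _
        rw [← pow_add]
        apply pow_dvd_pow
        calc p * k + p = p * (k + 1) := by ring
          _ ≤ p * j := Nat.mul_le_mul_left _ hgt
    rw [mul_comm] at h1
    exact (mul_dvd_mul_iff_right (pow_ne_zero _ X_ne_zero)).1 h1
  set a := r ⟨k, hk⟩
  set b := s ⟨k, hk⟩
  have hfp : (X : (ZMod p)[X]) ^ p ∣ f ^ p - C (f.eval 0) := by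
    have h1 : (X : (ZMod p)[X]) ∣ f - C (f.eval 0) := by
      rw [X_dvd_iff]; simp [coeff_zero_eq_eval_zero]
    have h2 := pow_dvd_pow_of_dvd h1 p
    rwa [sub_pow_char, ← C_pow, ZMod.pow_card] at h2
  have hd2 : (X : (ZMod p)[X]) ^ p ∣ a ^ 2 * f - C (f.eval 0) * b ^ 2 := by
    have h1 : a ^ 2 * f - C (f.eval 0) * b ^ 2 =
        (a + b * f ^ n) * ((a - b * f ^ n) * f) + b ^ 2 * (f ^ p - C (f.eval 0)) := by
      have h2 : f ^ p = f ^ (2 * n + 1) := congrArg (f ^ ·) hp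
      rw [h2]; ring
    rw [h1]
    exact dvd_add (hdvd.mul_right _) (hfp.mul_left _)
  have hz : a ^ 2 * f - C (f.eval 0) * b ^ 2 = 0 := by
    apply eq_zero_of_dvd_of_natDegree_lt hd2
    rw [natDegree_X_pow]
    have h1 : (a ^ 2 * f).natDegree ≤ 2 * n - 1 := by
      refine natDegree_mul_le.trans ?_
      have := natDegree_pow_le (p := a) (n := 2)
      have h3 := hr ⟨k, hk⟩
      change a.natDegree + 2 ≤ n at h3
      omega
    have h2 : (C (f.eval 0) * b ^ 2).natDegree ≤ 2 * n - 1 := by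
      refine (natDegree_C_mul_le _ _).trans ?_
      have := natDegree_pow_le (p := b) (n := 2)
      have h3 := hs ⟨k, hk⟩
      change b.natDegree + 2 ≤ n at h3
      omega
    have := natDegree_sub_le (a ^ 2 * f) (C (f.eval 0) * b ^ 2)
    omega
  exact hne (eq_zero_of_sq_mul_eq hf hf0 (sub_eq_zero.1 hz))

lemma exists_stepanov_poly {f : (ZMod p)[X]} {n J l A : ℕ}
    (hf : f.natDegree = 3) (hA : A + 1 = n) (σ : ZMod p)
    (hdim : l * (A + J + 2 * l) < 2 * (J * A)) :
    ∃ r s : Fin J → (ZMod p)[X], (∀ j, (r j).natDegree + 2 ≤ n) ∧ (∀ j, (s j).natDegree + 2 ≤ n) ∧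
      (∃ j, ¬ (r j = 0 ∧ s j = 0)) ∧
      ∀ k < l, ∑ j : Fin J, (stepOp f l k (r j) + C σ * stepOp f (l + n) k (s j)) * X ^ (j : ℕ) = 0 := by
  have hA0 : 0 < A := by
    rcases Nat.eq_zero_or_pos A with h | h
    · rw [h] at hdim; simp at hdim
    · exact h
  have hnd : ∀ q : degreeLT (ZMod p) A, (q : (ZMod p)[X]).natDegree + 1 ≤ A := by
    intro q
    have h1 := mem_degreeLT.1 q.2
    by_cases h0 : (q : (ZMod p)[X]) = 0
    · rw [h0, natDegree_zero]; omega
    · exact (natDegree_lt_iff_degree_lt h0).2 h1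
  let V := (Fin J → degreeLT (ZMod p) A) × (Fin J → degreeLT (ZMod p) A)
  let Φ : V →ₗ[ZMod p] (Fin l → (ZMod p)[X]) :=
    { toFun := fun v k => ∑ j : Fin J, (stepOp f l k (v.1 j : (ZMod p)[X]) +
        C σ * stepOp f (l + n) k (v.2 j : (ZMod p)[X])) * X ^ (j : ℕ)
      map_add' := by
        intro v w
        funext k
        rw [Pi.add_apply, ← Finset.sum_add_distrib]
        refine Finset.sum_congr rfl fun j _ => ?_
        have h1 : (((v + w).1 j : degreeLT (ZMod p) A) : (ZMod p)[X]) = v.1 j + w.1 j := rfl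
        have h2 : (((v + w).2 j : degreeLT (ZMod p) A) : (ZMod p)[X]) = v.2 j + w.2 j := rfl
        rw [h1, h2, map_add, map_add]
        ring
      map_smul' := by
        intro c v
        funext k
        rw [RingHom.id_apply, Pi.smul_apply, Finset.smul_sum]
        refine Finset.sum_congr rfl fun j _ => ?_
        have h1 : (((c • v).1 j : degreeLT (ZMod p) A) : (ZMod p)[X]) = c • (v.1 j : (ZMod p)[X]) := rfl
        have h2 : (((c • v).2 j : degreeLT (ZMod p) A) : (ZMod p)[X]) = c • (v.2 j : (ZMod p)[X]) := rfl
        rw [h1, h2, map_smul, map_smul]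
        simp only [smul_eq_C_mul]
        ring }
  have hmem : ∀ v k, Φ v k ∈ degreeLT (ZMod p) (A + J + 2 * l) := by
    intro v k
    have hΦ : Φ v k = ∑ j : Fin J, (stepOp f l k (v.1 j : (ZMod p)[X]) +
        C σ * stepOp f (l + n) k (v.2 j : (ZMod p)[X])) * X ^ (j : ℕ) := rfl
    rw [hΦ]
    refine Submodule.sum_mem (degreeLT (ZMod p) (A + J + 2 * l)) (fun j _ => ?_)
    rw [mem_degreeLT]
    have h1 := natDegree_stepOp_le hf.le l k (v.1 j : (ZMod p)[X])
    have h2 := natDegree_stepOp_le hf.le (l + n) k (v.2 j : (ZMod p)[X])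
    have h3 := hnd (v.1 j)
    have h4 := hnd (v.2 j)
    have hk := k.2
    have hj := j.2
    refine lt_of_le_of_lt degree_le_natDegree ?_
    rw [Nat.cast_lt]
    have h5 := natDegree_mul_le (p := (stepOp f l k (v.1 j : (ZMod p)[X]) +
        C σ * stepOp f (l + n) k (v.2 j : (ZMod p)[X]))) (q := X ^ (j : ℕ))
    have h6 := natDegree_add_le (stepOp f l k (v.1 j : (ZMod p)[X]))
        (C σ * stepOp f (l + n) k (v.2 j : (ZMod p)[X]))
    have h7 := natDegree_C_mul_le σ (stepOp f (l + n) k (v.2 j : (ZMod p)[X]))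
    rw [natDegree_X_pow] at h5
    omega
  let Ψ : V →ₗ[ZMod p] (Fin l → degreeLT (ZMod p) (A + J + 2 * l)) :=
    { toFun := fun v k => ⟨Φ v k, hmem v k⟩
      map_add' := by intro v w; funext k; ext1; simp
      map_smul' := by intro v w; funext k; ext1; simp }
  have hfin : ∀ N, Module.finrank (ZMod p) (degreeLT (ZMod p) N) = N := by
    intro N
    rw [LinearEquiv.finrank_eq (degreeLTEquiv (ZMod p) N)]; simp
  have hfd : ∀ N, FiniteDimensional (ZMod p) (degreeLT (ZMod p) N) := fun N =>
    LinearEquiv.finiteDimensional (degreeLTEquiv (ZMod p) N).symm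
  have hker : LinearMap.ker Ψ ≠ ⊥ := by
    apply LinearMap.ker_ne_bot_of_finrank_lt
    simp only [V, Module.finrank_prod, Module.finrank_pi_fintype, hfin, sum_const, card_univ,
      Fintype.card_fin, smul_eq_mul]
    omega
  obtain ⟨v, hv, hv0⟩ := (Submodule.ne_bot_iff _).1 hker
  refine ⟨fun j => v.1 j, fun j => v.2 j, fun j => ?_, fun j => ?_, ?_, ?_⟩
  · have := hnd (v.1 j); simp only; omega
  · have := hnd (v.2 j); simp only; omega
  · by_contra hcon
    push Not at hcon
    apply hv0
    ext j
    · simp [(hcon j).1]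
    · simp [(hcon j).2]
  · intro k hk
    have h1 : Ψ v = 0 := hv
    have h2 := congrArg Subtype.val (congrFun h1 ⟨k, hk⟩)
    exact h2

lemma stepanov_bound {f : (ZMod p)[X]} {n J l A : ℕ} (hp : p = 2 * n + 1)
    (hf : f.natDegree = 3) (hf0 : f.eval 0 ≠ 0) (hA : A + 1 = n) (σ : ZMod p)
    (hlp : l ≤ p) (hdim : l * (A + J + 2 * l) < 2 * (J * A)) :
    #{x : ZMod p | f.eval x ^ n = σ} * l ≤ 3 * l + p * (J + 1) := by
  classical
  obtain ⟨r, s, hr, hs, ⟨j0, hj0⟩, hQ⟩ := exists_stepanov_poly hf hA σ hdim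
  have hfne : f ≠ 0 := by rintro rfl; simp at hf
  set R : (ZMod p)[X] := f ^ l * stepAux f n J r s with hR
  have hR0 : R ≠ 0 := by
    refine mul_ne_zero (pow_ne_zero _ hfne) fun h => hj0 ?_
    exact stepAux_ne_zero hp hf hf0 hr hs h j0
  have hn0 : n ≠ 0 := by omega
  have hmult : ∀ x ∈ ({x : ZMod p | f.eval x ^ n = σ} : Finset (ZMod p)), l ≤ R.rootMultiplicity x := by
    intro x hx
    simp only [mem_filter, mem_univ, true_and] at hx
    rcases Nat.eq_zero_or_pos l with rfl | hl
    · exact Nat.zero_le _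
    obtain ⟨l', rfl⟩ : ∃ l', l = l' + 1 := ⟨l - 1, by omega⟩
    refine lt_rootMultiplicity_of_isRoot_iterate_derivative_of_mem_nonZeroDivisors hR0 ?_ ?_
    · intro k hk
      have hder : derivative^[k] R = ∑ j : Fin J, (f ^ (l' + 1 - k) * stepOp f (l' + 1) k (r j) *
          X ^ (p * (j : ℕ)) + f ^ (l' + 1 + n - k) * stepOp f (l' + 1 + n) k (s j) * X ^ (p * (j : ℕ))) := by
        rw [hR, stepAux, Finset.mul_sum, iterate_derivative_sum]
        refine Finset.sum_congr rfl fun j _ => ?_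
        rw [← iterate_derivative_pow_mul f (l' + 1) (by omega) j (r j),
          ← iterate_derivative_pow_mul f (l' + 1 + n) (by omega) j (s j), ← iterate_map_add derivative]
        congr 1
        ring
      rw [IsRoot.def, hder, eval_finsetSum]
      have hq := congrArg (eval x) (hQ k (by omega))
      rw [eval_finsetSum, eval_zero] at hq
      rw [← mul_zero (f.eval x ^ (l' + 1 - k)), ← hq, Finset.mul_sum]
      refine Finset.sum_congr rfl fun j _ => ?_
      have h1 : l' + 1 + n - k = (l' + 1 - k) + n := by omega
      have h2 : x ^ (p * (j : ℕ)) = x ^ (j : ℕ) := by rw [pow_mul, ZMod.pow_card]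
      simp only [eval_add, eval_mul, eval_pow, eval_X, eval_C, h1, pow_add, hx, h2]
      ring
    · rw [mem_nonZeroDivisors_iff_ne_zero]
      intro h
      rw [ZMod.natCast_eq_zero_iff, (Fact.out : p.Prime).dvd_factorial] at h
      omega
  have hcount : #{x : ZMod p | f.eval x ^ n = σ} * l ≤ R.natDegree := by
    calc #{x : ZMod p | f.eval x ^ n = σ} * l
        = ∑ x ∈ ({x : ZMod p | f.eval x ^ n = σ} : Finset (ZMod p)), l := by
          rw [sum_const, smul_eq_mul]
      _ ≤ ∑ x ∈ ({x : ZMod p | f.eval x ^ n = σ} : Finset (ZMod p)), R.roots.count x := by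
          refine Finset.sum_le_sum fun x hx => ?_
          rw [count_roots]; exact hmult x hx
      _ ≤ R.roots.card := by
          rw [← Multiset.sum_count_eq_card (s := univ) (m := R.roots) (fun a _ => mem_univ a)]
          exact Finset.sum_le_sum_of_subset (subset_univ _)
      _ ≤ R.natDegree := card_roots' R
  refine hcount.trans ?_
  rw [hR]
  refine natDegree_mul_le.trans ?_
  have h1 : (f ^ l).natDegree ≤ 3 * l := by
    refine natDegree_pow_le.trans ?_
    rw [hf]; omega
  have h2 : (stepAux f n J r s).natDegree ≤ p * (J + 1) := by
    refine natDegree_sum_le_of_forall_le _ _ fun j _ => ?_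
    refine natDegree_mul_le.trans ?_
    rw [natDegree_X_pow]
    have h3 := hr j
    have h4 := hs j
    have h5 : (f ^ n).natDegree ≤ n * 3 := by
      refine natDegree_pow_le.trans ?_
      rw [hf]
    have h6 := natDegree_mul_le (p := s j) (q := f ^ n)
    have h7 := natDegree_add_le (r j) (s j * f ^ n)
    have h8 : p * (j : ℕ) + p ≤ p * J := by
      calc p * (j : ℕ) + p = p * (j + 1) := by ring
        _ ≤ p * J := Nat.mul_le_mul_left _ j.2
    have h9 : p * (J + 1) = p * J + p := by ring
    omega
  omega

lemma card_pow_eq_le {f : (ZMod p)[X]} {n : ℕ} (hp : p = 2 * n + 1) (hp4 : 10000 ≤ p)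
    (hf : f.natDegree = 3) (hf0 : f.eval 0 ≠ 0) (σ : ZMod p) :
    (#{x : ZMod p | f.eval x ^ n = σ} : ℝ) ≤ p / 2 + 13 * √p := by
  set q := Nat.sqrt p / 2 with hq
  have hs1 : Nat.sqrt p * Nat.sqrt p ≤ p := Nat.sqrt_le p
  have hs2 : p < (Nat.sqrt p + 1) * (Nat.sqrt p + 1) := Nat.lt_succ_sqrt p
  have hs3 : 100 ≤ Nat.sqrt p := by
    rw [Nat.le_sqrt]; omega
  have hq50 : 50 ≤ q := by omega
  have hq2 : 2 * q ≤ Nat.sqrt p := by omega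
  have hqq : 4 * (q * q) ≤ p := by nlinarith
  have hb := stepanov_bound (l := 2 * q) (J := q + 4) (A := n - 1) hp hf hf0 (by omega) σ
    (by nlinarith) (by
      obtain ⟨A, hA⟩ : ∃ A, n = A + 1 := ⟨n - 1, by omega⟩
      have : n - 1 = A := by omega
      rw [this]
      nlinarith)
  have hq' : √p ≤ 4 * (q : ℝ) := by
    have h1 : p ≤ (4 * q) * (4 * q) := by
      have : Nat.sqrt p + 1 ≤ 4 * q := by omega
      nlinarith
    rw [Real.sqrt_le_left (by positivity), pow_two]
    exact_mod_cast h1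
  have hsp : (√(p : ℝ)) * √p = p := Real.mul_self_sqrt (by positivity)
  have hq0 : (0 : ℝ) < q := by
    have : (50 : ℝ) ≤ q := by exact_mod_cast hq50
    linarith
  have hbr : (#{x : ZMod p | f.eval x ^ n = σ} : ℝ) * (2 * q) ≤ 3 * (2 * q) + p * (q + 4 + 1) := by
    exact_mod_cast hb
  have h1 : (p : ℝ) ≤ 4 * q * √p := by
    nlinarith [Real.sqrt_nonneg (p : ℝ)]
  have hsp1 : (1 : ℝ) ≤ √p := by
    rw [Real.one_le_sqrt]
    have : (10000 : ℝ) ≤ p := by exact_mod_cast hp4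
    linarith
  rw [← mul_le_mul_iff_left₀ (by positivity : (0 : ℝ) < 2 * q)]
  nlinarith

lemma quadraticChar_sum_le_of_eval_ne {f : (ZMod p)[X]} (hp4 : 10000 ≤ p) (hf : f.natDegree = 3)
    (hf0 : f.eval 0 ≠ 0) :
    |((∑ x : ZMod p, quadraticChar (ZMod p) (f.eval x) : ℤ) : ℝ)| ≤ 100 * √p := by
  classical
  have hpp : p.Prime := Fact.out
  obtain ⟨n, hn⟩ : ∃ n, p = 2 * n + 1 := by
    obtain ⟨n, hn⟩ := hpp.odd_of_ne_two (by omega)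
    exact ⟨n, hn⟩
  have hn2 : p / 2 = n := by omega
  have hchar : ringChar (ZMod p) ≠ 2 := by rw [ZMod.ringChar_zmod_n]; omega
  have hone : (1 : ZMod p) ≠ -1 := (Ring.neg_one_ne_one_of_char_ne_two hchar).symm
  have hpow : ∀ x : ZMod p, ((quadraticChar (ZMod p) x : ℤ) : ZMod p) = x ^ n := by
    intro x
    rw [quadraticChar_eq_pow_of_char_ne_two' hchar, ZMod.card, hn2]
  have hval : ∀ x : ZMod p, quadraticChar (ZMod p) (f.eval x) =
      (if f.eval x ^ n = 1 then 1 else 0) - (if f.eval x ^ n = -1 then 1 else 0) := by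
    intro x
    rw [← hpow]
    by_cases h0 : f.eval x = 0
    · rw [h0, MulChar.map_zero]; simp [zero_ne_one, (neg_ne_zero.2 (one_ne_zero)).symm]
    · rcases quadraticChar_dichotomy h0 with h | h
      · rw [h]; simp [hone]
      · rw [h]; simp [hone.symm]
  have hval2 : ∀ x : ZMod p, (1 : ℤ) = (if f.eval x ^ n = 1 then 1 else 0) +
      (if f.eval x ^ n = -1 then 1 else 0) + (if f.eval x = 0 then 1 else 0) := by
    intro x
    rw [← hpow]
    by_cases h0 : f.eval x = 0
    · rw [h0, MulChar.map_zero]; simp [zero_ne_one, (neg_ne_zero.2 (one_ne_zero)).symm]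
    · rcases quadraticChar_dichotomy h0 with h | h
      · rw [h]; simp [hone, h0]
      · rw [h]; simp [hone.symm, h0]
  have hfne : f ≠ 0 := by rintro rfl; simp at hf
  have hN0 : #{x : ZMod p | f.eval x = 0} ≤ 3 := by
    calc #{x : ZMod p | f.eval x = 0} ≤ f.roots.toFinset.card := by
          apply Finset.card_le_card
          intro x hx
          simp only [mem_filter, mem_univ, true_and] at hx
          rw [Multiset.mem_toFinset, mem_roots hfne]
          exact hx
      _ ≤ f.roots.card := Multiset.toFinset_card_le _
      _ ≤ 3 := hf ▸ card_roots' f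
  have hsum : (∑ x : ZMod p, quadraticChar (ZMod p) (f.eval x) : ℤ) =
      #{x : ZMod p | f.eval x ^ n = 1} - #{x : ZMod p | f.eval x ^ n = -1} := by
    rw [Finset.sum_congr rfl fun x _ => hval x, Finset.sum_sub_distrib, Finset.sum_boole,
      Finset.sum_boole]
  have hsum2 : (p : ℤ) = #{x : ZMod p | f.eval x ^ n = 1} + #{x : ZMod p | f.eval x ^ n = -1} +
      #{x : ZMod p | f.eval x = 0} := by
    have h1 : (p : ℤ) = ∑ x : ZMod p, (1 : ℤ) := by simp [ZMod.card]
    rw [h1, Finset.sum_congr rfl fun x _ => hval2 x, Finset.sum_add_distrib, Finset.sum_add_distrib,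
      Finset.sum_boole, Finset.sum_boole, Finset.sum_boole]
  have hb1 := card_pow_eq_le hn hp4 hf hf0 1
  have hb2 := card_pow_eq_le hn hp4 hf hf0 (-1)
  have hsum2' : (p : ℝ) = #{x : ZMod p | f.eval x ^ n = 1} + #{x : ZMod p | f.eval x ^ n = -1} +
      #{x : ZMod p | f.eval x = 0} := by exact_mod_cast hsum2
  have hN0' : (#{x : ZMod p | f.eval x = 0} : ℝ) ≤ 3 := by exact_mod_cast hN0
  have hsp1 : (100 : ℝ) ≤ √p := by
    rw [Real.le_sqrt' (by norm_num)]
    have : (10000 : ℝ) ≤ p := by exact_mod_cast hp4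
    linarith
  rw [hsum]
  push_cast
  rw [abs_le]
  constructor <;> linarith

/-- A square-root bound for the quadratic character sum of a cubic polynomial. -/
theorem quadraticChar_sum_cubic_le {f : (ZMod p)[X]} (hf : f.natDegree = 3) :
    |((∑ x : ZMod p, quadraticChar (ZMod p) (f.eval x) : ℤ) : ℝ)| ≤ 100 * √p := by
  classical
  rcases lt_or_ge p 10000 with hp | hp
  · have h1 : |((∑ x : ZMod p, quadraticChar (ZMod p) (f.eval x) : ℤ) : ℝ)| ≤ p := by
      push_cast
      refine (Finset.abs_sum_le_sum_abs _ _).trans ?_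
      have h2 : ∀ x : ZMod p, |((quadraticChar (ZMod p) (f.eval x) : ℤ) : ℝ)| ≤ 1 := by
        intro x
        by_cases h0 : f.eval x = 0
        · rw [h0, MulChar.map_zero]; simp
        · rcases quadraticChar_dichotomy h0 with h | h <;> rw [h] <;> simp
      refine (Finset.sum_le_sum fun x _ => h2 x).trans ?_
      simp [ZMod.card]
    have h2 : √(p : ℝ) ≤ 100 := by
      rw [Real.sqrt_le_left (by norm_num)]
      have : (p : ℝ) ≤ 10000 := by exact_mod_cast hp.le
      linarith
    have hsp : (√(p : ℝ)) * √p = p := Real.mul_self_sqrt (by positivity)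
    nlinarith [Real.sqrt_nonneg (p : ℝ)]
  · have hfne : f ≠ 0 := by rintro rfl; simp at hf
    obtain ⟨s, hs⟩ : ∃ s : ZMod p, f.eval s ≠ 0 := by
      by_contra hcon
      push Not at hcon
      have h1 : (univ : Finset (ZMod p)) ⊆ f.roots.toFinset := by
        intro x _
        rw [Multiset.mem_toFinset, mem_roots hfne]
        exact hcon x
      have h2 := (Finset.card_le_card h1).trans (Multiset.toFinset_card_le _)
      have h3 := card_roots' f
      rw [card_univ, ZMod.card] at h2
      omega
    have h1 := quadraticChar_sum_le_of_eval_ne (f := f.comp (X + C s)) hp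
      (by rw [natDegree_comp, natDegree_X_add_C, hf]) (by simpa using hs)
    have h2 : ∑ x : ZMod p, quadraticChar (ZMod p) ((f.comp (X + C s)).eval x) =
        ∑ x : ZMod p, quadraticChar (ZMod p) (f.eval x) :=
      Fintype.sum_equiv (Equiv.addRight s) _ _ fun x => by simp
    rwa [h2] at h1

end Stepanov

section Averages

/-- The average of `F` over a complete set of residues modulo `m`. -/
noncomputable def avg (m : ℕ) (F : ℤ → ℝ) : ℝ := (∑ n ∈ range m, F n) / m

lemma avg_const {m : ℕ} (hm : 0 < m) (c : ℝ) : avg m (fun _ => c) = c := by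
  have : (m : ℝ) ≠ 0 := by positivity
  simp [avg, this]

lemma avg_add (m : ℕ) (F G : ℤ → ℝ) : avg m (fun x => F x + G x) = avg m F + avg m G := by
  simp [avg, sum_add_distrib, add_div]

lemma avg_const_mul (m : ℕ) (c : ℝ) (F : ℤ → ℝ) : avg m (fun x => c * F x) = c * avg m F := by
  simp [avg, ← mul_sum, mul_div_assoc]

lemma avg_sum {ι : Type*} (m : ℕ) (s : Finset ι) (F : ι → ℤ → ℝ) :
    avg m (fun x => ∑ i ∈ s, F i x) = ∑ i ∈ s, avg m (F i) := by
  simp only [avg]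
  rw [sum_comm, sum_div]

lemma avg_mono {m : ℕ} {F G : ℤ → ℝ} (h : ∀ x, F x ≤ G x) : avg m F ≤ avg m G := by
  simp only [avg]
  gcongr
  exact h _

lemma avg_nonneg {m : ℕ} {F : ℤ → ℝ} (h : ∀ x, 0 ≤ F x) : 0 ≤ avg m F :=
  div_nonneg (sum_nonneg fun _ _ => h _) (Nat.cast_nonneg _)

lemma abs_avg_le_avg (m : ℕ) (F : ℤ → ℝ) : |avg m F| ≤ avg m (fun x => |F x|) := by
  simp only [avg, abs_div, Nat.abs_cast]
  gcongr
  exact abs_sum_le_sum_abs _ _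

lemma abs_avg_le {m : ℕ} (hm : 0 < m) {F : ℤ → ℝ} {c : ℝ} (h : ∀ x, |F x| ≤ c) :
    |avg m F| ≤ c :=
  (abs_avg_le_avg m F).trans ((avg_mono h).trans_eq (avg_const hm c))

lemma sum_range_eq_sum_zmod (m : ℕ) [NeZero m] (F : ℤ → ℝ) :
    ∑ n ∈ range m, F n = ∑ x : ZMod m, F (x.val : ℤ) := by
  refine sum_nbij' (fun n => (n : ZMod m)) (fun x => x.val) ?_ ?_ ?_ ?_ ?_
  · simp
  · intro x _; simpa using x.val_lt
  · intro n hn; exact ZMod.val_cast_of_lt (by simpa using hn)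
  · intro x _; simp
  · intro n hn; rw [ZMod.val_cast_of_lt (by simpa using hn)]

lemma avg_eq_sum_zmod (m : ℕ) [NeZero m] (F : ℤ → ℝ) :
    avg m F = (∑ x : ZMod m, F (x.val : ℤ)) / m := by
  rw [avg, sum_range_eq_sum_zmod]

lemma eq_of_modEq {m : ℕ} {F : ℤ → ℝ} (hF : Function.Periodic F (m : ℤ)) {x y : ℤ}
    (h : (m : ℤ) ∣ x - y) : F x = F y := by
  obtain ⟨k, hk⟩ := h
  have := (hF.int_mul k) y
  rw [← this]
  congr 1
  rw [Int.cast_id]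
  linarith [mul_comm k (m : ℤ)]

lemma eq_of_zmod_eq {m : ℕ} {F : ℤ → ℝ} (hF : Function.Periodic F (m : ℤ)) {x y : ℤ}
    (h : (x : ZMod m) = y) : F x = F y := by
  refine eq_of_modEq hF ?_
  rw [← ZMod.intCast_zmod_eq_zero_iff_dvd]
  simp [h]

lemma sum_zmod_comp {m : ℕ} [NeZero m] {F : ℤ → ℝ} (hF : Function.Periodic F (m : ℤ))
    (e : ZMod m ≃ ZMod m) (g : ZMod m → ℤ) (hg : ∀ x, (g x : ZMod m) = e x) :
    ∑ x : ZMod m, F (g x) = ∑ x : ZMod m, F (x.val : ℤ) := by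
  rw [← Equiv.sum_comp e fun x => F (x.val : ℤ)]
  refine sum_congr rfl fun x _ => eq_of_zmod_eq hF ?_
  simp [hg]

lemma avg_shift {m : ℕ} {F : ℤ → ℝ} (hF : Function.Periodic F (m : ℤ)) (c : ℤ) :
    avg m (fun x => F (x + c)) = avg m F := by
  rcases Nat.eq_zero_or_pos m with rfl | hm
  · simp [avg]
  have : NeZero m := ⟨hm.ne'⟩
  rw [avg_eq_sum_zmod, avg_eq_sum_zmod,
    sum_zmod_comp hF (Equiv.addRight (c : ZMod m)) (fun x => (x.val : ℤ) + c) (by simp)]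

lemma avg_mul_coprime {a b : ℕ} (hab : a.Coprime b) {F G : ℤ → ℝ}
    (hF : Function.Periodic F (a : ℤ)) (hG : Function.Periodic G (b : ℤ)) (ha : 0 < a) (hb : 0 < b) :
    avg (a * b) (fun x => F x * G x) = avg a F * avg b G := by
  have : NeZero a := ⟨ha.ne'⟩
  have : NeZero b := ⟨hb.ne'⟩
  have : NeZero (a * b) := ⟨(Nat.mul_pos ha hb).ne'⟩
  rw [avg_eq_sum_zmod, avg_eq_sum_zmod, avg_eq_sum_zmod, div_mul_div_comm, sum_mul_sum,
    ← Fintype.sum_prod_type', Nat.cast_mul]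
  congr 1
  refine Fintype.sum_equiv (ZMod.chineseRemainder hab).toEquiv _ _ fun x => ?_
  have h : ZMod.chineseRemainder hab x = ((x.val : ZMod a), (x.val : ZMod b)) := by
    conv_lhs => rw [← ZMod.natCast_zmod_val x]
    rw [map_natCast]; rfl
  congr 1
  · refine eq_of_zmod_eq hF ?_
    simp [h]
  · refine eq_of_zmod_eq hG ?_
    simp [h]

lemma avg_dvd {m n : ℕ} (hmn : m ∣ n) (hn : 0 < n) {F : ℤ → ℝ}
    (hF : Function.Periodic F (m : ℤ)) : avg n F = avg m F := by
  obtain ⟨k, rfl⟩ := hmn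
  have hm : 0 < m := Nat.pos_of_mul_pos_right hn
  have hk : 0 < k := Nat.pos_of_mul_pos_left hn
  have key : ∀ k : ℕ, ∑ n ∈ range (m * k), F n = k * ∑ n ∈ range m, F n := by
    intro k
    induction k with
    | zero => simp
    | succ k ih =>
      rw [Nat.mul_succ, sum_range_add, ih]
      push_cast
      rw [add_mul, one_mul]
      congr 1
      refine sum_congr rfl fun x _ => eq_of_modEq hF ?_
      simp
  have : (m : ℝ) ≠ 0 := by positivity
  have : (k : ℝ) ≠ 0 := by positivity
  rw [avg, avg, key]
  push_cast
  field_simp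

lemma periodic_prod {ι : Type*} (s : Finset ι) {F : ι → ℤ → ℝ} {m : ℤ}
    (h : ∀ i ∈ s, Function.Periodic (F i) m) : Function.Periodic (fun x => ∏ i ∈ s, F i x) m :=
  fun x => prod_congr rfl fun i hi => h i hi x

lemma periodic_sum {ι : Type*} (s : Finset ι) {F : ι → ℤ → ℝ} {m : ℤ}
    (h : ∀ i ∈ s, Function.Periodic (F i) m) : Function.Periodic (fun x => ∑ i ∈ s, F i x) m :=
  fun x => sum_congr rfl fun i hi => h i hi x

lemma periodic_of_dvd {m n : ℕ} (h : m ∣ n) {F : ℤ → ℝ} (hF : Function.Periodic F (m : ℤ)) :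
    Function.Periodic F (n : ℤ) := by
  intro x
  exact eq_of_modEq hF (by simpa using Int.natCast_dvd_natCast.2 h)

lemma periodic_shift {F : ℤ → ℝ} {m : ℤ} (hF : Function.Periodic F m) (c : ℤ) :
    Function.Periodic (fun x => F (x + c)) m := by
  intro x
  have := hF (x + c)
  simp only
  rw [← this]; congr 1; ring

lemma avg_prod {ι : Type*} (s : Finset ι) (μ : ι → ℕ) (F : ι → ℤ → ℝ)
    (hμ : ∀ i ∈ s, 0 < μ i) (hco : (s : Set ι).Pairwise fun i j => (μ i).Coprime (μ j))
    (hF : ∀ i ∈ s, Function.Periodic (F i) (μ i : ℤ)) :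
    avg (∏ i ∈ s, μ i) (fun x => ∏ i ∈ s, F i x) = ∏ i ∈ s, avg (μ i) (F i) := by
  classical
  induction s using Finset.induction_on with
  | empty => simp [avg]
  | insert i s hi ih =>
    have hcop : (μ i).Coprime (∏ j ∈ s, μ j) := Nat.Coprime.prod_right fun j hj =>
      hco (by simp) (by simp [hj]) (by rintro rfl; exact hi hj)
    have h2 : Function.Periodic (fun x => ∏ j ∈ s, F j x) ((∏ j ∈ s, μ j : ℕ) : ℤ) :=
      periodic_prod s fun j hj =>
        periodic_of_dvd (dvd_prod_of_mem μ hj) (hF j (mem_insert_of_mem hj))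
    simp only [prod_insert hi]
    rw [avg_mul_coprime hcop (hF i (mem_insert_self i s)) h2 (hμ i (mem_insert_self i s))
      (prod_pos fun j hj => hμ j (mem_insert_of_mem hj)),
      ih (fun j hj => hμ j (mem_insert_of_mem hj))
        (hco.mono (by simp))
        (fun j hj => hF j (mem_insert_of_mem hj))]

end Averages

section Correlation

/-- The Jacobi symbol as a real-valued function. -/
noncomputable def chi (p : ℕ) (n : ℤ) : ℝ := (jacobiSym n p : ℝ)

/-- The centred indicator function of the multiples of `p`. -/
noncomputable def kap (p : ℕ) (n : ℤ) : ℝ := (if (p : ℤ) ∣ n then 1 else 0) - 1 / p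

/-- A combination of `chi` and `kap` with coefficients depending on `p`. -/
noncomputable def phi (a b : ℕ → ℝ) (p : ℕ) (n : ℤ) : ℝ := a p * chi p n + b p * kap p n

lemma chi_periodic (p : ℕ) : Function.Periodic (chi p) (p : ℤ) := by
  intro x
  simp only [chi]
  rw [jacobiSym.mod_left (x + p), Int.add_emod_right, ← jacobiSym.mod_left]

lemma kap_periodic (p : ℕ) : Function.Periodic (kap p) (p : ℤ) := by
  intro x
  simp [kap]

lemma phi_periodic (a b : ℕ → ℝ) (p : ℕ) : Function.Periodic (phi a b p) (p : ℤ) := by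
  intro x
  simp only [phi, chi_periodic p x, kap_periodic p x]

lemma abs_chi_le (p : ℕ) (n : ℤ) : |chi p n| ≤ 1 := by
  rcases jacobiSym.trichotomy n p with h | h | h <;> simp [chi, h]

lemma abs_kap_le {p : ℕ} (hp : 0 < p) (n : ℤ) : |kap p n| ≤ 1 := by
  have h1 : (1 : ℝ) / p ≤ 1 := by
    rw [div_le_one (by positivity)]; exact_mod_cast hp
  have h0 : (0 : ℝ) ≤ 1 / p := by positivity
  rw [kap, abs_le]
  split_ifs <;> constructor <;> linarith

lemma avg_abs_kap_le {p : ℕ} (hp : 0 < p) : avg p (fun x => |kap p x|) ≤ 2 / p := by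
  have hp' : (0 : ℝ) < p := by exact_mod_cast hp
  have h1 : ∀ x : ℤ, |kap p x| ≤ (if (p : ℤ) ∣ x then 1 else 0) + 1 / p := by
    intro x
    have h0 : (0 : ℝ) ≤ 1 / p := by positivity
    rw [kap, abs_le]
    split_ifs <;> constructor <;> linarith
  refine (avg_mono h1).trans ?_
  rw [avg_add, avg_const hp]
  have : avg p (fun x => if (p : ℤ) ∣ x then (1 : ℝ) else 0) = 1 / p := by
    rw [avg]
    congr 1
    rw [sum_eq_single 0]
    · simp
    · intro n hn hn0
      rw [if_neg]
      intro hd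
      exact absurd (Nat.le_of_dvd (Nat.pos_of_ne_zero hn0) (Int.natCast_dvd_natCast.1 hd))
        (by simpa using hn)
    · simp [hp.ne']
  rw [this]
  apply le_of_eq; ring

lemma avg_abs_kap_shift_le {p : ℕ} (hp : 0 < p) (c : ℤ) :
    avg p (fun x => |kap p (x + c)|) ≤ 2 / p := by
  rw [avg_shift (F := fun x => |kap p x|) (fun x => by simp only [kap_periodic p x])]
  exact avg_abs_kap_le hp

lemma avg_kap {p : ℕ} (hp : 0 < p) : avg p (kap p) = 0 := by
  have : avg p (kap p) = avg p (fun x => if (p : ℤ) ∣ x then (1 : ℝ) else 0) + avg p fun _ => -(1 / p : ℝ) := by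
    rw [← avg_add]; rfl
  rw [this, avg_const hp, avg, sum_eq_single 0]
  · simp
  · intro n hn hn0
    rw [if_neg]
    intro hd
    exact absurd (Nat.le_of_dvd (Nat.pos_of_ne_zero hn0) (Int.natCast_dvd_natCast.1 hd))
      (by simpa using hn)
  · simp [hp.ne']

lemma chi_eq_quadraticChar (p : ℕ) [Fact p.Prime] (n : ℤ) :
    chi p n = (quadraticChar (ZMod p) (n : ZMod p) : ℝ) := by
  rw [chi, ← jacobiSym.legendreSym.to_jacobiSym, legendreSym]

lemma avg_chi_prod {ι : Type*} (p : ℕ) [Fact p.Prime] (J : Finset ι) (h : ι → ℤ) :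
    avg p (fun x => chi p x * ∏ j ∈ J, chi p (x + h j)) =
      ((∑ x : ZMod p, quadraticChar (ZMod p) (x * ∏ j ∈ J, (x + (h j : ZMod p))) : ℤ) : ℝ) / p := by
  rw [avg_eq_sum_zmod]
  congr 1
  push_cast
  refine sum_congr rfl fun x _ => ?_
  simp [chi_eq_quadraticChar, map_prod, map_mul, -quadraticChar_apply]

open Polynomial in
lemma abs_sum_quadraticChar_le {ι : Type*} {p : ℕ} [Fact p.Prime] (hp2 : p ≠ 2) (J : Finset ι)
    (hJ : #J ≤ 3) (h : ι → ZMod p) (h0 : ∀ j ∈ J, h j ≠ 0) :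
    |((∑ x : ZMod p, quadraticChar (ZMod p) (x * ∏ j ∈ J, (x + h j)) : ℤ) : ℝ)| ≤ 101 * √p ∧
    (#J ≤ 1 → |((∑ x : ZMod p, quadraticChar (ZMod p) (x * ∏ j ∈ J, (x + h j)) : ℤ) : ℝ)| ≤ 1) := by
  have hp1 : (1 : ℝ) ≤ √p := by
    rw [Real.one_le_sqrt]; exact_mod_cast (Fact.out : p.Prime).one_lt.le
  have hchar : ringChar (ZMod p) ≠ 2 := by rwa [ZMod.ringChar_zmod_n]
  have hinv : ∀ x : ZMod p, quadraticChar (ZMod p) x⁻¹ = quadraticChar (ZMod p) x := by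
    intro x
    rcases eq_or_ne x 0 with rfl | hx
    · simp
    · have h1 : quadraticChar (ZMod p) x⁻¹ * quadraticChar (ZMod p) x = 1 := by
        rw [← map_mul, inv_mul_cancel₀ hx, map_one]
      have h2 := quadraticChar_sq_one hx
      have : quadraticChar (ZMod p) x⁻¹ * quadraticChar (ZMod p) x ^ 2 = quadraticChar (ZMod p) x := by
        rw [sq, ← mul_assoc, h1, one_mul]
      rwa [h2, mul_one] at this
  have key : Odd #J → ∑ x : ZMod p, quadraticChar (ZMod p) (x * ∏ j ∈ J, (x + h j)) =
      ∑ y : ZMod p, quadraticChar (ZMod p) (∏ j ∈ J, (1 + h j * y)) - 1 := by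
    intro hodd
    have e1 : ∑ x : ZMod p, quadraticChar (ZMod p) (x * ∏ j ∈ J, (x + h j)) =
        ∑ x : ZMod p, quadraticChar (ZMod p) (x⁻¹ * ∏ j ∈ J, (x⁻¹ + h j)) :=
      (Equiv.sum_comp (Function.Involutive.toPerm _ (inv_involutive (G := ZMod p)))
        (fun x => quadraticChar (ZMod p) (x * ∏ j ∈ J, (x + h j)))).symm
    rw [e1, ← add_sum_erase _ _ (mem_univ (0 : ZMod p)),
      ← add_sum_erase univ (fun y => quadraticChar (ZMod p) (∏ j ∈ J, (1 + h j * y)))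
        (mem_univ (0 : ZMod p))]
    simp only [inv_zero, zero_mul, mul_zero, add_zero, prod_const_one, map_one, MulChar.map_zero,
      zero_add, add_sub_cancel_left]
    refine sum_congr rfl fun y hy => ?_
    have hy0 : y ≠ 0 := by simpa using hy
    have e2 : ∏ j ∈ J, (1 + h j * y) = y ^ #J * ∏ j ∈ J, (y⁻¹ + h j) := by
      rw [← prod_const, ← prod_mul_distrib]
      refine prod_congr rfl fun j _ => ?_
      field_simp
    rw [e2, map_mul, map_mul, map_pow, hinv]
    congr 1
    obtain ⟨k, hk⟩ := hodd
    rw [hk, pow_succ, pow_mul, quadraticChar_sq_one hy0, one_pow, one_mul]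
  have c1 : #J ≤ 1 → |((∑ x : ZMod p, quadraticChar (ZMod p) (x * ∏ j ∈ J, (x + h j)) : ℤ) : ℝ)| ≤ 1 := by
    intro hc
    rcases Nat.le_one_iff_eq_zero_or_eq_one.1 hc with h1 | h1
    · rw [card_eq_zero] at h1
      subst h1
      simp only [prod_empty, mul_one, quadraticChar_sum_zero hchar]
      simp
    · rw [key (by rw [h1]; decide)]
      obtain ⟨j, rfl⟩ := card_eq_one.1 h1
      have hj := h0 j (by simp)
      have e3 : ∑ y : ZMod p, quadraticChar (ZMod p) (1 + h j * y) =
          ∑ y : ZMod p, quadraticChar (ZMod p) y :=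
        ((Equiv.mulLeft₀ (h j) hj).trans (Equiv.addLeft 1)).sum_comp
          (fun y => quadraticChar (ZMod p) y)
      simp only [prod_singleton, e3, quadraticChar_sum_zero hchar]
      simp
  refine ⟨?_, c1⟩
  have hcase : #J ≤ 1 ∨ #J = 2 ∨ #J = 3 := by omega
  rcases hcase with hc | hc | hc
  · linarith [c1 hc]
  · have hf : (X * ∏ j ∈ J, (X + C (h j))).natDegree = 3 := by
      rw [natDegree_mul X_ne_zero (monic_prod_of_monic _ _ fun j _ => monic_X_add_C _).ne_zero,
        natDegree_prod_of_monic _ _ fun j _ => monic_X_add_C _]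
      simp [hc]
    have := quadraticChar_sum_cubic_le hf
    simp only [eval_mul, eval_prod, eval_X, eval_add, eval_C] at this
    linarith
  · rw [key (by rw [hc]; decide)]
    have hne : ∀ j ∈ J, (1 + C (h j) * X).natDegree = 1 := fun j hj => by
      rw [add_comm, ← C_1, natDegree_linear (h0 j hj)]
    have hf : (∏ j ∈ J, (1 + C (h j) * X)).natDegree = 3 := by
      rw [natDegree_prod _ _ fun j hj => ?_, sum_congr rfl hne]
      · simp [hc]
      · intro h; simpa [h] using hne j hj
    have := quadraticChar_sum_cubic_le hf
    simp only [eval_mul, eval_prod, eval_X, eval_add, eval_C, eval_one] at this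
    push_cast at this ⊢
    rw [abs_le] at this ⊢
    constructor <;> linarith

lemma abs_prod_le_pow {ι : Type*} (J : Finset ι) (v : ι → ℝ) {c : ℝ} (hv : ∀ j ∈ J, |v j| ≤ c) :
    |∏ j ∈ J, v j| ≤ c ^ #J := by
  rw [abs_prod]
  refine (prod_le_prod (fun _ _ => abs_nonneg _) hv).trans_eq ?_
  rw [prod_const]

lemma abs_prod_sub_prod_le {ι : Type*} [DecidableEq ι] (J : Finset ι) (u v : ι → ℝ) {c : ℝ} (hc : 1 ≤ c)
    (hu : ∀ j ∈ J, |u j| ≤ c) (hv : ∀ j ∈ J, |v j| ≤ c) :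
    |∏ j ∈ J, u j - ∏ j ∈ J, v j| ≤ c ^ #J * ∑ j ∈ J, |u j - v j| := by
  induction J using Finset.induction_on with
  | empty => simp
  | insert i s hi ih =>
    have ih' := ih (fun j hj => hu j (mem_insert_of_mem hj)) (fun j hj => hv j (mem_insert_of_mem hj))
    rw [prod_insert hi, prod_insert hi, sum_insert hi, card_insert_of_notMem hi]
    have e : u i * ∏ j ∈ s, u j - v i * ∏ j ∈ s, v j =
      u i * (∏ j ∈ s, u j - ∏ j ∈ s, v j) + (u i - v i) * ∏ j ∈ s, v j := by ring
    have hpv : |∏ j ∈ s, v j| ≤ c ^ #s := by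
      exact abs_prod_le_pow s v fun j hj => hv j (mem_insert_of_mem hj)
    have hs : 0 ≤ ∑ j ∈ s, |u j - v j| := sum_nonneg fun _ _ => abs_nonneg _
    rw [e]
    refine (abs_add_le _ _).trans ?_
    rw [abs_mul, abs_mul]
    have h1 : |u i| * |∏ j ∈ s, u j - ∏ j ∈ s, v j| ≤ c * (c ^ #s * ∑ j ∈ s, |u j - v j|) := by
      gcongr
      exact hu i (mem_insert_self i s)
    have h2 : |u i - v i| * |∏ j ∈ s, v j| ≤ |u i - v i| * (c * c ^ #s) := by
      gcongr
      refine hpv.trans ?_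
      exact le_mul_of_one_le_left (by positivity) hc
    rw [pow_succ]
    nlinarith

section
variable {a b : ℕ → ℝ} (ha : ∀ p, |a p| ≤ 2) (hb : ∀ p, |b p| ≤ 2)
include ha hb

lemma abs_phi_le {p : ℕ} (hp : 0 < p) (n : ℤ) : |phi a b p n| ≤ 4 := by
  rw [phi]
  refine (abs_add_le _ _).trans ?_
  rw [abs_mul, abs_mul]
  have h1 : |a p| * |chi p n| ≤ 2 * 1 := by gcongr; exacts [ha p, abs_chi_le p n]
  have h2 : |b p| * |kap p n| ≤ 2 * 1 := by gcongr; exacts [hb p, abs_kap_le hp n]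
  linarith

lemma abs_avg_prod_phi_sub_le {ι : Type*} [DecidableEq ι] {p : ℕ} (hp : 0 < p) (J : Finset ι)
    (hJ : #J ≤ 4) (h : ι → ℤ) :
    |avg p (fun x => ∏ j ∈ J, phi a b p (x + h j)) -
      a p ^ #J * avg p (fun x => ∏ j ∈ J, chi p (x + h j))| ≤ 4096 / p := by
  have hp' : (0 : ℝ) < p := by exact_mod_cast hp
  have e : avg p (fun x => ∏ j ∈ J, phi a b p (x + h j)) -
      a p ^ #J * avg p (fun x => ∏ j ∈ J, chi p (x + h j)) =
      avg p (fun x => ∏ j ∈ J, phi a b p (x + h j) - ∏ j ∈ J, (a p * chi p (x + h j))) := by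
    simp only [sub_eq_add_neg, avg_add, prod_mul_distrib, prod_const]
    rw [← neg_one_mul (a p ^ #J * _), ← avg_const_mul, ← avg_const_mul]
    simp only [neg_one_mul]
  rw [e]
  refine (abs_avg_le_avg _ _).trans ?_
  have h1 : ∀ x : ℤ, |∏ j ∈ J, phi a b p (x + h j) - ∏ j ∈ J, (a p * chi p (x + h j))| ≤
      512 * ∑ j ∈ J, |kap p (x + h j)| := by
    intro x
    refine (abs_prod_sub_prod_le J _ _ (c := 4) (by norm_num)
      (fun j _ => abs_phi_le ha hb hp _) (fun j _ => ?_)).trans ?_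
    · rw [abs_mul]
      have : |a p| * |chi p (x + h j)| ≤ 2 * 1 := by gcongr; exacts [ha p, abs_chi_le p _]
      linarith
    · have h2 : ∀ j, |phi a b p (x + h j) - a p * chi p (x + h j)| ≤ 2 * |kap p (x + h j)| := by
        intro j
        rw [phi, add_sub_cancel_left, abs_mul]
        gcongr
        exact hb p
      calc (4 : ℝ) ^ #J * ∑ j ∈ J, |phi a b p (x + h j) - a p * chi p (x + h j)|
          ≤ 4 ^ 4 * ∑ j ∈ J, 2 * |kap p (x + h j)| := by
            gcongr with j hj
            · norm_num
            · exact h2 j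
        _ = _ := by rw [← mul_sum]; ring
  refine (avg_mono h1).trans ?_
  rw [avg_const_mul, avg_sum]
  calc 512 * ∑ j ∈ J, avg p (fun x => |kap p (x + h j)|) ≤ 512 * ∑ j ∈ J, (2 / p : ℝ) := by
        gcongr with j hj
        exact avg_abs_kap_shift_le hp _
    _ = 512 * (#J * (2 / p)) := by rw [sum_const, nsmul_eq_mul]
    _ ≤ 512 * (4 * (2 / p)) := by gcongr; exact_mod_cast hJ
    _ = 4096 / p := by ring

omit ha hb in
lemma abs_avg_prod_chi_le {ι : Type*} [DecidableEq ι] {p : ℕ} (hp : p.Prime) (hp2 : p ≠ 2)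
    (J : Finset ι) (hJ : #J ≤ 4) (h : ι → ℤ) {i : ι} (hi : i ∈ J)
    (hiso : ∀ j ∈ J, j ≠ i → ¬ (p : ℤ) ∣ h j - h i) :
    |avg p (fun x => ∏ j ∈ J, chi p (x + h j))| ≤ 101 / √p ∧
    (#J ≤ 2 → |avg p (fun x => ∏ j ∈ J, chi p (x + h j))| ≤ 1 / p) := by
  have := Fact.mk hp
  have hp' : (0 : ℝ) < p := by exact_mod_cast hp.pos
  have hcard : #(J.erase i) + 1 = #J := card_erase_add_one hi
  have e : avg p (fun x => ∏ j ∈ J, chi p (x + h j)) =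
      avg p (fun x => chi p x * ∏ j ∈ J.erase i, chi p (x + (h j - h i))) := by
    rw [← avg_shift (F := fun x => ∏ j ∈ J, chi p (x + h j))
      (periodic_prod J fun j _ => periodic_shift (chi_periodic p) _) (-h i)]
    congr 1
    ext x
    rw [← mul_prod_erase J _ hi]
    congr 1
    · congr 1; ring
    · refine prod_congr rfl fun j _ => ?_
      congr 1; ring
  rw [e, avg_chi_prod p (J.erase i) fun j => h j - h i]
  have key := abs_sum_quadraticChar_le hp2 (J.erase i) (by omega) (fun j => ((h j - h i : ℤ) : ZMod p))
    (fun j hj => by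
      rw [Ne, ZMod.intCast_zmod_eq_zero_iff_dvd]
      exact hiso j (mem_of_mem_erase hj) (ne_of_mem_erase hj))
  rw [abs_div, abs_of_pos hp']
  constructor
  · rw [div_le_div_iff₀ hp' (by positivity)]
    have h1 := key.1
    have h2 : √(p : ℝ) * √p = p := Real.mul_self_sqrt hp'.le
    nlinarith [Real.sqrt_nonneg (p : ℝ)]
  · intro hc
    gcongr
    exact key.2 (by omega)

lemma abs_avg_prod_phi_le {ι : Type*} [DecidableEq ι] {p : ℕ} (hp : p.Prime) (hp2 : p ≠ 2)
    (J : Finset ι) (hJ : #J ≤ 4) (h : ι → ℤ) {i : ι} (hi : i ∈ J)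
    (hiso : ∀ j ∈ J, j ≠ i → ¬ (p : ℤ) ∣ h j - h i) :
    |avg p (fun x => ∏ j ∈ J, phi a b p (x + h j))| ≤ 6000 / √p ∧
    (#J ≤ 2 → |avg p (fun x => ∏ j ∈ J, phi a b p (x + h j))| ≤ 6000 / p) := by
  have hp' : (0 : ℝ) < p := by exact_mod_cast hp.pos
  have h1 := abs_avg_prod_phi_sub_le ha hb hp.pos J hJ h
  have h2 := abs_avg_prod_chi_le hp hp2 J hJ h hi hiso
  set X := avg p (fun x => ∏ j ∈ J, phi a b p (x + h j))
  set Y := avg p (fun x => ∏ j ∈ J, chi p (x + h j))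
  have ha4 : |a p ^ #J| ≤ 16 := by
    rw [abs_pow]
    calc |a p| ^ #J ≤ 2 ^ #J := by gcongr; exact ha p
      _ ≤ 2 ^ 4 := by gcongr; norm_num
      _ = 16 := by norm_num
  have h3 : |X| ≤ 4096 / p + 16 * |Y| := by
    have : X = (X - a p ^ #J * Y) + a p ^ #J * Y := by ring
    rw [this]
    refine (abs_add_le _ _).trans ?_
    rw [abs_mul (a p ^ #J) Y]
    gcongr
  have hsq : (4096 : ℝ) / p ≤ 4096 / √p := by
    gcongr
    rw [Real.sqrt_le_left hp'.le]
    have : (1 : ℝ) ≤ p := by exact_mod_cast hp.one_lt.le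
    nlinarith
  constructor
  · have := h2.1
    calc |X| ≤ 4096 / p + 16 * |Y| := h3
      _ ≤ 4096 / √p + 16 * (101 / √p) := by gcongr
      _ = 5712 / √p := by ring
      _ ≤ 6000 / √p := by gcongr; norm_num
  · intro hc
    have := h2.2 hc
    calc |X| ≤ 4096 / p + 16 * |Y| := h3
      _ ≤ 4096 / p + 16 * (1 / p) := by gcongr
      _ = 4112 / p := by ring
      _ ≤ 6000 / p := by gcongr; norm_num

omit ha hb in
lemma avg_phi {p : ℕ} (hp : p.Prime) (hp2 : p ≠ 2) : avg p (phi a b p) = 0 := by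
  have := Fact.mk hp
  have hchar : ringChar (ZMod p) ≠ 2 := by rwa [ZMod.ringChar_zmod_n]
  have e : avg p (phi a b p) = a p * avg p (chi p) + b p * avg p (kap p) := by
    rw [← avg_const_mul, ← avg_const_mul, ← avg_add]; rfl
  have h1 : avg p (chi p) = 0 := by
    have := avg_chi_prod p (∅ : Finset ℕ) fun _ => 0
    simp only [prod_empty, mul_one, quadraticChar_sum_zero hchar] at this
    simpa using this
  rw [e, h1, avg_kap hp.pos]
  simp

lemma abs_avg_prod_phi_le_pow {ι : Type*} {p : ℕ} (hp : 0 < p) (J : Finset ι) (hJ : #J ≤ 4)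
    (h : ι → ℤ) : |avg p (fun x => ∏ j ∈ J, phi a b p (x + h j))| ≤ 256 := by
  refine abs_avg_le hp fun x => ?_
  calc |∏ j ∈ J, phi a b p (x + h j)| ≤ 4 ^ #J :=
        abs_prod_le_pow J _ fun j _ => abs_phi_le ha hb hp _
    _ ≤ 4 ^ 4 := by gcongr; norm_num
    _ = 256 := by norm_num

end

end Correlation

section FourthMoment

/-- The product of the local functions `phi` over a set of primes. -/
noncomputable def Phi (a b : ℕ → ℝ) (D : Finset ℕ) (n : ℤ) : ℝ := ∏ p ∈ D, phi a b p n

/-- The sum of `F` over the window of length `H` starting at `y`. -/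
noncomputable def win (F : ℤ → ℝ) (H : ℕ) (y : ℤ) : ℝ := ∑ h ∈ range H, F (y + h)

lemma Phi_periodic (a b : ℕ → ℝ) (D : Finset ℕ) :
    Function.Periodic (Phi a b D) ((∏ p ∈ D, p : ℕ) : ℤ) :=
  periodic_prod D fun _ hp => periodic_of_dvd (dvd_prod_of_mem (fun p => p) hp) (phi_periodic a b _)

lemma win_periodic {F : ℤ → ℝ} {m : ℤ} (hF : Function.Periodic F m) (H : ℕ) :
    Function.Periodic (win F H) m :=
  periodic_sum _ fun _ _ => periodic_shift hF _

lemma avg_prod_Phi {ι : Type*} (a b : ℕ → ℝ) {D : Finset ℕ} (hD : ∀ p ∈ D, p.Prime) (J : Finset ι)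
    (h : ι → ℤ) : avg (∏ p ∈ D, p) (fun x => ∏ j ∈ J, Phi a b D (x + h j)) =
      ∏ p ∈ D, avg p (fun x => ∏ j ∈ J, phi a b p (x + h j)) := by
  rw [← avg_prod D (fun p => p) (fun p x => ∏ j ∈ J, phi a b p (x + h j))]
  · congr 1
    ext x
    simp only [Phi]
    rw [prod_comm]
  · exact fun p hp => (hD p hp).pos
  · intro p hp q hq hpq
    exact (Nat.coprime_primes (hD p hp) (hD q hq)).2 hpq
  · exact fun p _ => periodic_prod J fun j _ => periodic_shift (phi_periodic a b p) _

lemma exists_isolated_or_paired (p : ℕ) (v : Fin 4 → ℤ) :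
    (∃ i, ∀ j ∈ (univ : Finset (Fin 4)), j ≠ i → ¬ (p : ℤ) ∣ v j - v i) ∨
    ((p : ℤ) ∣ v 0 - v 1 ∧ (p : ℤ) ∣ v 2 - v 3) ∨ ((p : ℤ) ∣ v 0 - v 2 ∧ (p : ℤ) ∣ v 1 - v 3) ∨
    ((p : ℤ) ∣ v 0 - v 3 ∧ (p : ℤ) ∣ v 1 - v 2) := by
  have key : ∀ i j, (p : ℤ) ∣ v i - v j ↔ (v i : ZMod p) = v j := by
    intro i j
    rw [← ZMod.intCast_zmod_eq_zero_iff_dvd, Int.cast_sub, sub_eq_zero]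
  simp only [key, mem_univ, true_imp_iff]
  rw [or_iff_not_imp_left]
  intro h
  push Not at h
  have h0 := h 0
  have h1 := h 1
  have h2 := h 2
  have h3 := h 3
  simp only [Fin.exists_fin_succ] at h0 h1 h2 h3
  generalize hA : (v 0 : ZMod p) = A at *
  generalize hB : (v 1 : ZMod p) = B at *
  generalize hC : (v 2 : ZMod p) = C at *
  generalize hE : (v 3 : ZMod p) = E at *
  simp [hB, hC, hE] at h0 h1 h2 h3
  grind

lemma sum_dvd_sub_le (q H : ℕ) (hq : 0 < q) :
    ∑ a ∈ range H, ∑ b ∈ range H, (if (q : ℤ) ∣ (a : ℤ) - b then (1 : ℝ) else 0) ≤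
      H * (H / q + 1) := by
  have h1 : ∀ a : ℕ, ∑ b ∈ range H, (if (q : ℤ) ∣ (a : ℤ) - b then (1 : ℝ) else 0) ≤ H / q + 1 := by
    intro a
    rw [sum_boole]
    have : #{b ∈ range H | (q : ℤ) ∣ (a : ℤ) - (b : ℕ)} = H.count (· ≡ a [MOD q]) := by
      rw [Nat.count_eq_card_filter_range]
      congr 1
      refine filter_congr fun b _ => ?_
      rw [← Nat.modEq_iff_dvd]
    rw [this, Nat.count_modEq_card _ hq]
    have h2 : ((H / q : ℕ) : ℝ) ≤ H / q := Nat.cast_div_le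
    split_ifs <;> push_cast <;> linarith
  calc _ ≤ ∑ a ∈ range H, ((H : ℝ) / q + 1) := sum_le_sum fun a _ => h1 a
    _ = _ := by simp [mul_add]

/-- The majorant attached to one pairing in the fourth moment. -/
noncomputable def pairMaj (D : Finset ℕ) (H : ℕ) (a b c d : ℕ) : ℝ :=
  (if a = b then 1 else 0) * (if c = d then 1 else 0) +
    (√((∏ p ∈ D, p : ℕ) : ℝ))⁻¹ * ∑ E ∈ D.powerset with ∏ p ∈ E, p ≤ H,
      ((∏ p ∈ E, p : ℕ) * √((∏ p ∈ E, p : ℕ) : ℝ)) *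
      ((if ((∏ p ∈ E, p : ℕ) : ℤ) ∣ (a : ℤ) - b then 1 else 0) *
        (if ((∏ p ∈ E, p : ℕ) : ℤ) ∣ (c : ℤ) - d then 1 else 0))

lemma pairMaj_nonneg (D : Finset ℕ) (H a b c d : ℕ) : 0 ≤ pairMaj D H a b c d := by
  unfold pairMaj
  positivity

lemma sum_pairMaj_le (D : Finset ℕ) (hD : ∀ p ∈ D, p.Prime) (H : ℕ) :
    ∑ a ∈ range H, ∑ b ∈ range H, ∑ c ∈ range H, ∑ d ∈ range H, pairMaj D H a b c d ≤
      (H : ℝ) ^ 2 + 4 * 2 ^ #D * (√((∏ p ∈ D, p : ℕ) : ℝ))⁻¹ * H ^ 4 := by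
  have hfac : ∀ f : ℕ → ℕ → ℝ, ∑ a ∈ range H, ∑ b ∈ range H, ∑ c ∈ range H, ∑ d ∈ range H,
      f a b * f c d = (∑ a ∈ range H, ∑ b ∈ range H, f a b) ^ 2 := by
    intro f
    rw [sq, sum_mul]
    refine sum_congr rfl fun a _ => ?_
    rw [sum_mul]
    refine sum_congr rfl fun b _ => ?_
    rw [mul_sum]
    refine sum_congr rfl fun c _ => ?_
    rw [mul_sum]
  unfold pairMaj
  simp only [sum_add_distrib]
  rw [hfac fun a b => if a = b then 1 else 0]
  have e1 : ∑ a ∈ range H, ∑ b ∈ range H, (if a = b then (1 : ℝ) else 0) = H := by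
    have : ∀ a ∈ range H, ∑ b ∈ range H, (if a = b then (1 : ℝ) else 0) = 1 := by
      intro a ha
      rw [sum_ite_eq, if_pos ha]
    rw [sum_congr rfl this]; simp
  rw [e1]
  gcongr
  have e2 : ∑ a ∈ range H, ∑ b ∈ range H, ∑ c ∈ range H, ∑ d ∈ range H,
      (√((∏ p ∈ D, p : ℕ) : ℝ))⁻¹ * ∑ E ∈ D.powerset with ∏ p ∈ E, p ≤ H,
      ((∏ p ∈ E, p : ℕ) * √((∏ p ∈ E, p : ℕ) : ℝ)) *
      ((if ((∏ p ∈ E, p : ℕ) : ℤ) ∣ (a : ℤ) - b then (1 : ℝ) else 0) *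
        (if ((∏ p ∈ E, p : ℕ) : ℤ) ∣ (c : ℤ) - d then 1 else 0)) =
      (√((∏ p ∈ D, p : ℕ) : ℝ))⁻¹ * ∑ E ∈ D.powerset with ∏ p ∈ E, p ≤ H,
      ((∏ p ∈ E, p : ℕ) * √((∏ p ∈ E, p : ℕ) : ℝ)) *
      (∑ a ∈ range H, ∑ b ∈ range H,
        (if ((∏ p ∈ E, p : ℕ) : ℤ) ∣ (a : ℤ) - b then (1 : ℝ) else 0)) ^ 2 := by
    simp only [← mul_sum]
    congr 1
    rw [sum_congr rfl fun a _ => sum_congr rfl fun b _ => sum_congr rfl fun c _ => sum_comm,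
      sum_congr rfl fun a _ => sum_congr rfl fun b _ => sum_comm,
      sum_congr rfl fun a _ => sum_comm, sum_comm]
    refine sum_congr rfl fun E _ => ?_
    simp only [← mul_sum]
    congr 1
    simp only [mul_sum]
    exact hfac fun a b => if ((∏ p ∈ E, p : ℕ) : ℤ) ∣ (a : ℤ) - b then (1 : ℝ) else 0
  rw [e2]
  have h3 : ∑ E ∈ D.powerset with ∏ p ∈ E, p ≤ H,
      ((∏ p ∈ E, p : ℕ) * √((∏ p ∈ E, p : ℕ) : ℝ)) *
      (∑ a ∈ range H, ∑ b ∈ range H,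
        (if ((∏ p ∈ E, p : ℕ) : ℤ) ∣ (a : ℤ) - b then (1 : ℝ) else 0)) ^ 2 ≤
      ∑ E ∈ D.powerset with ∏ p ∈ E, p ≤ H, 4 * (H : ℝ) ^ 4 := by
    refine sum_le_sum fun E hE => ?_
    rw [mem_filter, mem_powerset] at hE
    have hq : 0 < ∏ p ∈ E, p := prod_pos fun p hp => (hD p (hE.1 hp)).pos
    set q := ∏ p ∈ E, p
    have hq1 : (1 : ℝ) ≤ q := by exact_mod_cast hq
    have hqH : (q : ℝ) ≤ H := by exact_mod_cast hE.2
    have h4 := sum_dvd_sub_le q H hq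
    have h5 : (H : ℝ) * (H / q + 1) ≤ 2 * H ^ 2 / q := by
      rw [le_div_iff₀ (by positivity)]
      have : (H : ℝ) * (H / q + 1) * q = H * (H + q) := by field_simp
      rw [this]
      nlinarith
    have h0 : 0 ≤ ∑ a ∈ range H, ∑ b ∈ range H,
        (if (q : ℤ) ∣ (a : ℤ) - b then (1 : ℝ) else 0) := by positivity
    have hsq : √(q : ℝ) ≤ q := by
      rw [Real.sqrt_le_left (by positivity)]; nlinarith
    calc (q * √(q : ℝ)) * (∑ a ∈ range H, ∑ b ∈ range H,
        (if (q : ℤ) ∣ (a : ℤ) - b then (1 : ℝ) else 0)) ^ 2 ≤ (q * q) * (2 * H ^ 2 / q) ^ 2 := by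
          gcongr
          exact h4.trans h5
      _ = 4 * (H : ℝ) ^ 4 := by field_simp; ring
  have h4 : ∑ E ∈ D.powerset with ∏ p ∈ E, p ≤ H, 4 * (H : ℝ) ^ 4 ≤ 2 ^ #D * (4 * (H : ℝ) ^ 4) := by
    rw [sum_const, nsmul_eq_mul]
    gcongr
    have := card_filter_le D.powerset fun E => ∏ p ∈ E, p ≤ H
    rw [card_powerset] at this
    exact_mod_cast this
  calc _ ≤ (√((∏ p ∈ D, p : ℕ) : ℝ))⁻¹ * (2 ^ #D * (4 * (H : ℝ) ^ 4)) := by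
        gcongr
        exact h3.trans h4
    _ = _ := by ring

lemma prod_ite_sqrt (D : Finset ℕ) (P : ℕ → Prop) [DecidablePred P] :
    ∏ p ∈ D, (if P p then √(p : ℝ) else 1) = √((∏ p ∈ D with P p, p : ℕ) : ℝ) := by
  rw [← prod_filter, Nat.cast_prod, Real.sqrt_prod]
  exact fun _ _ => by positivity

lemma prod_dvd_sub {D : Finset ℕ} (hD : ∀ p ∈ D, p.Prime) (x y : ℤ) :
    (((∏ p ∈ D with (((p : ℕ) : ℤ) ∣ x ∧ ((p : ℕ) : ℤ) ∣ y), p : ℕ) : ℤ) ∣ x ∧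
    ((∏ p ∈ D with (((p : ℕ) : ℤ) ∣ x ∧ ((p : ℕ) : ℤ) ∣ y), p : ℕ) : ℤ) ∣ y) := by
  have key : ∀ w : ℤ, (∀ p ∈ D, ((p : ℤ) ∣ x ∧ (p : ℤ) ∣ y) → (p : ℤ) ∣ w) →
      ((∏ p ∈ D with (((p : ℕ) : ℤ) ∣ x ∧ ((p : ℕ) : ℤ) ∣ y), p : ℕ) : ℤ) ∣ w := by
    intro w hw
    rw [Int.natCast_dvd]
    refine Finset.prod_primes_dvd _ (fun p hp => ?_) fun p hp => ?_
    · exact (hD p (mem_filter.1 hp).1).prime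
    · rw [← Int.natCast_dvd]
      exact hw p (mem_filter.1 hp).1 (mem_filter.1 hp).2
  exact ⟨key x fun p _ h => h.1, key y fun p _ h => h.2⟩

lemma sqrt_mul_three_le {x y z : ℝ} (hx : 0 ≤ x) (hy : 0 ≤ y) (hz : 0 ≤ z) :
    √x * √y * √z ≤ x * √x + y * √y + z * √z := by
  have e : ∀ t : ℝ, 0 ≤ t → t * √t = √t ^ 3 := by
    intro t ht
    rw [pow_succ, Real.sq_sqrt ht]
  rw [e x hx, e y hy, e z hz]
  have h1 := Real.sqrt_nonneg x
  have h2 := Real.sqrt_nonneg y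
  have h3 := Real.sqrt_nonneg z
  set u := √x
  set v := √y
  set w := √z
  nlinarith [mul_nonneg h1 (sq_nonneg (v - w)), mul_nonneg h2 (sq_nonneg (u - w)),
    mul_nonneg h3 (sq_nonneg (u - v)), mul_nonneg h1 (sq_nonneg (u - v)),
    mul_nonneg h1 (sq_nonneg (u - w)), mul_nonneg h2 (sq_nonneg (u - v)),
    mul_nonneg h2 (sq_nonneg (v - w)), mul_nonneg h3 (sq_nonneg (w - v)),
    mul_nonneg h3 (sq_nonneg (w - u)), pow_nonneg h1 3, pow_nonneg h2 3, pow_nonneg h3 3,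
    mul_nonneg (mul_nonneg h1 h2) h3]

lemma le_pairMaj {D : Finset ℕ} (hD : ∀ p ∈ D, p.Prime) {H a b c d : ℕ} (ha : a < H) (hb : b < H)
    (hc : c < H) (hd : d < H) (hne : ¬ (a = b ∧ c = d)) :
    (√((∏ p ∈ D, p : ℕ) : ℝ))⁻¹ *
      (((∏ p ∈ D with (((p : ℕ) : ℤ) ∣ (a : ℤ) - b ∧ ((p : ℕ) : ℤ) ∣ (c : ℤ) - d), p : ℕ) : ℝ) *
        √((∏ p ∈ D with (((p : ℕ) : ℤ) ∣ (a : ℤ) - b ∧ ((p : ℕ) : ℤ) ∣ (c : ℤ) - d), p : ℕ) : ℝ)) ≤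
      pairMaj D H a b c d := by
  obtain ⟨h1, h2⟩ := prod_dvd_sub hD ((a : ℤ) - b) ((c : ℤ) - d)
  set E := {p ∈ D | ((p : ℕ) : ℤ) ∣ (a : ℤ) - b ∧ ((p : ℕ) : ℤ) ∣ (c : ℤ) - d} with hE
  have hqH : ∏ p ∈ E, p ≤ H := by
    by_cases hab : a = b
    · have hcd : (c : ℤ) - d ≠ 0 := by
        intro h; exact hne ⟨hab, by omega⟩
      have := Int.le_of_dvd (abs_pos.2 hcd) ((dvd_abs _ _).2 h2)
      have h3 : |(c : ℤ) - d| ≤ H := by rw [abs_le]; omega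
      omega
    · have hab' : (a : ℤ) - b ≠ 0 := by omega
      have := Int.le_of_dvd (abs_pos.2 hab') ((dvd_abs _ _).2 h1)
      have h3 : |(a : ℤ) - b| ≤ H := by rw [abs_le]; omega
      omega
  unfold pairMaj
  refine le_trans ?_ (le_add_of_nonneg_left (by positivity))
  gcongr
  refine le_trans ?_ (single_le_sum (f := fun E : Finset ℕ =>
      ((∏ p ∈ E, p : ℕ) * √((∏ p ∈ E, p : ℕ) : ℝ)) *
      ((if ((∏ p ∈ E, p : ℕ) : ℤ) ∣ (a : ℤ) - b then (1 : ℝ) else 0) *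
        (if ((∏ p ∈ E, p : ℕ) : ℤ) ∣ (c : ℤ) - d then 1 else 0))) (fun E _ => by positivity)
      (mem_filter.2 ⟨mem_powerset.2 (filter_subset _ _ : E ⊆ D), hqH⟩))
  rw [if_pos h1, if_pos h2, mul_one, mul_one]

lemma pairMaj_of_eq (D : Finset ℕ) (H a c : ℕ) : 1 ≤ pairMaj D H a a c c := by
  unfold pairMaj
  simp only [if_true, mul_one]
  refine le_add_of_nonneg_right (by positivity)

variable {a b : ℕ → ℝ} (ha : ∀ p, |a p| ≤ 2) (hb : ∀ p, |b p| ≤ 2)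
include ha hb

lemma abs_avg_prod_Phi_four_le {D : Finset ℕ} (hD : ∀ p ∈ D, p.Prime) (hD2 : ∀ p ∈ D, p ≠ 2)
    {H x y z w : ℕ} (hx : x < H) (hy : y < H) (hz : z < H) (hw : w < H) :
    |avg (∏ p ∈ D, p) (fun n => ∏ j : Fin 4, Phi a b D (n + (![x, y, z, w] j : ℕ)))| ≤
      6000 ^ #D * (pairMaj D H x y z w + pairMaj D H x z y w + pairMaj D H x w y z) := by
  classical
  rw [avg_prod_Phi a b hD univ fun j => ((![x, y, z, w] j : ℕ) : ℤ), abs_prod]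
  set v : Fin 4 → ℤ := fun j => ((![x, y, z, w] j : ℕ) : ℤ) with hv
  have v0 : v 0 = x := rfl
  have v1 : v 1 = y := rfl
  have v2 : v 2 = z := rfl
  have v3 : v 3 = w := rfl
  have n1 := pairMaj_nonneg D H x y z w
  have n2 := pairMaj_nonneg D H x z y w
  have n3 := pairMaj_nonneg D H x w y z
  have crude : ∏ p ∈ D, |avg p fun n => ∏ j, phi a b p (n + v j)| ≤ 6000 ^ #D := by
    refine (prod_le_prod (fun _ _ => abs_nonneg _) (g := fun _ => (6000 : ℝ)) fun p hp => ?_).trans_eq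
      (prod_const _)
    exact (abs_avg_prod_phi_le_pow ha hb (hD p hp).pos univ (by simp) v).trans (by norm_num)
  have hone : (1 : ℝ) ≤ pairMaj D H x y z w + pairMaj D H x z y w + pairMaj D H x w y z →
      ∏ p ∈ D, |avg p fun n => ∏ j, phi a b p (n + v j)| ≤
      6000 ^ #D * (pairMaj D H x y z w + pairMaj D H x z y w + pairMaj D H x w y z) := fun h =>
    crude.trans (le_mul_of_one_le_right (by positivity) h)
  by_cases g1 : x = y ∧ z = w
  · refine hone ?_
    have : 1 ≤ pairMaj D H x y z w := by rw [← g1.1, ← g1.2]; exact pairMaj_of_eq _ _ _ _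
    linarith
  by_cases g2 : x = z ∧ y = w
  · refine hone ?_
    have : 1 ≤ pairMaj D H x z y w := by rw [← g2.1, ← g2.2]; exact pairMaj_of_eq _ _ _ _
    linarith
  by_cases g3 : x = w ∧ y = z
  · refine hone ?_
    have : 1 ≤ pairMaj D H x w y z := by rw [← g3.1, ← g3.2]; exact pairMaj_of_eq _ _ _ _
    linarith
  have hlocal : ∀ p ∈ D, |avg p fun n => ∏ j, phi a b p (n + v j)| ≤ 6000 * ((√(p : ℝ))⁻¹ *
      ((if (p : ℤ) ∣ (x : ℤ) - y ∧ (p : ℤ) ∣ (z : ℤ) - w then √(p : ℝ) else 1) *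
      (if (p : ℤ) ∣ (x : ℤ) - z ∧ (p : ℤ) ∣ (y : ℤ) - w then √(p : ℝ) else 1) *
      (if (p : ℤ) ∣ (x : ℤ) - w ∧ (p : ℤ) ∣ (y : ℤ) - z then √(p : ℝ) else 1))) := by
    intro p hp
    have hp1 : 1 ≤ √(p : ℝ) := by
      rw [Real.one_le_sqrt]; exact_mod_cast (hD p hp).one_lt.le
    have i1 : ∀ Q : Prop, [Decidable Q] → 1 ≤ (if Q then √(p : ℝ) else 1) := by
      intro Q _; split_ifs <;> simp [hp1]
    have j1 := i1 ((p : ℤ) ∣ (x : ℤ) - y ∧ (p : ℤ) ∣ (z : ℤ) - w)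
    have j2 := i1 ((p : ℤ) ∣ (x : ℤ) - z ∧ (p : ℤ) ∣ (y : ℤ) - w)
    have j3 := i1 ((p : ℤ) ∣ (x : ℤ) - w ∧ (p : ℤ) ∣ (y : ℤ) - z)
    have crude1 := abs_avg_prod_phi_le_pow ha hb (hD p hp).pos univ (by simp) v
    have fin : ∀ t : ℝ, √(p : ℝ) ≤ t → |avg p fun n => ∏ j, phi a b p (n + v j)| ≤
        6000 * ((√(p : ℝ))⁻¹ * t) := by
      intro t ht
      have : 1 ≤ (√(p : ℝ))⁻¹ * t := by
        rw [← div_eq_inv_mul, one_le_div (by positivity)]; exact ht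
      linarith
    rcases exists_isolated_or_paired p v with ⟨i, hi⟩ | h | h | h
    · refine ((abs_avg_prod_phi_le ha hb (hD p hp) (hD2 p hp) univ (by simp) v (mem_univ i) hi).1).trans ?_
      rw [div_eq_mul_inv]
      gcongr
      exact le_mul_of_one_le_right (by positivity)
        (one_le_mul_of_one_le_of_one_le (one_le_mul_of_one_le_of_one_le j1 j2) j3)
    · rw [v0, v1, v2, v3] at h
      refine fin _ ?_
      rw [if_pos h]
      nlinarith [mul_nonneg (sub_nonneg.2 j2) (sub_nonneg.2 j3)]
    · rw [v0, v1, v2, v3] at h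
      refine fin _ ?_
      rw [if_pos h]
      nlinarith [mul_nonneg (sub_nonneg.2 j1) (sub_nonneg.2 j3)]
    · rw [v0, v1, v2, v3] at h
      refine fin _ ?_
      rw [if_pos h]
      nlinarith [mul_nonneg (sub_nonneg.2 j1) (sub_nonneg.2 j2)]
  refine (prod_le_prod (fun _ _ => abs_nonneg _) hlocal).trans ?_
  rw [prod_mul_distrib, prod_const, prod_mul_distrib, prod_mul_distrib, prod_mul_distrib,
    prod_ite_sqrt, prod_ite_sqrt, prod_ite_sqrt, prod_inv_distrib, ← Real.sqrt_prod _ (by simp),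
    ← Nat.cast_prod]
  gcongr
  have k1 := le_pairMaj hD hx hy hz hw g1
  have k2 := le_pairMaj hD hx hz hy hw g2
  have k3 := le_pairMaj hD hx hw hy hz g3
  refine le_trans ?_ (add_le_add (add_le_add k1 k2) k3)
  rw [← mul_add, ← mul_add]
  gcongr
  exact sqrt_mul_three_le (by positivity) (by positivity) (by positivity)

/-- A fourth moment bound for short sums of `Phi`. -/
lemma avg_win_pow_four_le {D : Finset ℕ} (hD : ∀ p ∈ D, p.Prime) (hD2 : ∀ p ∈ D, p ≠ 2) (H : ℕ) :
    avg (∏ p ∈ D, p) (fun y => win (Phi a b D) H y ^ 4) ≤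
      6000 ^ #D * (3 * (H : ℝ) ^ 2 + 12 * 2 ^ #D * (√((∏ p ∈ D, p : ℕ) : ℝ))⁻¹ * H ^ 4) := by
  have e1 : ∀ y : ℤ, win (Phi a b D) H y ^ 4 = ∑ x ∈ range H, ∑ z ∈ range H, ∑ u ∈ range H,
      ∑ w ∈ range H, ∏ j : Fin 4, Phi a b D (y + (![x, z, u, w] j : ℕ)) := by
    intro y
    simp only [win, Fin.prod_univ_four]
    have : ∀ t : ℝ, t ^ 4 = t * (t * (t * t)) := fun t => by ring
    rw [this, sum_mul]
    refine sum_congr rfl fun x _ => ?_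
    rw [sum_mul, mul_sum]
    refine sum_congr rfl fun z _ => ?_
    rw [sum_mul, mul_sum, mul_sum]
    refine sum_congr rfl fun u _ => ?_
    rw [mul_sum, mul_sum, mul_sum]
    refine sum_congr rfl fun w _ => ?_
    simp [mul_assoc]
  simp only [e1, avg_sum]
  have h1 : ∀ x ∈ range H, ∀ z ∈ range H, ∀ u ∈ range H, ∀ w ∈ range H,
      avg (∏ p ∈ D, p) (fun y => ∏ j : Fin 4, Phi a b D (y + (![x, z, u, w] j : ℕ))) ≤
      6000 ^ #D * (pairMaj D H x z u w + pairMaj D H x u z w + pairMaj D H x w z u) := by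
    intro x hx z hz u hu w hw
    exact (le_abs_self _).trans (abs_avg_prod_Phi_four_le ha hb hD hD2 (mem_range.1 hx)
      (mem_range.1 hz) (mem_range.1 hu) (mem_range.1 hw))
  refine (sum_le_sum fun x hx => sum_le_sum fun z hz => sum_le_sum fun u hu => sum_le_sum fun w hw =>
    h1 x hx z hz u hu w hw).trans ?_
  simp only [← mul_sum]
  gcongr
  simp only [sum_add_distrib]
  have k := sum_pairMaj_le D hD H
  have k2 : ∑ x ∈ range H, ∑ z ∈ range H, ∑ u ∈ range H, ∑ w ∈ range H, pairMaj D H x u z w =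
      ∑ x ∈ range H, ∑ z ∈ range H, ∑ u ∈ range H, ∑ w ∈ range H, pairMaj D H x z u w :=
    sum_congr rfl fun x _ => sum_comm
  have k3 : ∑ x ∈ range H, ∑ z ∈ range H, ∑ u ∈ range H, ∑ w ∈ range H, pairMaj D H x w z u =
      ∑ x ∈ range H, ∑ z ∈ range H, ∑ u ∈ range H, ∑ w ∈ range H, pairMaj D H x z u w := by
    refine sum_congr rfl fun x _ => ?_
    rw [sum_congr rfl fun z _ => sum_comm, sum_comm]
  rw [k2, k3]
  linarith

end FourthMoment

section SecondMoment

variable {a b : ℕ → ℝ} (ha : ∀ p, |a p| ≤ 2) (hb : ∀ p, |b p| ≤ 2)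
include ha hb

lemma abs_avg_prod_Phi_two_le {D : Finset ℕ} (hD : ∀ p ∈ D, p.Prime) (hD2 : ∀ p ∈ D, p ≠ 2)
    (x y : ℕ) :
    |avg (∏ p ∈ D, p) (fun n => ∏ j : Fin 2, Phi a b D (n + (![x, y] j : ℕ)))| ≤
      6000 ^ #D * ∑ E ∈ D.powerset, ((∏ p ∈ E, p : ℕ) / (∏ p ∈ D, p : ℕ)) *
        (if ((∏ p ∈ E, p : ℕ) : ℤ) ∣ (x : ℤ) - y then (1 : ℝ) else 0) := by
  classical
  rw [avg_prod_Phi a b hD univ fun j => ((![x, y] j : ℕ) : ℤ), abs_prod]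
  set v : Fin 2 → ℤ := fun j => ((![x, y] j : ℕ) : ℤ) with hv
  have v0 : v 0 = x := rfl
  have v1 : v 1 = y := rfl
  have hlocal : ∀ p ∈ D, |avg p fun n => ∏ j, phi a b p (n + v j)| ≤ 6000 * ((p : ℝ)⁻¹ *
      (if (p : ℤ) ∣ (x : ℤ) - y then (p : ℝ) else 1)) := by
    intro p hp
    have hp0 : (0 : ℝ) < p := by exact_mod_cast (hD p hp).pos
    split_ifs with h
    · rw [inv_mul_cancel₀ hp0.ne', mul_one]
      exact (abs_avg_prod_phi_le_pow ha hb (hD p hp).pos univ (by simp) v).trans (by norm_num)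
    · have := (abs_avg_prod_phi_le ha hb (hD p hp) (hD2 p hp) univ (by simp) v (mem_univ 1)
        (fun j _ hj => by
          have : j = 0 := by omega
          rw [this, v0, v1]; exact h)).2 (by simp)
      rwa [mul_one, ← div_eq_mul_inv]
  refine (prod_le_prod (fun _ _ => abs_nonneg _) hlocal).trans ?_
  rw [prod_mul_distrib, prod_const]
  gcongr
  rw [prod_mul_distrib, prod_inv_distrib, ← prod_filter, ← Nat.cast_prod, ← Nat.cast_prod]
  have h1 := (prod_dvd_sub hD ((x : ℤ) - y) ((x : ℤ) - y)).1
  simp only [and_self] at h1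
  refine le_trans ?_ (single_le_sum (f := fun E : Finset ℕ =>
    ((∏ p ∈ E, p : ℕ) / (∏ p ∈ D, p : ℕ) : ℝ) *
        (if ((∏ p ∈ E, p : ℕ) : ℤ) ∣ (x : ℤ) - y then (1 : ℝ) else 0)) (fun E _ => by positivity)
    (mem_powerset.2 (filter_subset (fun p : ℕ => (p : ℤ) ∣ (x : ℤ) - y) D)))
  rw [if_pos h1, mul_one, div_eq_inv_mul]

/-- A second moment bound for short sums of `Phi`. -/
lemma avg_win_sq_le {D : Finset ℕ} (hD : ∀ p ∈ D, p.Prime) (hD2 : ∀ p ∈ D, p ≠ 2) {H : ℕ}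
    (hH : H ≤ ∏ p ∈ D, p) :
    avg (∏ p ∈ D, p) (fun y => win (Phi a b D) H y ^ 2) ≤ 2 * 12000 ^ #D * H := by
  have e1 : ∀ y : ℤ, win (Phi a b D) H y ^ 2 = ∑ x ∈ range H, ∑ z ∈ range H,
      ∏ j : Fin 2, Phi a b D (y + (![x, z] j : ℕ)) := by
    intro y
    simp only [win, Fin.prod_univ_two]
    rw [sq, sum_mul_sum]
    rfl
  simp only [e1, avg_sum]
  refine (sum_le_sum fun x _ => sum_le_sum fun z _ =>
    (le_abs_self _).trans (abs_avg_prod_Phi_two_le ha hb hD hD2 x z)).trans ?_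
  simp only [← mul_sum]
  rw [sum_congr rfl fun x _ => sum_comm, sum_comm]
  simp only [← mul_sum]
  have hd : 0 < ∏ p ∈ D, p := prod_pos fun p hp => (hD p hp).pos
  set d := ∏ p ∈ D, p
  have hd1 : (0 : ℝ) < d := by exact_mod_cast hd
  have hHd : (H : ℝ) ≤ d := by exact_mod_cast hH
  have h3 : ∀ E ∈ D.powerset, ((∏ p ∈ E, p : ℕ) / d : ℝ) * ∑ x ∈ range H, ∑ z ∈ range H,
      (if ((∏ p ∈ E, p : ℕ) : ℤ) ∣ (x : ℤ) - z then (1 : ℝ) else 0) ≤ 2 * H := by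
    intro E hE
    rw [mem_powerset] at hE
    have hq : 0 < ∏ p ∈ E, p := prod_pos fun p hp => (hD p (hE hp)).pos
    have hqd : ∏ p ∈ E, p ≤ d := Nat.le_of_dvd hd (prod_dvd_prod_of_subset _ _ _ hE)
    set q := ∏ p ∈ E, p
    have hq1 : (0 : ℝ) < q := by exact_mod_cast hq
    have hqd1 : (q : ℝ) ≤ d := by exact_mod_cast hqd
    calc (q / d : ℝ) * _ ≤ (q / d : ℝ) * (H * (H / q + 1)) := by
          gcongr
          exact sum_dvd_sub_le q H hq
      _ = H * ((H + q) / d) := by field_simp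
      _ ≤ H * 2 := by
          gcongr
          rw [div_le_iff₀ hd1]; linarith
      _ = 2 * H := by ring
  calc _ ≤ 6000 ^ #D * ∑ E ∈ D.powerset, (2 * H : ℝ) := by
        refine mul_le_mul_of_nonneg_left (sum_le_sum h3) (by positivity)
    _ = 2 * 12000 ^ #D * H := by
        rw [sum_const, card_powerset, nsmul_eq_mul, show (12000 : ℝ) = 6000 * 2 by norm_num,
          mul_pow]
        push_cast
        ring

end SecondMoment

section Burgess

lemma Phi_one_zero {E : Finset ℕ} (hE : ∀ p ∈ E, p.Prime) (n : ℤ) :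
    Phi (fun _ => 1) (fun _ => 0) E n = chi (∏ p ∈ E, p) n := by
  induction E using Finset.induction_on with
  | empty => simp [Phi, chi]
  | insert q E hq ih =>
    have h1 := ih fun p hp => hE p (mem_insert_of_mem hp)
    have : NeZero q := ⟨(hE q (mem_insert_self q E)).ne_zero⟩
    have : NeZero (∏ p ∈ E, p) := ⟨prod_ne_zero_iff.2 fun p hp => (hE p (mem_insert_of_mem hp)).ne_zero⟩
    rw [Phi] at h1 ⊢
    rw [prod_insert hq, prod_insert hq, h1]
    simp [phi, chi, jacobiSym.mul_right]

lemma chi_mul (e : ℕ) (m n : ℤ) : chi e (m * n) = chi e m * chi e n := by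
  simp [chi, jacobiSym.mul_left]

lemma abs_chi_of_coprime {e a : ℕ} (h : a.Coprime e) : |chi e a| = 1 := by
  have h1 : jacobiSym a e ≠ 0 := jacobiSym.ne_zero (by simpa using h)
  rcases jacobiSym.trichotomy a e with h | h | h
  · exact absurd h h1
  · simp [chi, h]
  · simp [chi, h]

lemma abs_win_shift_le {F : ℤ → ℝ} (hF : ∀ x, |F x| ≤ 1) (N : ℕ) (y : ℤ) (k : ℕ) :
    |win F N y - win F N (y + k)| ≤ 2 * k := by
  have step : ∀ z : ℤ, |win F N z - win F N (z + 1)| ≤ 2 := by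
    intro z
    have h1 : win F N (z + 1) + F z = win F N z + F (z + N) := by
      simp only [win]
      rw [← sum_range_succ (fun h : ℕ => F (z + h)), sum_range_succ' (fun h : ℕ => F (z + h))]
      simp only [Nat.cast_zero, add_zero, add_left_inj]
      refine sum_congr rfl fun h _ => ?_
      congr 1; push_cast; ring
    have h2 := abs_le.1 (hF z)
    have h3 := abs_le.1 (hF (z + N))
    rw [abs_le]
    constructor <;> linarith
  induction k with
  | zero => simp
  | succ k ih =>
    have h1 := step (y + k)
    have e : y + ((k + 1 : ℕ) : ℤ) = y + k + 1 := by push_cast; ring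
    rw [e]
    have := abs_sub_le (win F N y) (win F N (y + k)) (win F N (y + k + 1))
    push_cast
    linarith

lemma sq_sum_fiber_le {τ : Type*} {e : ℕ} [NeZero e] (T : Finset τ) (f : τ → ZMod e)
    (G : ZMod e → ℝ) :
    (∑ t ∈ T, G (f t)) ^ 4 ≤ (#T : ℝ) ^ 2 *
      (∑ t ∈ T, ∑ t' ∈ T, if f t = f t' then (1 : ℝ) else 0) * ∑ y, G y ^ 4 := by
  have h1 : (∑ t ∈ T, G (f t)) ^ 2 ≤ #T * ∑ t ∈ T, G (f t) ^ 2 := sq_sum_le_card_mul_sum_sq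
  have h2 : ∑ t ∈ T, G (f t) ^ 2 = ∑ y, (#{t ∈ T | f t = y} : ℝ) * G y ^ 2 := by
    rw [← sum_fiberwise T f]
    refine sum_congr rfl fun y _ => ?_
    rw [sum_congr rfl fun t ht => by rw [(mem_filter.1 ht).2], sum_const, nsmul_eq_mul]
  have h3 : (∑ y, (#{t ∈ T | f t = y} : ℝ) * G y ^ 2) ^ 2 ≤
      (∑ y, (#{t ∈ T | f t = y} : ℝ) ^ 2) * ∑ y, (G y ^ 2) ^ 2 := sum_mul_sq_le_sq_mul_sq _ _ _
  have h4 : ∑ y, (#{t ∈ T | f t = y} : ℝ) ^ 2 =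
      ∑ t ∈ T, ∑ t' ∈ T, if f t = f t' then (1 : ℝ) else 0 := by
    rw [← sum_fiberwise T f]
    refine sum_congr rfl fun y _ => ?_
    rw [sum_congr rfl fun t ht => sum_congr rfl fun t' _ => by rw [(mem_filter.1 ht).2]]
    rw [sum_const, sum_boole, nsmul_eq_mul, sq]
    simp only [eq_comm]
  have h5 : ∀ y, (G y ^ 2) ^ 2 = G y ^ 4 := fun y => by ring
  calc (∑ t ∈ T, G (f t)) ^ 4 = ((∑ t ∈ T, G (f t)) ^ 2) ^ 2 := by ring
    _ ≤ (#T * ∑ t ∈ T, G (f t) ^ 2) ^ 2 := by gcongr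
    _ = (#T : ℝ) ^ 2 * (∑ y, (#{t ∈ T | f t = y} : ℝ) * G y ^ 2) ^ 2 := by rw [h2]; ring
    _ ≤ (#T : ℝ) ^ 2 * ((∑ y, (#{t ∈ T | f t = y} : ℝ) ^ 2) * ∑ y, (G y ^ 2) ^ 2) := by gcongr
    _ = _ := by rw [h4]; simp only [h5]; ring

lemma card_congr_pairs_le {e a a' N : ℕ} (haa : a.Coprime a')
    (ha0 : 0 < a) (hb : (a + a') * N ≤ e) (z : ℤ) :
    ∑ i ∈ range N, ∑ i' ∈ range N,
      (if (e : ℤ) ∣ a' * (z + i) - a * (z + i') then (1 : ℝ) else 0) ≤ N / a + 1 := by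
  classical
  set S := {x ∈ range N ×ˢ range N | (e : ℤ) ∣ a' * (z + (x.1 : ℕ)) - a * (z + (x.2 : ℕ))} with hS
  have e1 : ∑ i ∈ range N, ∑ i' ∈ range N,
      (if (e : ℤ) ∣ a' * (z + i) - a * (z + i') then (1 : ℝ) else 0) = #S := by
    rw [hS, ← sum_boole, sum_product]
  rw [e1]
  have hmem : ∀ x ∈ S, x.1 < N ∧ x.2 < N ∧ (e : ℤ) ∣ a' * (z + x.1) - a * (z + x.2) := by
    intro x hx
    rw [hS, mem_filter, mem_product, mem_range, mem_range] at hx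
    exact ⟨hx.1.1, hx.1.2, hx.2⟩
  have hkey : ∀ x ∈ S, ∀ y ∈ S, (a' : ℤ) * ((x.1 : ℤ) - y.1) = a * ((x.2 : ℤ) - y.2) := by
    intro x hx y hy
    obtain ⟨hx1, hx2, hx3⟩ := hmem x hx
    obtain ⟨hy1, hy2, hy3⟩ := hmem y hy
    have hd := dvd_sub hx3 hy3
    have e2 : (a' : ℤ) * (z + x.1) - a * (z + x.2) - (a' * (z + y.1) - a * (z + y.2)) =
      a' * ((x.1 : ℤ) - y.1) - a * ((x.2 : ℤ) - y.2) := by ring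
    rw [e2] at hd
    have hlt : |(a' : ℤ) * ((x.1 : ℤ) - y.1) - a * ((x.2 : ℤ) - y.2)| < e := by
      have b1 : |(x.1 : ℤ) - y.1| ≤ N - 1 := by rw [abs_le]; omega
      have b2 : |(x.2 : ℤ) - y.2| ≤ N - 1 := by rw [abs_le]; omega
      have hb' : ((a : ℤ) + a') * N ≤ e := by exact_mod_cast hb
      calc |(a' : ℤ) * ((x.1 : ℤ) - y.1) - a * ((x.2 : ℤ) - y.2)|
          ≤ |(a' : ℤ) * ((x.1 : ℤ) - y.1)| + |a * ((x.2 : ℤ) - y.2)| := abs_sub _ _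
        _ = a' * |(x.1 : ℤ) - y.1| + a * |(x.2 : ℤ) - y.2| := by
            rw [abs_mul, abs_mul, Nat.abs_cast, Nat.abs_cast]
        _ ≤ a' * (N - 1) + a * (N - 1) := by gcongr
        _ < (a + a') * N := by
            have : (0 : ℤ) < a := by exact_mod_cast ha0
            have : (0 : ℤ) ≤ a' := by positivity
            nlinarith
        _ ≤ e := hb'
    linarith [Int.eq_zero_of_abs_lt_dvd hd hlt]
  rcases S.eq_empty_or_nonempty with h0 | ⟨x0, hx0⟩
  · rw [h0]; simp; positivity
  have hcard : #S ≤ #{i ∈ range N | i ≡ x0.1 [MOD a]} := by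
    refine card_le_card_of_injOn (fun x => x.1) ?_ ?_
    · intro x hx
      have h := hkey x0 hx0 x hx
      simp only [mem_coe, mem_filter, mem_range]
      refine ⟨(hmem x hx).1, ?_⟩
      rw [Nat.modEq_iff_dvd]
      have : (a : ℤ) ∣ a' * ((x0.1 : ℤ) - x.1) := ⟨_, h⟩
      exact (Int.isCoprime_iff_gcd_eq_one.2 (by simpa using haa)).dvd_of_dvd_mul_left this
    · intro x hx y hy hxy
      have h := hkey x hx y hy
      simp only at hxy
      rw [hxy, sub_self, mul_zero] at h
      have ha0' : (a : ℤ) ≠ 0 := by exact_mod_cast ha0.ne'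
      have h2 : (x.2 : ℤ) - y.2 = 0 := by
        rcases mul_eq_zero.1 h.symm with h | h
        · exact absurd h ha0'
        · exact h
      exact Prod.ext hxy (by omega)
  have h3 : #{i ∈ range N | i ≡ x0.1 [MOD a]} = N.count (· ≡ x0.1 [MOD a]) := by
    rw [Nat.count_eq_card_filter_range]
  rw [h3, Nat.count_modEq_card _ ha0] at hcard
  have h2 : ((N / a : ℕ) : ℝ) ≤ N / a := Nat.cast_div_le
  have : (#S : ℝ) ≤ ((N / a : ℕ) : ℝ) + 1 := by
    have : #S ≤ N / a + 1 := hcard.trans (by split_ifs <;> omega)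
    exact_mod_cast this
  linarith

lemma card_congr_pairs_self_le {e a N : ℕ} (ha : a.Coprime e) (hN : N ≤ e) (z : ℤ) :
    ∑ i ∈ range N, ∑ i' ∈ range N,
      (if (e : ℤ) ∣ a * (z + i) - a * (z + i') then (1 : ℝ) else 0) ≤ N := by
  have : ∀ i ∈ range N, ∑ i' ∈ range N,
      (if (e : ℤ) ∣ a * (z + i) - a * (z + i') then (1 : ℝ) else 0) ≤ 1 := by
    intro i hi
    rw [sum_boole]
    have : #{i' ∈ range N | (e : ℤ) ∣ a * (z + i) - a * (z + (i' : ℕ))} ≤ 1 := by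
      rw [card_le_one]
      have key : ∀ j ∈ {i' ∈ range N | (e : ℤ) ∣ a * (z + i) - a * (z + (i' : ℕ))}, i = j := by
        intro j hj
        rw [mem_filter, mem_range] at hj
        have h1 : (e : ℤ) ∣ a * ((i : ℤ) - j) := by
          have e2 : (a : ℤ) * ((i : ℤ) - j) = a * (z + i) - a * (z + j) := by ring
          rw [e2]; exact hj.2
        have h2 : (e : ℤ) ∣ (i : ℤ) - j :=
          (Int.isCoprime_iff_gcd_eq_one.2 (by simpa using ha.symm)).dvd_of_dvd_mul_left h1
        have hi' := mem_range.1 hi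
        have := Int.eq_zero_of_abs_lt_dvd h2 (by rw [abs_lt]; omega)
        omega
      intro x hx y hy
      rw [← key x hx, ← key y hy]
    exact_mod_cast this
  calc _ ≤ ∑ i ∈ range N, (1 : ℝ) := sum_le_sum this
    _ = N := by simp

lemma sum_inv_max_le (𝒜 : Finset ℕ) (h0 : ∀ a ∈ 𝒜, 0 < a) :
    ∑ a ∈ 𝒜, ∑ a' ∈ 𝒜, (1 : ℝ) / (max a a' : ℕ) ≤ 2 * #𝒜 := by
  have h1 : ∀ a ∈ 𝒜, ∑ a' ∈ 𝒜, (if a' ≤ a then (1 : ℝ) / a else 0) ≤ 1 := by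
    intro a ha
    rw [← sum_filter, sum_const, nsmul_eq_mul, mul_one_div]
    have ha0 : (0 : ℝ) < a := by exact_mod_cast h0 a ha
    rw [div_le_one ha0]
    have : {a' ∈ 𝒜 | a' ≤ a} ⊆ Icc 1 a := by
      intro x hx
      rw [mem_filter] at hx
      exact mem_Icc.2 ⟨h0 x hx.1, hx.2⟩
    have := card_le_card this
    rw [Nat.card_Icc] at this
    exact_mod_cast (by omega : #{a' ∈ 𝒜 | a' ≤ a} ≤ a)
  have h2 : ∑ a ∈ 𝒜, ∑ a' ∈ 𝒜, (1 : ℝ) / (max a a' : ℕ) ≤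
      ∑ a ∈ 𝒜, ∑ a' ∈ 𝒜, ((if a' ≤ a then (1 : ℝ) / a else 0) + if a ≤ a' then (1 : ℝ) / a' else 0) := by
    refine sum_le_sum fun a _ => sum_le_sum fun a' _ => ?_
    rcases le_total a a' with h | h
    · rw [max_eq_right h, if_pos h]
      have : (0 : ℝ) ≤ if a' ≤ a then (1 : ℝ) / a else 0 := by positivity
      linarith
    · rw [max_eq_left h, if_pos h]
      have : (0 : ℝ) ≤ if a ≤ a' then (1 : ℝ) / a' else 0 := by positivity
      linarith
  refine h2.trans ?_
  simp only [sum_add_distrib]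
  have h3 : ∑ a ∈ 𝒜, ∑ a' ∈ 𝒜, (if a ≤ a' then (1 : ℝ) / (a' : ℝ) else 0) =
      ∑ a' ∈ 𝒜, ∑ a ∈ 𝒜, (if a ≤ a' then (1 : ℝ) / (a' : ℝ) else 0) := sum_comm
  have := sum_le_sum h1
  rw [h3]
  simp only [sum_const, nsmul_eq_mul, mul_one] at this
  linarith

lemma sum_collisions_le {e N : ℕ} (𝒜 : Finset ℕ) (hp : ∀ a ∈ 𝒜, a.Prime)
    (hco : ∀ a ∈ 𝒜, a.Coprime e) {A : ℕ} (hA : ∀ a ∈ 𝒜, a ≤ A) (hAN : 2 * A * N ≤ e) (hA0 : #𝒜 ≤ N)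
    (hNe : N ≤ e) (z : ℤ) :
    ∑ t ∈ 𝒜 ×ˢ range N, ∑ t' ∈ 𝒜 ×ˢ range N,
      (if (t.1 : ZMod e)⁻¹ * ((z + t.2 : ℤ) : ZMod e) = (t'.1 : ZMod e)⁻¹ * ((z + t'.2 : ℤ) : ZMod e)
        then (1 : ℝ) else 0) ≤ 4 * #𝒜 * N := by
  have hiff : ∀ a ∈ 𝒜, ∀ a' ∈ 𝒜, ∀ i i' : ℕ, ((a : ZMod e)⁻¹ * ((z + i : ℤ) : ZMod e) =
      (a' : ZMod e)⁻¹ * ((z + i' : ℤ) : ZMod e)) ↔ (e : ℤ) ∣ a' * (z + i) - a * (z + i') := by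
    intro a ha a' ha' i i'
    have u1 : (a : ZMod e) * (a : ZMod e)⁻¹ = 1 := ZMod.coe_mul_inv_eq_one a (hco a ha)
    have u2 : (a' : ZMod e) * (a' : ZMod e)⁻¹ = 1 := ZMod.coe_mul_inv_eq_one a' (hco a' ha')
    rw [← ZMod.intCast_zmod_eq_zero_iff_dvd, Int.cast_sub, sub_eq_zero]
    simp only [Int.cast_mul, Int.cast_natCast]
    generalize ((z + i : ℤ) : ZMod e) = X
    generalize ((z + i' : ℤ) : ZMod e) = Y
    constructor
    · intro h
      calc (a' : ZMod e) * X = a' * a * ((a : ZMod e)⁻¹ * X) := by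
            linear_combination -(a' : ZMod e) * X * u1
        _ = a' * a * ((a' : ZMod e)⁻¹ * Y) := by rw [h]
        _ = a * Y := by linear_combination (a : ZMod e) * Y * u2
    · intro h
      calc (a : ZMod e)⁻¹ * X = (a : ZMod e)⁻¹ * (a' : ZMod e)⁻¹ * (a' * X) := by
            linear_combination -(a : ZMod e)⁻¹ * X * u2
        _ = (a : ZMod e)⁻¹ * (a' : ZMod e)⁻¹ * (a * Y) := by rw [h]
        _ = (a' : ZMod e)⁻¹ * Y := by linear_combination (a' : ZMod e)⁻¹ * Y * u1
  have hpair : ∀ a ∈ 𝒜, ∀ a' ∈ 𝒜, ∑ i ∈ range N, ∑ i' ∈ range N,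
      (if (a : ZMod e)⁻¹ * ((z + i : ℤ) : ZMod e) = (a' : ZMod e)⁻¹ * ((z + i' : ℤ) : ZMod e)
        then (1 : ℝ) else 0) ≤ (if a = a' then (N : ℝ) else 0) + (N * (1 / (max a a' : ℕ)) + 1) := by
    intro a ha a' ha'
    simp only [hiff a ha a' ha']
    split_ifs with h
    · subst h
      have := card_congr_pairs_self_le (hco a ha) hNe z
      have h0 : (0 : ℝ) ≤ N * (1 / (max a a : ℕ)) := by positivity
      linarith
    · have hc : a.Coprime a' := (Nat.coprime_primes (hp a ha) (hp a' ha')).2 h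
      have hb : (a + a') * N ≤ e := by
        refine le_trans (Nat.mul_le_mul_right N ?_) hAN
        have := hA a ha; have := hA a' ha'; omega
      rw [zero_add, mul_one_div]
      rcases le_total a a' with hle | hle
      · rw [max_eq_right hle]
        have := card_congr_pairs_le (e := e) hc.symm (hp a' ha').pos (by rwa [add_comm]) z
        rw [sum_comm] at this
        refine le_trans (le_of_eq ?_) this
        refine sum_congr rfl fun i _ => sum_congr rfl fun i' _ => ?_
        refine if_congr ?_ rfl rfl
        rw [← neg_sub, dvd_neg]
      · rw [max_eq_left hle]
        exact card_congr_pairs_le hc (hp a ha).pos hb z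
  have e1 : ∑ t ∈ 𝒜 ×ˢ range N, ∑ t' ∈ 𝒜 ×ˢ range N,
      (if (t.1 : ZMod e)⁻¹ * ((z + t.2 : ℤ) : ZMod e) = (t'.1 : ZMod e)⁻¹ * ((z + t'.2 : ℤ) : ZMod e)
        then (1 : ℝ) else 0) = ∑ a ∈ 𝒜, ∑ a' ∈ 𝒜, ∑ i ∈ range N, ∑ i' ∈ range N,
      (if (a : ZMod e)⁻¹ * ((z + i : ℤ) : ZMod e) = (a' : ZMod e)⁻¹ * ((z + i' : ℤ) : ZMod e)
        then (1 : ℝ) else 0) := by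
    rw [sum_product]
    refine sum_congr rfl fun a _ => ?_
    rw [sum_comm, sum_product]
    refine sum_congr rfl fun a' _ => ?_
    rw [sum_comm]
  rw [e1]
  refine (sum_le_sum fun a ha => sum_le_sum fun a' ha' => hpair a ha a' ha').trans ?_
  simp only [sum_add_distrib, ← mul_sum, sum_ite_eq]
  have h1 : ∑ a ∈ 𝒜, (if a ∈ 𝒜 then (N : ℝ) else 0) = #𝒜 * N := by
    rw [sum_congr rfl fun a ha => if_pos ha]; simp
  have h2 := sum_inv_max_le 𝒜 fun a ha => (hp a ha).pos
  have h3 : (#𝒜 : ℝ) ≤ N := by exact_mod_cast hA0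
  rw [h1]
  simp only [sum_const, nsmul_eq_mul, mul_one]
  have h4 : (N : ℝ) * ∑ a ∈ 𝒜, ∑ a' ∈ 𝒜, (1 : ℝ) / (max a a' : ℕ) ≤ N * (2 * #𝒜) := by gcongr
  nlinarith [(Nat.cast_nonneg #𝒜 : (0 : ℝ) ≤ #𝒜)]

end Burgess

section Burgess

lemma card_mul_abs_win_chi_le {e A B N : ℕ} [NeZero e] (𝒜 : Finset ℕ)
    (hco : ∀ a ∈ 𝒜, a.Coprime e) (hA : ∀ a ∈ 𝒜, a ≤ A) (z : ℤ) :
    (#𝒜 : ℝ) * B * |win (chi e) N z| ≤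
      ∑ t ∈ 𝒜 ×ˢ range N,
        |win (chi e) B (((t.1 : ZMod e)⁻¹ * ((z + t.2 : ℤ) : ZMod e)).val : ℤ)| +
      2 * #𝒜 * A * B ^ 2 := by
  have h1 : ∀ a ∈ 𝒜, (B : ℝ) * |win (chi e) N z| ≤
      ∑ i ∈ range N, |win (chi e) B (((a : ZMod e)⁻¹ * ((z + i : ℤ) : ZMod e)).val : ℤ)| +
        2 * A * B ^ 2 := by
    intro a ha
    have e1 : ∑ b ∈ range B, win (chi e) N (z + (a * b : ℕ)) =
        ∑ i ∈ range N, chi e a *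
          win (chi e) B (((a : ZMod e)⁻¹ * ((z + i : ℤ) : ZMod e)).val : ℤ) := by
      simp only [win]
      rw [sum_comm]
      refine sum_congr rfl fun i _ => ?_
      rw [mul_sum]
      refine sum_congr rfl fun b _ => ?_
      rw [← chi_mul]
      refine eq_of_zmod_eq (chi_periodic e) ?_
      have u1 : (a : ZMod e) * (a : ZMod e)⁻¹ = 1 := ZMod.coe_mul_inv_eq_one a (hco a ha)
      push_cast
      rw [ZMod.natCast_zmod_val]
      linear_combination -((z : ZMod e) + i) * u1
    have e2 : (B : ℝ) * win (chi e) N z = ∑ b ∈ range B, win (chi e) N (z + (a * b : ℕ)) +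
        ∑ b ∈ range B, (win (chi e) N z - win (chi e) N (z + (a * b : ℕ))) := by
      rw [← sum_add_distrib]
      simp
    have e3 : |∑ b ∈ range B, (win (chi e) N z - win (chi e) N (z + (a * b : ℕ)))| ≤
        2 * A * B ^ 2 := by
      refine (abs_sum_le_sum_abs _ _).trans ?_
      have : ∀ b ∈ range B, |win (chi e) N z - win (chi e) N (z + (a * b : ℕ))| ≤ 2 * (A * B) := by
        intro b hb
        refine (abs_win_shift_le (abs_chi_le e) N z (a * b)).trans ?_
        have : a * b ≤ A * B := Nat.mul_le_mul (hA a ha) (mem_range.1 hb).le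
        have : ((a * b : ℕ) : ℝ) ≤ A * B := by exact_mod_cast this
        linarith
      refine (sum_le_sum this).trans_eq ?_
      simp; ring
    have e4 : |∑ i ∈ range N, chi e a *
          win (chi e) B (((a : ZMod e)⁻¹ * ((z + i : ℤ) : ZMod e)).val : ℤ)| ≤
        ∑ i ∈ range N, |win (chi e) B (((a : ZMod e)⁻¹ * ((z + i : ℤ) : ZMod e)).val : ℤ)| := by
      refine (abs_sum_le_sum_abs _ _).trans_eq ?_
      refine sum_congr rfl fun i _ => ?_
      rw [abs_mul, abs_chi_of_coprime (hco a ha), one_mul]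
    calc (B : ℝ) * |win (chi e) N z| = |(B : ℝ) * win (chi e) N z| := by rw [abs_mul, Nat.abs_cast]
      _ ≤ _ := by
        rw [e2, e1]
        exact (abs_add_le _ _).trans (add_le_add e4 e3)
  have := sum_le_sum h1
  rw [sum_const, nsmul_eq_mul, sum_add_distrib, sum_const, nsmul_eq_mul] at this
  rw [sum_product]
  linarith

lemma exists_primes_coprime {E : Finset ℕ} (hE : ∀ p ∈ E, p.Prime) {w : ℝ} (hw : 10 ^ 6 ≤ w)
    (hc : (#E : ℝ) ≤ w ^ 2) : ∃ 𝒜 : Finset ℕ, (∀ a ∈ 𝒜, a.Prime) ∧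
      (∀ a ∈ 𝒜, a.Coprime (∏ p ∈ E, p)) ∧ (∀ a ∈ 𝒜, a ≤ ⌊w ^ 20⌋₊) ∧ w ^ 18 ≤ #𝒜 := by
  set A := ⌊w ^ 20⌋₊ with hA
  have hw0 : 0 < w := by linarith
  have hw1 : 1 ≤ w := by linarith
  refine ⟨(Iic A).filter Nat.Prime \ E, ?_, ?_, ?_, ?_⟩
  · intro a ha; simp at ha; exact ha.1.2
  · intro a ha
    simp at ha
    refine Nat.Coprime.prod_right fun p hp => (Nat.coprime_primes ha.1.2 (hE p hp)).2 ?_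
    rintro rfl; exact ha.2 hp
  · intro a ha; simp at ha; exact ha.1.1
  have hAw : (A : ℝ) ≤ w ^ 20 := Nat.floor_le (by positivity)
  have hAw2 : w ^ 20 - 1 < A := Nat.sub_one_lt_floor _
  have hbig : (10 ^ 6 : ℝ) ≤ w ^ 20 := hw.trans (le_self_pow₀ hw1 (by norm_num))
  have hA1 : (1 : ℝ) < A := by linarith
  have hpi := Chebyshev.pi_ge A
  have hcard : #((Iic A).filter Nat.Prime) = Nat.primeCounting A := by
    rw [Nat.primeCounting, Nat.primeCounting', Nat.count_eq_card_filter_range]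
    congr 1
    ext x; simp
  have hlogA : Real.log A ≤ 20 * w := by
    calc Real.log A ≤ Real.log (w ^ 20) := Real.log_le_log (by linarith) hAw
      _ = 20 * Real.log w := by rw [Real.log_pow]; norm_num
      _ ≤ 20 * w := by
        have := Real.log_le_sub_one_of_pos hw0
        linarith
  have hlogA0 : 0 < Real.log A := Real.log_pos hA1
  have hlog1 : Real.log (A + 1) ≤ 98 + (A + 1) / 100 := by
    have h1 := Real.log_le_sub_one_of_pos (show (0 : ℝ) < (A + 1) / 100 by positivity)
    have h2 := Real.log_le_sub_one_of_pos (show (0 : ℝ) < 100 by norm_num)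
    rw [Real.log_div (by positivity) (by norm_num)] at h1
    linarith
  have hnum : (A : ℝ) / 2 ≤ A * Real.log 2 - Real.log (A + 1) := by
    have := Real.log_two_gt_d9
    nlinarith
  have h1 : w ^ 19 / 80 ≤ (A : ℝ) / 2 / Real.log A := by
    rw [le_div_iff₀ hlogA0]
    calc w ^ 19 / 80 * Real.log A ≤ w ^ 19 / 80 * (20 * w) := by gcongr
      _ = w ^ 20 / 4 := by ring
      _ ≤ A / 2 := by linarith
  have h2 : w ^ 19 / 80 ≤ (Nat.primeCounting A : ℝ) :=
    h1.trans ((div_le_div_of_nonneg_right hnum hlogA0.le).trans hpi)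
  have h3 : #((Iic A).filter Nat.Prime) ≤ #((Iic A).filter Nat.Prime \ E) + #E :=
    card_le_card_sdiff_add_card
  rw [hcard] at h3
  have h4 : (Nat.primeCounting A : ℝ) ≤ #((Iic A).filter Nat.Prime \ E) + #E := by exact_mod_cast h3
  have h5 : w ^ 2 ≤ w ^ 18 := pow_le_pow_right₀ hw1 (by norm_num)
  have h6 : 10 ^ 6 * w ^ 18 ≤ w ^ 19 := by
    calc 10 ^ 6 * w ^ 18 ≤ w * w ^ 18 := by gcongr
      _ = w ^ 19 := by ring
  linarith

lemma le_pow_of_fourth_moment {w a A B N S X : ℝ} (hw : 10 ^ 6 ≤ w) (ha : w ^ 18 ≤ a)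
    (hB : w ^ 25 / 2 ≤ B) (hB' : B ≤ w ^ 25) (hA : A ≤ w ^ 20) (hN0 : 0 ≤ N)
    (hN : N ≤ w ^ 48)
    (hX : X ^ 4 ≤ (a * N) ^ 2 * (4 * a * N) * (w ^ 100 * (15 * w ^ 2 * w ^ 50)))
    (hS : a * B * S ≤ X + 2 * a * A * B ^ 2) : S ≤ w ^ 46 := by
  have hw0 : 0 < w := by linarith
  have hw1 : 1 ≤ w := by linarith
  have ha0 : 0 < a := lt_of_lt_of_le (by positivity) ha
  have hB0 : 0 < B := lt_of_lt_of_le (by positivity) hB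
  have hXle : X ≤ a * B * (8 * w ^ 45) := by
    refine le_of_pow_le_pow_left₀ (n := 4) (by norm_num) (by positivity) (hX.trans ?_)
    have h1 : N ^ 3 ≤ w ^ 144 := by
      calc N ^ 3 ≤ (w ^ 48) ^ 3 := by gcongr
        _ = w ^ 144 := by ring
    have h2 : w ^ 100 / 16 ≤ B ^ 4 := by
      calc w ^ 100 / 16 = (w ^ 25 / 2) ^ 4 := by ring
        _ ≤ _ := by gcongr
    have h3 : 960 * w ^ 178 ≤ 4096 * w ^ 180 := by
      have : w ^ 178 ≤ w ^ 180 := pow_le_pow_right₀ hw1 (by norm_num)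
      have : 0 < w ^ 178 := by positivity
      linarith
    calc (a * N) ^ 2 * (4 * a * N) * (w ^ 100 * (15 * w ^ 2 * w ^ 50))
        = a ^ 3 * N ^ 3 * 60 * w ^ 152 := by ring
      _ ≤ a ^ 3 * w ^ 144 * 60 * w ^ 152 := by gcongr
      _ = a ^ 3 * (w ^ 18 * (w ^ 100 / 16) * (960 * w ^ 178)) := by ring
      _ ≤ a ^ 3 * (a * B ^ 4 * (4096 * w ^ 180)) := by
          refine mul_le_mul_of_nonneg_left ?_ (by positivity)
          exact mul_le_mul (mul_le_mul ha h2 (by positivity) ha0.le) h3 (by positivity)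
            (by positivity)
      _ = (a * B * (8 * w ^ 45)) ^ 4 := by ring
  have hAB : 2 * a * A * B ^ 2 ≤ a * B * (2 * w ^ 45) := by
    calc 2 * a * A * B ^ 2 = a * B * (2 * (A * B)) := by ring
      _ ≤ a * B * (2 * (w ^ 20 * w ^ 25)) := by gcongr
      _ = _ := by ring
  have h7 : (a * B) * S ≤ a * B * (10 * w ^ 45) := by linarith
  have h8 := le_of_mul_le_mul_left h7 (by positivity)
  calc S ≤ 10 * w ^ 45 := h8
    _ ≤ w * w ^ 45 := by gcongr; linarith
    _ = w ^ 46 := by ring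

/-- Burgess' bound for short sums of real characters to squarefree odd moduli. -/
lemma abs_win_chi_le {E : Finset ℕ} (hE : ∀ p ∈ E, p.Prime) (hE2 : ∀ p ∈ E, p ≠ 2) {w : ℝ}
    (hw : 10 ^ 6 ≤ w) (hwe : w ^ 100 = (∏ p ∈ E, p : ℕ)) (hK : (12000 : ℝ) ^ #E ≤ w ^ 2)
    {N : ℕ} (hN : (N : ℝ) ≤ w ^ 48) (z : ℤ) :
    |win (chi (∏ p ∈ E, p)) N z| ≤ w ^ 46 := by
  set e := ∏ p ∈ E, p with he
  have hw0 : 0 < w := by linarith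
  have hw1 : 1 ≤ w := by linarith
  have he0 : e ≠ 0 := prod_ne_zero_iff.2 fun p hp => (hE p hp).ne_zero
  have : NeZero e := ⟨he0⟩
  set S := win (chi e) N z with hS
  rcases le_or_gt (N : ℝ) (w ^ 46) with hN46 | hN46
  · refine le_trans ?_ hN46
    refine (abs_sum_le_sum_abs _ _).trans ((sum_le_sum fun i _ => abs_chi_le e _).trans ?_)
    simp
  have hcE : (#E : ℝ) ≤ w ^ 2 := by
    refine le_trans ?_ hK
    have : #E ≤ 12000 ^ #E := (Nat.lt_pow_self (by norm_num)).le
    exact_mod_cast this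
  obtain ⟨𝒜, hp, hco, hA, hcard⟩ := exists_primes_coprime hE hw hcE
  set A := ⌊w ^ 20⌋₊ with hAdef
  set B := ⌊w ^ 25⌋₊ with hBdef
  have hAw : (A : ℝ) ≤ w ^ 20 := Nat.floor_le (by positivity)
  have hBw : (B : ℝ) ≤ w ^ 25 := Nat.floor_le (by positivity)
  have hBw2 : w ^ 25 / 2 ≤ (B : ℝ) := by
    have h1 : w ^ 25 - 1 < B := Nat.sub_one_lt_floor _
    have : (10 ^ 6 : ℝ) ≤ w ^ 25 := hw.trans (le_self_pow₀ hw1 (by norm_num))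
    linarith
  have hcardA : (#𝒜 : ℝ) ≤ w ^ 20 := by
    refine le_trans ?_ hAw
    have h1 : 𝒜 ⊆ Icc 1 A := fun a ha => mem_Icc.2 ⟨(hp a ha).one_lt.le, hA a ha⟩
    have := card_le_card h1
    rw [Nat.card_Icc] at this
    exact_mod_cast (by omega : #𝒜 ≤ A)
  have hAN : 2 * A * N ≤ e := by
    have : (2 * A * N : ℝ) ≤ e := by
      rw [← hwe]
      calc (2 * A * N : ℝ) ≤ w * w ^ 20 * w ^ 48 := by gcongr; linarith
        _ = w ^ 69 := by ring
        _ ≤ w ^ 100 := pow_le_pow_right₀ hw1 (by norm_num)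
    exact_mod_cast this
  have hAN0 : #𝒜 ≤ N := by
    have h1 : w ^ 20 ≤ w ^ 46 := pow_le_pow_right₀ hw1 (by norm_num)
    exact_mod_cast (by linarith : (#𝒜 : ℝ) ≤ N)
  have hNe : N ≤ e := by
    have h1 : w ^ 48 ≤ w ^ 100 := pow_le_pow_right₀ hw1 (by norm_num)
    rw [hwe] at h1
    exact_mod_cast (by linarith : (N : ℝ) ≤ e)
  have hcoll := sum_collisions_le 𝒜 hp hco hA hAN hAN0 hNe z
  have hfour := sq_sum_fiber_le (𝒜 ×ˢ range N)
    (fun t => (t.1 : ZMod e)⁻¹ * ((z + t.2 : ℤ) : ZMod e))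
    (fun y => |win (chi e) B (y.val : ℤ)|)
  have hmain := card_mul_abs_win_chi_le (B := B) (N := N) 𝒜 hco hA z
  rw [← hS] at hmain
  set X := ∑ t ∈ 𝒜 ×ˢ range N,
        |win (chi e) B (((t.1 : ZMod e)⁻¹ * ((z + t.2 : ℤ) : ZMod e)).val : ℤ)| with hX
  have hmom : ∑ y : ZMod e, |win (chi e) B (y.val : ℤ)| ^ 4 ≤ e * (15 * w ^ 2 * w ^ 50) := by
    have h1 := avg_win_pow_four_le (a := fun _ => 1) (b := fun _ => 0) (by norm_num) (by norm_num)
      hE hE2 B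
    have hPhi : Phi (fun _ => 1) (fun _ => 0) E = chi e := funext fun n => Phi_one_zero hE n
    rw [hPhi, ← he, avg_eq_sum_zmod, div_le_iff₀ (by positivity)] at h1
    have h2 : ∀ y : ZMod e, |win (chi e) B (y.val : ℤ)| ^ 4 = win (chi e) B (y.val : ℤ) ^ 4 :=
      fun y => Even.pow_abs (by decide) _
    rw [sum_congr rfl fun y _ => h2 y]
    refine h1.trans ?_
    rw [mul_comm]
    have hsq : √(e : ℝ) = w ^ 50 := by
      rw [← hwe, show w ^ 100 = (w ^ 50) ^ 2 by ring, Real.sqrt_sq (by positivity)]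
    rw [hsq]
    have h3 : (B : ℝ) ^ 2 ≤ w ^ 50 := by
      calc (B : ℝ) ^ 2 ≤ (w ^ 25) ^ 2 := by gcongr
        _ = w ^ 50 := by ring
    have h4 : (w ^ 50)⁻¹ * (B : ℝ) ^ 4 ≤ w ^ 50 := by
      rw [inv_mul_le_iff₀ (by positivity)]
      calc (B : ℝ) ^ 4 ≤ (w ^ 25) ^ 4 := by gcongr
        _ = w ^ 50 * w ^ 50 := by ring
    have h5 : (1 : ℝ) ≤ 2 ^ #E := one_le_pow₀ (by norm_num)
    have h6 : (12000 : ℝ) ^ #E = 6000 ^ #E * 2 ^ #E := by rw [← mul_pow]; norm_num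
    refine mul_le_mul_of_nonneg_left ?_ (Nat.cast_nonneg e)
    calc (6000 : ℝ) ^ #E * (3 * B ^ 2 + 12 * 2 ^ #E * (w ^ 50)⁻¹ * B ^ 4)
        = 6000 ^ #E * (3 * B ^ 2 + 12 * 2 ^ #E * ((w ^ 50)⁻¹ * B ^ 4)) := by ring
      _ ≤ 6000 ^ #E * (3 * (2 ^ #E * w ^ 50) + 12 * 2 ^ #E * w ^ 50) := by
          gcongr
          nlinarith
      _ = 15 * 12000 ^ #E * w ^ 50 := by rw [h6]; ring
      _ ≤ 15 * w ^ 2 * w ^ 50 := by gcongr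
  have hX4 : X ^ 4 ≤ (#𝒜 * N) ^ 2 * (4 * #𝒜 * N) * (w ^ 100 * (15 * w ^ 2 * w ^ 50)) := by
    refine hfour.trans ?_
    rw [card_product, card_range, Nat.cast_mul, hwe]
    exact mul_le_mul (mul_le_mul_of_nonneg_left hcoll (by positivity)) hmom
      (sum_nonneg fun _ _ => by positivity) (by positivity)
  exact le_pow_of_fourth_moment hw hcard hBw2 hBw hAw (Nat.cast_nonneg _) hN hX4 hmain

lemma win_add (F : ℤ → ℝ) (N K : ℕ) (y : ℤ) : win F (N + K) y = win F N y + win F K (y + N) := by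
  simp only [win]
  rw [sum_range_add]
  congr 1
  refine sum_congr rfl fun i _ => ?_
  congr 1; push_cast; ring

lemma abs_win_le_of_short {F : ℤ → ℝ} {N : ℕ} (hN : 0 < N) {c : ℝ}
    (h : ∀ K ≤ N, ∀ y, |win F K y| ≤ c) (L : ℕ) (y : ℤ) : |win F L y| ≤ (L / N + 1) * c := by
  have hc : 0 ≤ c := (abs_nonneg _).trans (h 0 (Nat.zero_le _) 0)
  induction L using Nat.strong_induction_on generalizing y with
  | _ L ih =>
    rcases le_or_gt L N with hL | hL
    · refine (h L hL y).trans ?_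
      have : (0 : ℝ) ≤ L / N := by positivity
      nlinarith
    · obtain ⟨K, rfl⟩ := Nat.exists_eq_add_of_le hL.le
      rw [win_add]
      have h1 := ih K (by omega) (y + N)
      have h2 := h N le_rfl y
      have hN' : (N : ℝ) ≠ 0 := by positivity
      have e1 : (((N + K : ℕ) : ℝ) / N + 1) * c = c + (K / N + 1) * c := by
        push_cast; field_simp; ring
      rw [e1]
      exact (abs_add_le _ _).trans (add_le_add h2 h1)

lemma abs_win_chi_le' {E : Finset ℕ} (hE : ∀ p ∈ E, p.Prime) (hE2 : ∀ p ∈ E, p ≠ 2) {w : ℝ}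
    (hw : 10 ^ 6 ≤ w) (hwe : w ^ 100 = (∏ p ∈ E, p : ℕ)) (hK : (12000 : ℝ) ^ #E ≤ w ^ 2)
    (L : ℕ) (z : ℤ) :
    |win (chi (∏ p ∈ E, p)) L z| ≤ 2 * L / w ^ 2 + w ^ 46 := by
  have hw1 : 1 ≤ w := by linarith
  have hw0 : 0 < w := by linarith
  have h1 : (1 : ℝ) ≤ w ^ 48 := one_le_pow₀ hw1
  have hN0 : 0 < ⌊w ^ 48⌋₊ := Nat.floor_pos.2 h1
  have h2 : ((⌊w ^ 48⌋₊ : ℕ) : ℝ) ≤ w ^ 48 := Nat.floor_le (by positivity)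
  have h3 : w ^ 48 / 2 ≤ (⌊w ^ 48⌋₊ : ℕ) := by
    have h4 : w ^ 48 < (⌊w ^ 48⌋₊ : ℕ) + 1 := Nat.lt_floor_add_one _
    have h5 : (1 : ℝ) ≤ (⌊w ^ 48⌋₊ : ℕ) := by exact_mod_cast hN0
    linarith
  refine (abs_win_le_of_short hN0 (c := w ^ 46) (fun K hK' y => abs_win_chi_le hE hE2 hw hwe hK
    ((Nat.cast_le.2 hK').trans h2) y) L z).trans ?_
  have h6 : (L : ℝ) / (⌊w ^ 48⌋₊ : ℕ) ≤ L / (w ^ 48 / 2) := by gcongr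
  calc ((L : ℝ) / (⌊w ^ 48⌋₊ : ℕ) + 1) * w ^ 46 ≤ (L / (w ^ 48 / 2) + 1) * w ^ 46 := by gcongr
    _ = 2 * L / w ^ 2 + w ^ 46 := by field_simp

end Burgess

section Sup

lemma pow_div_pow_eq {x : ℝ} (hx : x ≠ 0) {k m n : ℕ} (h : k + n = m) : x ^ m / x ^ n = x ^ k := by
  rw [div_eq_iff (pow_ne_zero _ hx), ← pow_add, h]

lemma abs_win_Phi_le {a b : ℕ → ℝ} (ha : ∀ p, |a p| ≤ 2) (hb : ∀ p, |b p| ≤ 2) {D : Finset ℕ}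
    (hD : ∀ p ∈ D, p.Prime) {L : ℕ} {y : ℤ} {c : ℝ}
    (h : ∀ E ⊆ D, |win (fun n => chi (∏ p ∈ E, p) n * ∏ p ∈ D \ E, kap p n) L y| ≤ c) :
    |win (Phi a b D) L y| ≤ 4 ^ #D * c := by
  have h1 : ∀ n, Phi a b D n = ∑ E ∈ D.powerset, ((∏ p ∈ E, a p) * ∏ p ∈ D \ E, b p) *
      (chi (∏ p ∈ E, p) n * ∏ p ∈ D \ E, kap p n) := by
    intro n
    simp only [Phi, phi]
    rw [prod_add]
    refine sum_congr rfl fun E hE => ?_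
    have h2 := Phi_one_zero (E := E) (fun p hp => hD p (mem_powerset.1 hE hp)) n
    simp only [Phi, phi, one_mul, zero_mul, add_zero] at h2
    rw [← h2, prod_mul_distrib, prod_mul_distrib]
    ring
  have h2 : win (Phi a b D) L y = ∑ E ∈ D.powerset, ((∏ p ∈ E, a p) * ∏ p ∈ D \ E, b p) *
      win (fun n => chi (∏ p ∈ E, p) n * ∏ p ∈ D \ E, kap p n) L y := by
    simp only [win, h1]
    rw [sum_comm]
    refine sum_congr rfl fun E _ => ?_
    rw [mul_sum]
  rw [h2]
  refine (abs_sum_le_sum_abs _ _).trans ?_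
  have h3 : ∀ E ∈ D.powerset, |((∏ p ∈ E, a p) * ∏ p ∈ D \ E, b p) *
      win (fun n => chi (∏ p ∈ E, p) n * ∏ p ∈ D \ E, kap p n) L y| ≤ 2 ^ #D * c := by
    intro E hE
    have hED := mem_powerset.1 hE
    rw [abs_mul, abs_mul]
    have e1 := abs_prod_le_pow E a (c := 2) fun p _ => ha p
    have e2 := abs_prod_le_pow (D \ E) b (c := 2) fun p _ => hb p
    have e3 : (2 : ℝ) ^ #D = 2 ^ #E * 2 ^ #(D \ E) := by
      rw [← pow_add, add_comm, card_sdiff_add_card_eq_card hED]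
    rw [e3]
    have := h E hED
    gcongr
  refine (sum_le_sum h3).trans_eq ?_
  rw [sum_const, card_powerset, nsmul_eq_mul, ← mul_assoc]
  push_cast
  rw [← mul_pow]; norm_num

lemma prod_kap_eq {F : Finset ℕ} (hF : ∀ p ∈ F, p.Prime) (n : ℤ) :
    ∏ p ∈ F, kap p n = ∑ G ∈ F.powerset, (∏ p ∈ F \ G, (-(1 / (p : ℝ)))) *
      (if ((∏ p ∈ G, p : ℕ) : ℤ) ∣ n then (1 : ℝ) else 0) := by
  simp only [kap, sub_eq_add_neg]
  rw [prod_add]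
  refine sum_congr rfl fun G hG => ?_
  rw [mul_comm]
  congr 1
  rw [prod_boole]
  refine if_congr ?_ rfl rfl
  rw [Nat.cast_prod]
  constructor
  · intro h
    refine Finset.prod_dvd_of_coprime (fun p hp q hq hpq => ?_) h
    have := (Nat.coprime_primes (hF p (mem_powerset.1 hG hp)) (hF q (mem_powerset.1 hG hq))).2 hpq
    exact Nat.isCoprime_iff_coprime.2 this
  · intro h p hp
    exact (dvd_prod_of_mem (fun p : ℕ => (p : ℤ)) hp).trans h

lemma exists_sum_dvd_eq {g : ℕ} (hg : 0 < g) (L : ℕ) (y : ℤ) : ∃ (K : ℕ) (z : ℤ),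
    (K : ℝ) ≤ L / g + 1 ∧ ∀ F : ℤ → ℝ, ∑ h ∈ range L, (if (g : ℤ) ∣ y + h then F (y + h) else 0) =
      ∑ k ∈ range K, F (g * (z + k)) := by
  have hg' : (0 : ℤ) < g := by exact_mod_cast hg
  have hgq : (0 : ℚ) < g := by exact_mod_cast hg
  set z := ⌈(y : ℚ) / (g : ℤ)⌉ with hz
  set z' := ⌈((y + L : ℤ) : ℚ) / (g : ℤ)⌉ with hz'
  have hzz : z ≤ z' := by
    refine Int.ceil_le_ceil ?_
    push_cast
    gcongr
    linarith [(Nat.cast_nonneg L : (0 : ℚ) ≤ L)]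
  have range_Ico : ∀ (F : ℤ → ℝ) (K : ℕ) (u : ℤ), ∑ k ∈ range K, F (u + k) = ∑ n ∈ Ico u (u + K), F n := by
    intro F K u
    refine sum_bij' (fun k _ => u + (k : ℤ)) (fun n _ => (n - u).toNat) ?_ ?_ ?_ ?_ ?_
    · intro k hk; have := mem_range.1 hk; rw [mem_Ico]; omega
    · intro n hn; rw [mem_Ico] at hn; rw [mem_range]; omega
    · intro k hk; simp
    · intro n hn; rw [mem_Ico] at hn; simp; omega
    · intro k hk; rfl
  refine ⟨(z' - z).toNat, z, ?_, ?_⟩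
  · have h1 : ((y + L : ℤ) : ℚ) / (g : ℤ) = (y : ℚ) / (g : ℤ) + L / g := by push_cast; ring
    have h2 : ((z' - z : ℤ) : ℚ) ≤ L / g + 1 := by
      have h3 := Int.ceil_lt_add_one (((y + L : ℤ) : ℚ) / (g : ℤ))
      have h4 := Int.le_ceil ((y : ℚ) / (g : ℤ))
      rw [← hz'] at h3
      rw [← hz] at h4
      rw [h1] at h3
      push_cast
      linarith
    have h5 : (((z' - z).toNat : ℕ) : ℚ) ≤ L / g + 1 := by
      have : (((z' - z).toNat : ℕ) : ℤ) = z' - z := Int.toNat_of_nonneg (by omega)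
      have h6 : (((z' - z).toNat : ℕ) : ℚ) = ((z' - z : ℤ) : ℚ) := by exact_mod_cast this
      rw [h6]; exact h2
    have : ((((z' - z).toNat : ℕ) : ℚ) : ℝ) ≤ ((L / g + 1 : ℚ) : ℝ) := by exact_mod_cast h5
    push_cast at this
    exact this
  · intro F
    have h1 := range_Ico (fun n => if (g : ℤ) ∣ n then F n else 0) L y
    have h2 := range_Ico (fun n => F (g * n)) (z' - z).toNat z
    have h3 : z + ((z' - z).toNat : ℤ) = z' := by
      have : (((z' - z).toNat : ℕ) : ℤ) = z' - z := Int.toNat_of_nonneg (by omega)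
      omega
    rw [h1, h2, h3, ← sum_filter, Int.Ico_filter_dvd_eq _ _ hg', sum_map]
    refine sum_congr rfl fun n _ => ?_
    simp [mul_comm]

lemma abs_win_chi_kap_le {e : ℕ} {F : Finset ℕ} (hF : ∀ p ∈ F, p.Prime) {L : ℕ} {c : ℝ}
    (h : ∀ G ⊆ F, ∀ (K : ℕ) (z : ℤ), (K : ℝ) ≤ L / (∏ p ∈ G, p : ℕ) + 1 →
      (∏ p ∈ F \ G, (1 / (p : ℝ))) * |win (chi e) K z| ≤ c) (y : ℤ) :
    |win (fun n => chi e n * ∏ p ∈ F, kap p n) L y| ≤ 2 ^ #F * c := by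
  have h2 : win (fun n => chi e n * ∏ p ∈ F, kap p n) L y =
      ∑ G ∈ F.powerset, (∏ p ∈ F \ G, (-(1 / (p : ℝ)))) *
        ∑ i ∈ range L, (if ((∏ p ∈ G, p : ℕ) : ℤ) ∣ y + i then chi e (y + i) else 0) := by
    simp only [win, prod_kap_eq hF, mul_sum]
    rw [sum_comm]
    refine sum_congr rfl fun G _ => sum_congr rfl fun i _ => ?_
    split_ifs <;> ring
  rw [h2]
  refine (abs_sum_le_sum_abs _ _).trans ?_
  have h3 : ∀ G ∈ F.powerset, |(∏ p ∈ F \ G, (-(1 / (p : ℝ)))) *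
        ∑ i ∈ range L, (if ((∏ p ∈ G, p : ℕ) : ℤ) ∣ y + i then chi e (y + i) else 0)| ≤ c := by
    intro G hG
    have hGF := mem_powerset.1 hG
    have hg : 0 < ∏ p ∈ G, p := prod_pos fun p hp => (hF p (hGF hp)).pos
    obtain ⟨K, z, hK, hsum⟩ := exists_sum_dvd_eq hg L y
    rw [hsum (chi e), abs_mul, abs_prod]
    have e1 : ∑ k ∈ range K, chi e ((∏ p ∈ G, p : ℕ) * (z + k)) =
        chi e (∏ p ∈ G, p : ℕ) * win (chi e) K z := by
      simp only [chi_mul, win, mul_sum]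
    have e2 : ∀ p ∈ F \ G, |(-(1 / (p : ℝ)))| = 1 / (p : ℝ) := by
      intro p _
      rw [abs_neg, abs_of_nonneg (by positivity)]
    rw [e1, prod_congr rfl e2, abs_mul]
    refine le_trans ?_ (h G hGF K z hK)
    have e3 : (0 : ℝ) ≤ ∏ p ∈ F \ G, (1 / (p : ℝ)) := prod_nonneg fun _ _ => by positivity
    refine mul_le_mul_of_nonneg_left ?_ e3
    exact mul_le_of_le_one_left (abs_nonneg _) (abs_chi_le _ _)
  refine (sum_le_sum h3).trans_eq ?_
  rw [sum_const, card_powerset, nsmul_eq_mul]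
  push_cast; rfl

lemma abs_win_chi_kap_le_of_kap {e : ℕ} {F : Finset ℕ} (hF : ∀ p ∈ F, p.Prime) (L : ℕ) (y : ℤ) :
    |win (fun n => chi e n * ∏ p ∈ F, kap p n) L y| ≤
      2 ^ #F * (L / (∏ p ∈ F, p : ℕ) + 1) := by
  refine abs_win_chi_kap_le hF (fun G hG K z hK => ?_) y
  have h1 : |win (chi e) K z| ≤ L / (∏ p ∈ G, p : ℕ) + 1 := by
    refine le_trans ?_ hK
    refine (abs_sum_le_sum_abs _ _).trans ((sum_le_sum fun i _ => abs_chi_le e _).trans ?_)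
    simp
  have hg : (0 : ℝ) < (∏ p ∈ G, p : ℕ) := by
    exact_mod_cast prod_pos fun p hp => (hF p (hG hp)).pos
  have hfg : (0 : ℝ) < (∏ p ∈ F \ G, p : ℕ) := by
    exact_mod_cast prod_pos fun p hp => (hF p (sdiff_subset hp)).pos
  have hfg1 : (1 : ℝ) ≤ (∏ p ∈ F \ G, p : ℕ) := by exact_mod_cast hfg
  have e1 : ((∏ p ∈ F, p : ℕ) : ℝ) = (∏ p ∈ F \ G, p : ℕ) * (∏ p ∈ G, p : ℕ) := by
    rw [← Nat.cast_mul, prod_sdiff hG]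
  have e2 : ∏ p ∈ F \ G, (1 / (p : ℝ)) = 1 / (∏ p ∈ F \ G, p : ℕ) := by
    rw [prod_div_distrib]; simp
  rw [e2, e1]
  calc 1 / ((∏ p ∈ F \ G, p : ℕ) : ℝ) * |win (chi e) K z|
      ≤ 1 / ((∏ p ∈ F \ G, p : ℕ) : ℝ) * (L / (∏ p ∈ G, p : ℕ) + 1) := by gcongr
    _ = L / ((∏ p ∈ F \ G, p : ℕ) * (∏ p ∈ G, p : ℕ)) + 1 / ((∏ p ∈ F \ G, p : ℕ) : ℝ) := by
        field_simp
    _ ≤ _ := by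
        gcongr
        rw [div_le_one hfg]; exact hfg1

lemma abs_win_chi_kap_le_of_chi {e : ℕ} {F : Finset ℕ} (hF : ∀ p ∈ F, p.Prime) {L : ℕ} {c : ℝ}
    (h : ∀ K : ℕ, K ≤ L + 1 → ∀ z, |win (chi e) K z| ≤ c) (y : ℤ) :
    |win (fun n => chi e n * ∏ p ∈ F, kap p n) L y| ≤ 2 ^ #F * c := by
  refine abs_win_chi_kap_le hF (fun G hG K z hK => ?_) y
  have hg : (1 : ℝ) ≤ (∏ p ∈ G, p : ℕ) := by
    exact_mod_cast (prod_pos fun p hp => (hF p (hG hp)).pos : 0 < ∏ p ∈ G, p)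
  have h1 : (K : ℝ) ≤ L + 1 := hK.trans (by gcongr; exact div_le_self (by positivity) hg)
  refine le_trans ?_ (h K (by exact_mod_cast h1) z)
  refine mul_le_of_le_one_left (abs_nonneg _) ?_
  refine prod_le_one (fun _ _ => by positivity) fun p hp => ?_
  have : (1 : ℝ) ≤ p := by exact_mod_cast (hF p (sdiff_subset hp)).one_lt.le
  rw [div_le_one (by positivity)]; exact this

/-- A nontrivial bound for the sums of `Phi` over intervals of length `L ≤ x ^ 10000`, for moduli
between `x ^ 7000` and `x ^ 20200`. -/
lemma abs_win_Phi_le_pow {a b : ℕ → ℝ} (ha : ∀ p, |a p| ≤ 2) (hb : ∀ p, |b p| ≤ 2) {D : Finset ℕ}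
    (hD : ∀ p ∈ D, p.Prime) (hD2 : ∀ p ∈ D, p ≠ 2) {x : ℝ} (hx : 10 ^ 6 ≤ x)
    (hK : (12000 : ℝ) ^ #D ≤ x) (hd : x ^ 7000 ≤ (∏ p ∈ D, p : ℕ))
    (hd' : ((∏ p ∈ D, p : ℕ) : ℝ) ≤ x ^ 20200) {L : ℕ} (hL : (L : ℝ) ≤ x ^ 10000) (y : ℤ) :
    |win (Phi a b D) L y| ≤ x ^ 9902 := by
  have hx0 : 0 < x := by linarith
  have hx1 : 1 ≤ x := by linarith
  have h8 : (4 : ℝ) ^ #D * 2 ^ #D ≤ x := by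
    refine le_trans ?_ hK
    rw [← mul_pow]
    gcongr
    norm_num
  have key : ∀ E ⊆ D, |win (fun n => chi (∏ p ∈ E, p) n * ∏ p ∈ D \ E, kap p n) L y| ≤
      2 ^ #D * (5 * x ^ 9900) := by
    intro E hE
    have hF : ∀ p ∈ D \ E, p.Prime := fun p hp => hD p (sdiff_subset hp)
    have hcF : (2 : ℝ) ^ #(D \ E) ≤ 2 ^ #D :=
      pow_le_pow_right₀ (by norm_num) (card_le_card sdiff_subset)
    have hprod : ((∏ p ∈ D, p : ℕ) : ℝ) = (∏ p ∈ D \ E, p : ℕ) * (∏ p ∈ E, p : ℕ) := by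
      rw [← Nat.cast_mul, prod_sdiff hE]
    have he1 : (1 : ℝ) ≤ (∏ p ∈ E, p : ℕ) := by
      exact_mod_cast (prod_pos fun p hp => (hD p (hE hp)).pos : 0 < ∏ p ∈ E, p)
    have hf1 : (1 : ℝ) ≤ (∏ p ∈ D \ E, p : ℕ) := by
      exact_mod_cast (prod_pos fun p hp => (hF p hp).pos : 0 < ∏ p ∈ D \ E, p)
    rcases le_or_gt (x ^ 2000) ((∏ p ∈ D \ E, p : ℕ) : ℝ) with hf | hf
    · refine (abs_win_chi_kap_le_of_kap hF L y).trans ?_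
      refine mul_le_mul hcF ?_ (by positivity) (by positivity)
      calc (L : ℝ) / (∏ p ∈ D \ E, p : ℕ) + 1 ≤ x ^ 10000 / x ^ 2000 + 1 := by gcongr
        _ = x ^ 8000 + 1 := by rw [pow_div_pow_eq (k := 8000) hx0.ne' (by norm_num)]
        _ ≤ x ^ 9900 + x ^ 9900 :=
            add_le_add (pow_le_pow_right₀ hx1 (by norm_num)) (one_le_pow₀ hx1)
        _ ≤ 5 * x ^ 9900 := by have : 0 < x ^ 9900 := by positivity
                               linarith
    · have he : x ^ 5000 ≤ (∏ p ∈ E, p : ℕ) := by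
        by_contra hcon
        push Not at hcon
        have h1 : ((∏ p ∈ D, p : ℕ) : ℝ) < x ^ 2000 * x ^ 5000 := by
          rw [hprod]
          exact mul_lt_mul'' hf hcon (by positivity) (by positivity)
        rw [← pow_add, show 2000 + 5000 = 7000 by norm_num] at h1
        linarith
      have he' : ((∏ p ∈ E, p : ℕ) : ℝ) ≤ x ^ 20200 := by
        refine le_trans ?_ hd'
        rw [hprod]
        exact le_mul_of_one_le_left (by positivity) hf1
      obtain ⟨w, hw0, hwe⟩ : ∃ w : ℝ, 0 ≤ w ∧ w ^ 100 = (∏ p ∈ E, p : ℕ) :=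
        ⟨((∏ p ∈ E, p : ℕ) : ℝ) ^ ((1 : ℝ) / (100 : ℕ)), by positivity, by
          rw [one_div]; exact Real.rpow_inv_natCast_pow (by positivity) (by norm_num)⟩
      have hw50 : x ^ 50 ≤ w := by
        refine le_of_pow_le_pow_left₀ (n := 100) (by norm_num) hw0 ?_
        rw [hwe, ← pow_mul]; exact he
      have hw202 : w ≤ x ^ 202 := by
        refine le_of_pow_le_pow_left₀ (n := 100) (by norm_num) (by positivity) ?_
        rw [hwe, ← pow_mul]; exact he'
      have hxw : x ≤ w := (le_self_pow₀ hx1 (by norm_num)).trans hw50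
      have hK' : (12000 : ℝ) ^ #E ≤ w ^ 2 := by
        calc (12000 : ℝ) ^ #E ≤ 12000 ^ #D := pow_le_pow_right₀ (by norm_num) (card_le_card hE)
          _ ≤ x := hK
          _ ≤ w := hxw
          _ ≤ w ^ 2 := le_self_pow₀ (hx1.trans hxw) (by norm_num)
      refine (abs_win_chi_kap_le_of_chi hF (c := 5 * x ^ 9900) (fun K hKL z => ?_) y).trans ?_
      · refine (abs_win_chi_le' (fun p hp => hD p (hE hp)) (fun p hp => hD2 p (hE hp))
          (hx.trans hxw) hwe hK' K z).trans ?_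
        have h1 : (K : ℝ) ≤ 2 * x ^ 10000 := by
          have h2 : (K : ℝ) ≤ L + 1 := by exact_mod_cast hKL
          have h3 : (1 : ℝ) ≤ x ^ 10000 := one_le_pow₀ hx1
          linarith
        have h2 : x ^ 100 ≤ w ^ 2 := by
          calc x ^ 100 = (x ^ 50) ^ 2 := by rw [← pow_mul]
            _ ≤ w ^ 2 := by gcongr
        have h3 : w ^ 46 ≤ x ^ 9900 := by
          calc w ^ 46 ≤ (x ^ 202) ^ 46 := by gcongr
            _ = x ^ 9292 := by rw [← pow_mul]
            _ ≤ x ^ 9900 := pow_le_pow_right₀ hx1 (by norm_num)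
        calc 2 * (K : ℝ) / w ^ 2 + w ^ 46 ≤ 2 * (2 * x ^ 10000) / x ^ 100 + x ^ 9900 := by gcongr
          _ = 4 * (x ^ 10000 / x ^ 100) + x ^ 9900 := by ring
          _ = 5 * x ^ 9900 := by rw [pow_div_pow_eq (k := 9900) hx0.ne' (by norm_num)]; ring
      · gcongr
  refine (abs_win_Phi_le ha hb hD key).trans ?_
  calc (4 : ℝ) ^ #D * (2 ^ #D * (5 * x ^ 9900)) = (4 ^ #D * 2 ^ #D) * 5 * x ^ 9900 := by ring
    _ ≤ x * x * x ^ 9900 := by gcongr; linarith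
    _ = x ^ 9902 := by rw [← sq, ← pow_add]

lemma avg_Phi {a b : ℕ → ℝ} {D : Finset ℕ} (hD : ∀ p ∈ D, p.Prime) (hD2 : ∀ p ∈ D, p ≠ 2)
    (hne : D.Nonempty) : avg (∏ p ∈ D, p) (Phi a b D) = 0 := by
  have h := avg_prod_Phi (ι := Unit) a b hD {()} (fun _ => 0)
  simp only [prod_singleton, add_zero] at h
  refine h.trans ?_
  obtain ⟨p, hp⟩ := hne
  exact prod_eq_zero hp (avg_phi (hD p hp) (hD2 p hp))

lemma win_mod {F : ℤ → ℝ} {d : ℕ} (hd : 0 < d) (hF : Function.Periodic F (d : ℤ))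
    (h0 : avg d F = 0) (H : ℕ) (y : ℤ) : win F H y = win F (H % d) y := by
  have hper : ∀ z : ℤ, win F d z = 0 := by
    intro z
    have h1 := avg_shift hF z
    rw [h0, avg, div_eq_zero_iff] at h1
    rcases h1 with h1 | h1
    · rw [win, ← h1]
      exact sum_congr rfl fun i _ => by rw [add_comm]
    · exact absurd h1 (by positivity)
  have key : ∀ k : ℕ, win F (H % d + d * k) y = win F (H % d) y := by
    intro k
    induction k with
    | zero => simp
    | succ k ih =>
      rw [show H % d + d * (k + 1) = (H % d + d * k) + d by ring, win_add, hper, add_zero, ih]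
  rw [← key (H / d), Nat.mod_add_div]

lemma abs_win_Phi_le_trivial {a b : ℕ → ℝ} (ha : ∀ p, |a p| ≤ 2) (hb : ∀ p, |b p| ≤ 2)
    {D : Finset ℕ} (hD : ∀ p ∈ D, p.Prime) (L : ℕ) (y : ℤ) :
    |win (Phi a b D) L y| ≤ L * 4 ^ #D := by
  refine (abs_sum_le_sum_abs _ _).trans ((sum_le_sum fun i _ => ?_).trans_eq
    (by rw [sum_const, card_range, nsmul_eq_mul]))
  exact abs_prod_le_pow D _ fun p hp => abs_phi_le ha hb (hD p hp).pos _

lemma avg_win_pow_four_le_pow {a b : ℕ → ℝ} (ha : ∀ p, |a p| ≤ 2) (hb : ∀ p, |b p| ≤ 2)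
    {D : Finset ℕ} (hD : ∀ p ∈ D, p.Prime) (hD2 : ∀ p ∈ D, p ≠ 2) (hne : D.Nonempty) {x : ℝ}
    (hx : 10 ^ 6 ≤ x) (hK : (12000 : ℝ) ^ #D ≤ x) {H : ℕ} (hH : (H : ℝ) = x ^ 10000) :
    avg (∏ p ∈ D, p) (fun y => win (Phi a b D) H y ^ 4) ≤ x ^ 29902 := by
  have hx0 : 0 < x := by linarith
  have hx1 : 1 ≤ x := by linarith
  set d := ∏ p ∈ D, p with hd
  have hd0 : 0 < d := prod_pos fun p hp => (hD p hp).pos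
  rcases le_or_gt ((d : ℕ) : ℝ) (x ^ 20200) with hd1 | hd1
  · have hHd : H % d < d := Nat.mod_lt _ hd0
    have hHd' : ((H % d : ℕ) : ℝ) ≤ x ^ 10000 := by
      rw [← hH]; exact_mod_cast Nat.mod_le H d
    have hwin : ∀ y, win (Phi a b D) H y = win (Phi a b D) (H % d) y :=
      win_mod hd0 (Phi_periodic a b D) (avg_Phi hD hD2 hne) H
    have hsup : ∀ y, |win (Phi a b D) (H % d) y| ≤ x ^ 9902 := by
      intro y
      rcases le_or_gt (x ^ 7000) ((d : ℕ) : ℝ) with hd2 | hd2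
      · exact abs_win_Phi_le_pow ha hb hD hD2 hx hK hd2 hd1 hHd' y
      · refine (abs_win_Phi_le_trivial ha hb hD _ y).trans ?_
        have h1 : ((H % d : ℕ) : ℝ) ≤ x ^ 7000 := by
          have : ((H % d : ℕ) : ℝ) ≤ d := by exact_mod_cast hHd.le
          linarith
        have h2 : (4 : ℝ) ^ #D ≤ x := le_trans (by gcongr; norm_num) hK
        calc ((H % d : ℕ) : ℝ) * 4 ^ #D ≤ x ^ 7000 * x := by gcongr
          _ = x ^ 7001 := by rw [← pow_succ]
          _ ≤ x ^ 9902 := pow_le_pow_right₀ hx1 (by norm_num)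
    have h2 := avg_win_sq_le ha hb hD hD2 hHd.le
    rw [← hd] at h2
    have h3 : ∀ y, win (Phi a b D) H y ^ 4 ≤ (x ^ 9902) ^ 2 * win (Phi a b D) (H % d) y ^ 2 := by
      intro y
      rw [hwin]
      have : win (Phi a b D) (H % d) y ^ 2 ≤ (x ^ 9902) ^ 2 := sq_le_sq.2 (by
        rw [abs_of_pos (show (0 : ℝ) < x ^ 9902 by positivity)]; exact hsup y)
      nlinarith [sq_nonneg (win (Phi a b D) (H % d) y)]
    refine (avg_mono h3).trans ?_
    rw [avg_const_mul]
    calc (x ^ 9902) ^ 2 * avg d (fun y => win (Phi a b D) (H % d) y ^ 2)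
        ≤ (x ^ 9902) ^ 2 * (2 * x * x ^ 10000) := by
          refine mul_le_mul_of_nonneg_left (h2.trans ?_) (by positivity)
          gcongr
      _ ≤ (x ^ 9902) ^ 2 * (x * x * x ^ 10000) := by gcongr; linarith
      _ = x ^ 29806 := by rw [← pow_mul, ← sq, ← pow_add, ← pow_add]
      _ ≤ x ^ 29902 := pow_le_pow_right₀ hx1 (by norm_num)
  · refine (avg_win_pow_four_le ha hb hD hD2 H).trans ?_
    have hs : x ^ 10100 ≤ √((d : ℕ) : ℝ) := by
      refine Real.le_sqrt_of_sq_le ?_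
      rw [← pow_mul]; exact hd1.le
    have h6 : (12000 : ℝ) ^ #D = 6000 ^ #D * 2 ^ #D := by rw [← mul_pow]; norm_num
    have h5 : (1 : ℝ) ≤ 2 ^ #D := one_le_pow₀ (by norm_num)
    rw [hH, ← hd, ← pow_mul, ← pow_mul]
    have h7 : (√((d : ℕ) : ℝ))⁻¹ * x ^ (10000 * 4) ≤ x ^ 29900 := by
      rw [inv_mul_le_iff₀ (lt_of_lt_of_le (by positivity) hs)]
      calc x ^ (10000 * 4) = x ^ 10100 * x ^ 29900 := by rw [← pow_add]
        _ ≤ _ := by gcongr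
    have h8 : x ^ (10000 * 2) ≤ x ^ 29900 := pow_le_pow_right₀ hx1 (by norm_num)
    have h9 : (0 : ℝ) < x ^ 29900 := by positivity
    calc (6000 : ℝ) ^ #D * (3 * x ^ (10000 * 2) +
          12 * 2 ^ #D * (√((d : ℕ) : ℝ))⁻¹ * x ^ (10000 * 4))
        = 6000 ^ #D * (3 * x ^ (10000 * 2) +
          12 * 2 ^ #D * ((√((d : ℕ) : ℝ))⁻¹ * x ^ (10000 * 4))) := by rw [mul_assoc (12 * 2 ^ #D)]
      _ ≤ 6000 ^ #D * (3 * (2 ^ #D * x ^ 29900) + 12 * 2 ^ #D * x ^ 29900) := by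
          gcongr
          exact h8.trans (le_mul_of_one_le_left h9.le h5)
      _ = 15 * 12000 ^ #D * x ^ 29900 := by rw [h6]; ring
      _ ≤ x * x * x ^ 29900 := by gcongr; linarith
      _ = x ^ 29902 := by rw [← sq, ← pow_add]

end Sup

section Crude

variable {ι : Type*} [Fintype ι] [DecidableEq ι]

lemma abs_avg_prod_sum_le (a b : ℕ → ℝ) (h : ι → ℤ) {ρ : ℕ → ι → ℝ} {P : Finset ℕ} (hP : ∀ p ∈ P, p.Prime) (c : ι → Finset ℕ → ℝ) (t : ι → ℝ)
    (hc : ∀ i, ∀ D ⊆ P, |c i D| ≤ t i * ∏ p ∈ D, ρ p i) :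
    |avg (∏ p ∈ P, p) (fun x => ∏ i, ∑ D ∈ P.powerset, c i D * Phi a b D (x + h i))| ≤
      (∏ i, t i) * ∏ p ∈ P, ∑ J : Finset ι,
        |avg p (fun x => ∏ j ∈ J, phi a b p (x + h j))| * ∏ i ∈ J, ρ p i := by
  induction P using Finset.induction_on generalizing c t with
  | empty =>
    have h1 : ∀ i, |c i ∅| ≤ t i := fun i => by simpa using hc i ∅ (Finset.Subset.refl _)
    have h2 : ∀ x : ℤ, ∏ i, ∑ D ∈ (∅ : Finset ℕ).powerset, c i D * Phi a b D (x + h i) =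
        ∏ i, c i ∅ := fun x => by simp [Phi]
    simp only [h2, prod_empty, mul_one]
    rw [avg_const one_pos, abs_prod]
    exact prod_le_prod (fun _ _ => abs_nonneg _) fun i _ => h1 i
  | insert q P hq ih =>
    have hP' : ∀ p ∈ P, p.Prime := fun p hp => hP p (mem_insert_of_mem hp)
    have hqp := hP q (mem_insert_self q P)
    have hcop : q.Coprime (∏ p ∈ P, p) := Nat.Coprime.prod_right fun p hp =>
      (Nat.coprime_primes hqp (hP' p hp)).2 (by rintro rfl; exact hq hp)
    let cJ : Finset ι → ι → Finset ℕ → ℝ := fun J i D => if i ∈ J then c i (insert q D) else c i D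
    let tJ : Finset ι → ι → ℝ := fun J i => if i ∈ J then t i * ρ q i else t i
    have hexp : ∀ x : ℤ, ∏ i, ∑ D ∈ (insert q P).powerset, c i D * Phi a b D (x + h i) =
        ∑ J : Finset ι, (∏ j ∈ J, phi a b q (x + h j)) *
          ∏ i, ∑ D ∈ P.powerset, cJ J i D * Phi a b D (x + h i) := by
      intro x
      have h1 : ∀ i, ∑ D ∈ (insert q P).powerset, c i D * Phi a b D (x + h i) =
          phi a b q (x + h i) * (∑ D ∈ P.powerset, c i (insert q D) * Phi a b D (x + h i)) +
          ∑ D ∈ P.powerset, c i D * Phi a b D (x + h i) := by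
        intro i
        rw [sum_powerset_insert hq, add_comm, mul_sum]
        congr 1
        refine sum_congr rfl fun D hD => ?_
        have : q ∉ D := fun hh => hq (mem_powerset.1 hD hh)
        rw [Phi, prod_insert this, Phi]; ring
      simp only [h1]
      rw [prod_add, powerset_univ]
      refine sum_congr rfl fun J _ => ?_
      rw [prod_mul_distrib, mul_assoc]
      congr 1
      rw [← prod_sdiff (subset_univ J), mul_comm]
      congr 1
      · refine prod_congr rfl fun i hi => ?_
        simp only [cJ, if_neg (mem_sdiff.1 hi).2]
      · refine prod_congr rfl fun i hi => ?_
        simp only [cJ, if_pos hi]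
    have hterm : ∀ J : Finset ι, |avg (q * ∏ p ∈ P, p) (fun x => (∏ j ∈ J, phi a b q (x + h j)) *
          ∏ i, ∑ D ∈ P.powerset, cJ J i D * Phi a b D (x + h i))| ≤
        |avg q (fun x => ∏ j ∈ J, phi a b q (x + h j))| * ((∏ i, tJ J i) * ∏ p ∈ P, ∑ J : Finset ι,
        |avg p (fun x => ∏ j ∈ J, phi a b p (x + h j))| * ∏ i ∈ J, ρ p i) := by
      intro J
      rw [avg_mul_coprime hcop (_root_.periodic_prod J fun i _ => periodic_shift (phi_periodic a b q) _)
        (_root_.periodic_prod univ fun i _ => _root_.periodic_sum _ fun D hD => ?_) hqp.pos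
        (prod_pos fun p hp => (hP' p hp).pos), abs_mul]
      · refine mul_le_mul_of_nonneg_left (ih hP' (cJ J) (tJ J) ?_) (abs_nonneg _)
        intro i D hD
        by_cases hi : i ∈ J
        · simp only [cJ, tJ, if_pos hi]
          have hqD : q ∉ D := fun hh => hq (hD hh)
          have := hc i (insert q D) (insert_subset_insert q hD)
          rw [prod_insert hqD] at this
          rwa [mul_assoc]
        · simp only [cJ, tJ, if_neg hi]
          exact hc i D (hD.trans (subset_insert q P))
      · intro x
        have h1 : Function.Periodic (Phi a b D) ((∏ p ∈ P, p : ℕ) : ℤ) :=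
          periodic_of_dvd (prod_dvd_prod_of_subset _ _ _ (mem_powerset.1 hD)) (Phi_periodic a b D)
        have := periodic_shift h1 (h i) x
        simp only at this ⊢
        rw [this]
    have htJ : ∀ J : Finset ι, ∏ i, tJ J i = (∏ i, t i) * ∏ i ∈ J, ρ q i := by
      intro J
      have : ∀ i, tJ J i = t i * (if i ∈ J then ρ q i else 1) := by
        intro i; simp only [tJ]; split_ifs <;> simp
      simp only [this]
      rw [prod_mul_distrib, prod_ite_mem, univ_inter]
    rw [prod_insert hq, prod_insert hq]
    simp only [hexp]
    rw [avg_sum]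
    refine (abs_sum_le_sum_abs _ _).trans ((sum_le_sum fun J _ => hterm J).trans_eq ?_)
    simp only [htJ]
    rw [sum_mul, mul_sum]
    refine sum_congr rfl fun J _ => ?_
    ring

lemma sum_abs_avg_prod_phi_le {a b : ℕ → ℝ} (ha : ∀ p, |a p| ≤ 2) (hb : ∀ p, |b p| ≤ 2)
    (hι : Fintype.card ι ≤ 4) (h : ι → ℤ) {R : Finset ι} {Δ : ℤ}
    (hΔ : ∀ i ∈ R, ∀ j, j ≠ i → h j - h i ∣ Δ) {p : ℕ} (hp : p.Prime) (hp6 : 10 ^ 6 ≤ p) {r : ℝ}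
    (hr0 : 0 ≤ r) (hr : r ^ 16 = p) :
    ∑ J : Finset ι, |avg p (fun x => ∏ j ∈ J, phi a b p (x + h j))| *
      ∏ i ∈ J, (if i ∈ R then r else 1) ≤ 4096 * (if (p : ℤ) ∣ Δ then (p : ℝ) else 1) := by
  have hpR : (10 : ℝ) ^ 6 ≤ p := by exact_mod_cast hp6
  have hr1 : 1 ≤ r := by
    by_contra hcon
    have := pow_le_one₀ (n := 16) hr0 (not_le.1 hcon).le
    rw [hr] at this; linarith
  have hr4 : 24 ≤ r ^ 4 := by
    refine le_of_pow_le_pow_left₀ (n := 4) (by norm_num) (by positivity) ?_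
    rw [← pow_mul, show 4 * 4 = 16 by norm_num, hr]
    exact le_trans (by norm_num) hpR
  have hs : √(p : ℝ) = r ^ 8 := by
    rw [← hr, show r ^ 16 = (r ^ 8) ^ 2 by ring, Real.sqrt_sq (by positivity)]
  have hJ4 : ∀ J : Finset ι, #J ≤ 4 := fun J => (card_le_univ J).trans hι
  have hρ : ∀ J : Finset ι, ∏ i ∈ J, (if i ∈ R then r else 1) ≤ r ^ 4 := by
    intro J
    calc ∏ i ∈ J, (if i ∈ R then r else 1) ≤ ∏ i ∈ J, r :=
          prod_le_prod (fun i _ => by split_ifs <;> positivity) fun i _ => by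
            split_ifs <;> linarith
      _ = r ^ #J := prod_const _
      _ ≤ r ^ 4 := pow_le_pow_right₀ hr1 (hJ4 J)
  have hρ0 : ∀ J : Finset ι, 0 ≤ ∏ i ∈ J, (if i ∈ R then r else 1) := fun J =>
    prod_nonneg fun i _ => by split_ifs <;> positivity
  have key : ∀ J ∈ (univ : Finset (Finset ι)),
      |avg p (fun x => ∏ j ∈ J, phi a b p (x + h j))| * ∏ i ∈ J, (if i ∈ R then r else 1) ≤
        256 * (if (p : ℤ) ∣ Δ then (p : ℝ) else 1) := by
    intro J _
    have h256 := abs_avg_prod_phi_le_pow ha hb hp.pos J (hJ4 J) h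
    split_ifs with hd
    · have hrp : r ^ 4 ≤ p := by rw [← hr]; exact pow_le_pow_right₀ hr1 (by norm_num)
      exact mul_le_mul h256 ((hρ J).trans hrp) (hρ0 J) (by norm_num)
    · by_cases hJR : ∃ i ∈ J, i ∈ R
      · obtain ⟨i, hiJ, hiR⟩ := hJR
        have h1 := (abs_avg_prod_phi_le ha hb hp (by rintro rfl; norm_num at hp6) J (hJ4 J) h hiJ
          fun j _ hji hdvd => hd (hdvd.trans (hΔ i hiR j hji))).1
        refine (mul_le_mul h1 (hρ J) (hρ0 J) (by positivity)).trans ?_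
        rw [hs, show r ^ 8 = r ^ 4 * r ^ 4 by ring, div_mul_eq_mul_div,
          mul_div_mul_right _ _ (by positivity), div_le_iff₀ (by positivity)]
        linarith
      · push Not at hJR
        rw [prod_congr rfl (fun i hi => if_neg (hJR i hi)), prod_const_one]
        linarith
  refine (sum_le_sum key).trans ?_
  rw [sum_const, card_univ, Fintype.card_finset, nsmul_eq_mul, ← mul_assoc]
  refine mul_le_mul_of_nonneg_right ?_ (by split_ifs <;> positivity)
  have : (2 : ℝ) ^ Fintype.card ι ≤ 2 ^ 4 := pow_le_pow_right₀ (by norm_num) hι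
  push_cast; linarith

lemma prod_ite_dvd_le {P : Finset ℕ} (hP : ∀ p ∈ P, p.Prime) {Δ : ℤ} (hΔ : Δ ≠ 0) :
    ∏ p ∈ P, (if (p : ℤ) ∣ Δ then (p : ℝ) else 1) ≤ |(Δ : ℝ)| := by
  rw [← prod_filter, ← Nat.cast_prod]
  have h1 := (prod_dvd_sub hP Δ Δ).1
  simp only [and_self] at h1
  have := Int.le_of_dvd (abs_pos.2 hΔ) ((dvd_abs _ _).2 h1)
  exact_mod_cast this

/-- The part of `∏ p ∈ P, (1 + phi a b p n)` coming from moduli exceeding `T`. -/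
noncomputable def tail (a b : ℕ → ℝ) (P : Finset ℕ) (T : ℝ) (n : ℤ) : ℝ :=
  ∑ D ∈ P.powerset, (if T < (∏ p ∈ D, p : ℕ) then 1 else 0) * Phi a b D n

lemma abs_avg_prod_tail_le {a b : ℕ → ℝ} (ha : ∀ p, |a p| ≤ 2) (hb : ∀ p, |b p| ≤ 2)
    (hι : Fintype.card ι ≤ 4) (h : ι → ℤ)
    {P : Finset ℕ} (hP : ∀ p ∈ P, p.Prime) (hP6 : ∀ p ∈ P, 10 ^ 6 ≤ p) {H : ℝ} (hH : 4096 ≤ H)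
    (hPH : (3 / 2 : ℝ) ^ #P ≤ H) (hh : ∀ i j, |((h j - h i : ℤ) : ℝ)| ≤ 2 * H)
    (hR : ∃ i j, i ≠ j ∧ (∀ k, k ≠ i → h k ≠ h i) ∧ ∀ k, k ≠ j → h k ≠ h j) :
    |avg (∏ p ∈ P, p) (fun x => ∏ i, tail a b P (H ^ 1600) (x + h i))| ≤ (H ^ 100)⁻¹ := by
  obtain ⟨i₀, j₀, hij, hi₀, hj₀⟩ := hR
  have hH0 : 0 < H := by linarith
  have hH1 : 1 ≤ H := by linarith
  set R : Finset ι := {i₀, j₀} with hRdef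
  have hRiso : ∀ i ∈ R, ∀ k, k ≠ i → h k ≠ h i := by
    intro i hi
    rcases mem_insert.1 hi with rfl | hi
    · exact hi₀
    · rw [mem_singleton.1 hi]; exact hj₀
  set Δ : ℤ := ∏ i ∈ R, ∏ j ∈ univ.erase i, (h j - h i) with hΔ
  have hΔ0 : Δ ≠ 0 := prod_ne_zero_iff.2 fun i hi => prod_ne_zero_iff.2 fun j hj =>
    sub_ne_zero.2 (hRiso i hi j (mem_erase.1 hj).1)
  have hΔd : ∀ i ∈ R, ∀ j, j ≠ i → h j - h i ∣ Δ := fun i hi j hj =>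
    (dvd_prod_of_mem (fun j => h j - h i) (mem_erase.2 ⟨hj, mem_univ _⟩)).trans
      (dvd_prod_of_mem (fun i => ∏ j ∈ univ.erase i, (h j - h i)) hi)
  have hcR : #R = 2 := card_pair hij
  have hΔle : |(Δ : ℝ)| ≤ (2 * H) ^ 6 := by
    rw [hΔ, Int.cast_prod, abs_prod]
    calc ∏ i ∈ R, |((∏ j ∈ univ.erase i, (h j - h i) : ℤ) : ℝ)| ≤ ∏ i ∈ R, (2 * H) ^ 3 := by
          refine prod_le_prod (fun _ _ => abs_nonneg _) fun i _ => ?_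
          rw [Int.cast_prod, abs_prod]
          refine (prod_le_prod (fun _ _ => abs_nonneg _) fun j _ => hh i j).trans ?_
          rw [prod_const]
          refine pow_le_pow_right₀ (by linarith) ?_
          rw [card_erase_of_mem (mem_univ _), card_univ]; omega
      _ = (2 * H) ^ 6 := by rw [prod_const, hcR, ← pow_mul]
  set r : ℕ → ℝ := fun p => (p : ℝ) ^ ((1 : ℝ) / (16 : ℕ)) with hr
  have hr0 : ∀ p, 0 ≤ r p := fun p => by positivity
  have hr16 : ∀ p, r p ^ 16 = p := fun p => by
    simp only [hr, one_div]; exact Real.rpow_inv_natCast_pow (by positivity) (by norm_num)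
  have hr1 : ∀ p : ℕ, 1 ≤ p → 1 ≤ r p := fun p hp =>
    Real.one_le_rpow (by exact_mod_cast hp) (by positivity)
  have main := abs_avg_prod_sum_le a b h (ρ := fun p i => if i ∈ R then r p else 1) hP
    (fun _ D => if H ^ 1600 < (∏ p ∈ D, p : ℕ) then 1 else 0)
    (fun i => if i ∈ R then (H ^ 100)⁻¹ else 1) (by
      intro i D hD
      by_cases hi : i ∈ R
      · simp only [if_pos hi]
        have hprod : (∏ p ∈ D, r p) ^ 16 = (∏ p ∈ D, p : ℕ) := by
          rw [← prod_pow, Nat.cast_prod]; exact prod_congr rfl fun p _ => hr16 p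
        have h0 : 0 ≤ ∏ p ∈ D, r p := prod_nonneg fun p _ => hr0 p
        split_ifs with hT
        · rw [abs_one, inv_mul_eq_div, one_le_div (by positivity)]
          refine le_of_pow_le_pow_left₀ (n := 16) (by norm_num) h0 ?_
          rw [hprod, ← pow_mul]; exact hT.le
        · rw [abs_zero]; positivity
      · simp only [if_neg hi, prod_const_one, mul_one]
        split_ifs <;> simp)
  refine main.trans ?_
  have ht : ∏ i, (if i ∈ R then (H ^ 100)⁻¹ else 1) = ((H ^ 100)⁻¹) ^ 2 := by
    rw [prod_ite_mem, univ_inter, prod_const, hcR]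
  have hprodP : ∏ p ∈ P, ∑ J : Finset ι, |avg p (fun x => ∏ j ∈ J, phi a b p (x + h j))| *
      ∏ i ∈ J, (if i ∈ R then r p else 1) ≤ H ^ 21 * (2 * H) ^ 6 := by
    calc _ ≤ ∏ p ∈ P, (4096 * (if (p : ℤ) ∣ Δ then (p : ℝ) else 1)) :=
          prod_le_prod (fun p _ => sum_nonneg fun J _ => mul_nonneg (abs_nonneg _)
            (prod_nonneg fun i _ => by split_ifs; exacts [hr0 p, zero_le_one]))
            fun p hp => sum_abs_avg_prod_phi_le ha hb hι h hΔd (hP p hp) (hP6 p hp) (hr0 p) (hr16 p)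
      _ = 4096 ^ #P * ∏ p ∈ P, (if (p : ℤ) ∣ Δ then (p : ℝ) else 1) := by
          rw [prod_mul_distrib, prod_const]
      _ ≤ H ^ 21 * (2 * H) ^ 6 := by
          refine mul_le_mul ?_ ((prod_ite_dvd_le hP hΔ0).trans hΔle)
            (prod_nonneg fun p _ => by split_ifs <;> positivity) (by positivity)
          calc (4096 : ℝ) ^ #P ≤ ((3 / 2) ^ 21) ^ #P := by gcongr; norm_num
            _ = ((3 / 2) ^ #P) ^ 21 := by rw [← pow_mul, ← pow_mul, mul_comm]
            _ ≤ H ^ 21 := by gcongr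
  rw [ht]
  refine (mul_le_mul_of_nonneg_left hprodP (by positivity)).trans ?_
  have h3 : H ^ 21 * (2 * H) ^ 6 ≤ H ^ 100 := by
    calc H ^ 21 * (2 * H) ^ 6 = 64 * H ^ 27 := by ring
      _ ≤ H * H ^ 27 := by gcongr; linarith
      _ = H ^ 28 := by ring
      _ ≤ H ^ 100 := pow_le_pow_right₀ hH1 (by norm_num)
  calc (H ^ 100)⁻¹ ^ 2 * (H ^ 21 * (2 * H) ^ 6) ≤ (H ^ 100)⁻¹ ^ 2 * H ^ 100 := by gcongr
    _ = (H ^ 100)⁻¹ := by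
      have : H ^ 100 ≠ 0 := by positivity
      rw [sq, mul_assoc, inv_mul_cancel₀ this, mul_one]

end Crude

section Head

/-- The part of `∏ p ∈ P, (1 + phi a b p n) - 1` coming from moduli up to `T`. -/
noncomputable def head (a b : ℕ → ℝ) (P : Finset ℕ) (T : ℝ) (n : ℤ) : ℝ :=
  ∑ D ∈ P.powerset with D.Nonempty ∧ ((∏ p ∈ D, p : ℕ) : ℝ) ≤ T, Phi a b D n

lemma prod_one_add_phi_eq (a b : ℕ → ℝ) (P : Finset ℕ) {T : ℝ} (hT : 1 ≤ T) (n : ℤ) :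
    ∏ p ∈ P, (1 + phi a b p n) = 1 + head a b P T n + tail a b P T n := by
  rw [prod_one_add, head, tail]
  have h1 : ∀ D : Finset ℕ, Phi a b D n = (if D = ∅ then 1 else 0) +
      (if D.Nonempty ∧ ((∏ p ∈ D, p : ℕ) : ℝ) ≤ T then Phi a b D n else 0) +
      (if T < (∏ p ∈ D, p : ℕ) then 1 else 0) * Phi a b D n := by
    intro D
    rcases D.eq_empty_or_nonempty with rfl | hD
    · simp [Phi, hT.not_gt]
    · by_cases h : ((∏ p ∈ D, p : ℕ) : ℝ) ≤ T
      · simp only [if_neg hD.ne_empty, if_pos (⟨hD, h⟩ : _ ∧ _), if_neg (not_lt.2 h)]; ring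
      · simp only [if_neg hD.ne_empty, if_neg (fun h' : _ ∧ _ => h h'.2), if_pos (not_le.1 h)]
        ring
  have h2 : ∑ D ∈ P.powerset, (if D = ∅ then (1 : ℝ) else 0) = 1 := by simp
  refine (sum_congr rfl fun D _ => h1 D).trans ?_
  rw [sum_add_distrib, sum_add_distrib, h2, sum_filter]

lemma avg_prod_one_add_phi (a b : ℕ → ℝ) {P : Finset ℕ} (hP : ∀ p ∈ P, p.Prime)
    (hP2 : ∀ p ∈ P, p ≠ 2) : avg (∏ p ∈ P, p) (fun n => ∏ p ∈ P, (1 + phi a b p n)) = 1 := by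
  have hco : (P : Set ℕ).Pairwise fun i j => Nat.Coprime i j := fun p hp q hq hpq =>
    (Nat.coprime_primes (hP p hp) (hP q hq)).2 hpq
  rw [avg_prod P (fun p => p) (fun p n => 1 + phi a b p n) (fun p hp => (hP p hp).pos) hco]
  · refine prod_eq_one fun p hp => ?_
    rw [avg_add, avg_const (hP p hp).pos, avg_phi (hP p hp) (hP2 p hp), add_zero]
  · intro p _ x
    simp only
    rw [phi_periodic a b p x]

variable {P : Finset ℕ} {x : ℝ} {H : ℕ}

lemma card_small_prod_le (hx : 10 ^ 6 ≤ x) {T : ℝ} (hPx : (3 / 2 : ℝ) ^ #P ≤ x ^ 10000)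
    (hK : ∀ D ⊆ P, ((∏ p ∈ D, p : ℕ) : ℝ) ≤ T → ((10 : ℝ) ^ 6) ^ #D ≤ x) :
    (#{D ∈ P.powerset | D.Nonempty ∧ ((∏ p ∈ D, p : ℕ) : ℝ) ≤ T} : ℝ) ≤ x ^ 2 := by
  have hx0 : 0 < x := by linarith
  have h1 : (1 + ((10 : ℝ) ^ 6)⁻¹) ^ #P ≤ x := by
    refine le_of_pow_le_pow_left₀ (n := 10000) (by norm_num) hx0.le ?_
    refine le_trans ?_ hPx
    rw [← pow_mul, mul_comm, pow_mul]
    refine pow_le_pow_left₀ (by positivity) ?_ _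
    have h2 : 1 + ((10 : ℝ) ^ 6)⁻¹ ≤ Real.exp ((10 : ℝ) ^ 6)⁻¹ := by
      have := Real.add_one_le_exp ((10 : ℝ) ^ 6)⁻¹; linarith
    refine (pow_le_pow_left₀ (by positivity) h2 _).trans ?_
    rw [← Real.exp_nat_mul]
    have h3 := Real.one_sub_le_exp_neg ((10000 : ℕ) * ((10 : ℝ) ^ 6)⁻¹)
    rw [Real.exp_neg] at h3
    have h4 : (2 / 3 : ℝ) ≤ (Real.exp ((10000 : ℕ) * ((10 : ℝ) ^ 6)⁻¹))⁻¹ :=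
      le_trans (by norm_num) h3
    have := inv_anti₀ (by norm_num) h4
    rw [inv_inv] at this
    exact this.trans (by norm_num)
  calc (#{D ∈ P.powerset | D.Nonempty ∧ ((∏ p ∈ D, p : ℕ) : ℝ) ≤ T} : ℝ)
      = ∑ D ∈ P.powerset with D.Nonempty ∧ ((∏ p ∈ D, p : ℕ) : ℝ) ≤ T, (1 : ℝ) := by simp
    _ ≤ ∑ D ∈ P.powerset with D.Nonempty ∧ ((∏ p ∈ D, p : ℕ) : ℝ) ≤ T,
          x * ((10 : ℝ) ^ 6)⁻¹ ^ #D := by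
        refine sum_le_sum fun D hD => ?_
        obtain ⟨hD1, -, hD2⟩ := mem_filter.1 hD
        rw [inv_pow, ← div_eq_mul_inv, one_le_div (by positivity)]
        exact hK D (mem_powerset.1 hD1) hD2
    _ ≤ ∑ D ∈ P.powerset, x * ((10 : ℝ) ^ 6)⁻¹ ^ #D :=
        sum_le_sum_of_subset_of_nonneg (filter_subset _ _) fun _ _ _ => by positivity
    _ = x * (1 + ((10 : ℝ) ^ 6)⁻¹) ^ #P := by
        rw [← mul_sum, add_comm, ← sum_pow_mul_eq_add_pow]
        simp
    _ ≤ x ^ 2 := by rw [sq]; gcongr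

variable {a b : ℕ → ℝ} (ha : ∀ p, |a p| ≤ 2) (hb : ∀ p, |b p| ≤ 2)
  (hP : ∀ p ∈ P, p.Prime)
include ha hb hP

lemma abs_head_le (hx : 10 ^ 6 ≤ x) {T : ℝ} (hPx : (3 / 2 : ℝ) ^ #P ≤ x ^ 10000)
    (hK : ∀ D ⊆ P, ((∏ p ∈ D, p : ℕ) : ℝ) ≤ T → ((10 : ℝ) ^ 6) ^ #D ≤ x) (n : ℤ) :
    |head a b P T n| ≤ x ^ 3 := by
  have hx0 : 0 < x := by linarith
  refine (abs_sum_le_sum_abs _ _).trans ?_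
  calc ∑ D ∈ P.powerset with D.Nonempty ∧ ((∏ p ∈ D, p : ℕ) : ℝ) ≤ T, |Phi a b D n|
      ≤ ∑ D ∈ P.powerset with D.Nonempty ∧ ((∏ p ∈ D, p : ℕ) : ℝ) ≤ T, x := by
        refine sum_le_sum fun D hD => ?_
        obtain ⟨hD1, -, hD2⟩ := mem_filter.1 hD
        have hDP := mem_powerset.1 hD1
        refine (abs_prod_le_pow D _ fun p hp =>
          abs_phi_le ha hb (hP p (hDP hp)).pos n).trans ?_
        refine le_trans ?_ (hK D hDP hD2)
        gcongr; norm_num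
    _ ≤ x ^ 2 * x := by
        rw [sum_const, nsmul_eq_mul]
        gcongr
        exact card_small_prod_le hx hPx hK
    _ = x ^ 3 := by ring

lemma avg_win_head_pow_four_le (hP2 : ∀ p ∈ P, p ≠ 2) (hx : 10 ^ 6 ≤ x) {T : ℝ}
    (hPx : (3 / 2 : ℝ) ^ #P ≤ x ^ 10000)
    (hK : ∀ D ⊆ P, ((∏ p ∈ D, p : ℕ) : ℝ) ≤ T → ((10 : ℝ) ^ 6) ^ #D ≤ x)
    (hH : (H : ℝ) = x ^ 10000) :
    avg (∏ p ∈ P, p) (fun y => win (head a b P T) H y ^ 4) ≤ x ^ 29910 := by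
  have hx0 : 0 < x := by linarith
  set 𝒟 := P.powerset.filter fun D => D.Nonempty ∧ ((∏ p ∈ D, p : ℕ) : ℝ) ≤ T with h𝒟
  have hcard : (#𝒟 : ℝ) ≤ x ^ 2 := card_small_prod_le hx hPx hK
  have h1 : ∀ y, win (head a b P T) H y ^ 4 ≤
      (#𝒟 : ℝ) ^ 3 * ∑ D ∈ 𝒟, win (Phi a b D) H y ^ 4 := by
    intro y
    have e1 : win (head a b P T) H y = ∑ D ∈ 𝒟, win (Phi a b D) H y := by
      simp only [win, head]
      rw [sum_comm]
    rw [e1]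
    have e2 := sq_sum_le_card_mul_sum_sq (s := 𝒟) (f := fun D => win (Phi a b D) H y)
    have e3 := sq_sum_le_card_mul_sum_sq (s := 𝒟) (f := fun D => win (Phi a b D) H y ^ 2)
    calc (∑ D ∈ 𝒟, win (Phi a b D) H y) ^ 4 = ((∑ D ∈ 𝒟, win (Phi a b D) H y) ^ 2) ^ 2 := by ring
      _ ≤ (#𝒟 * ∑ D ∈ 𝒟, win (Phi a b D) H y ^ 2) ^ 2 := by gcongr
      _ = (#𝒟 : ℝ) ^ 2 * (∑ D ∈ 𝒟, win (Phi a b D) H y ^ 2) ^ 2 := by ring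
      _ ≤ (#𝒟 : ℝ) ^ 2 * (#𝒟 * ∑ D ∈ 𝒟, (win (Phi a b D) H y ^ 2) ^ 2) := by gcongr
      _ = _ := by simp only [← pow_mul]; ring
  refine (avg_mono h1).trans ?_
  rw [avg_const_mul, avg_sum]
  have h2 : ∀ D ∈ 𝒟, avg (∏ p ∈ P, p) (fun y => win (Phi a b D) H y ^ 4) ≤ x ^ 29902 := by
    intro D hD
    obtain ⟨hD1, hne, hD2⟩ := mem_filter.1 hD
    have hDP := mem_powerset.1 hD1
    rw [avg_dvd (prod_dvd_prod_of_subset _ _ (fun p => p) hDP)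
      (prod_pos fun p hp => (hP p hp).pos)]
    · refine avg_win_pow_four_le_pow ha hb (fun p hp => hP p (hDP hp))
        (fun p hp => hP2 p (hDP hp)) hne hx (le_trans ?_ (hK D hDP hD2)) hH
      gcongr; norm_num
    · intro y
      simp only
      rw [win_periodic (Phi_periodic a b D) H y]
  calc (#𝒟 : ℝ) ^ 3 * ∑ D ∈ 𝒟, avg (∏ p ∈ P, p) (fun y => win (Phi a b D) H y ^ 4)
      ≤ (#𝒟 : ℝ) ^ 3 * (#𝒟 * x ^ 29902) := by
        gcongr
        refine (sum_le_sum h2).trans_eq ?_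
        rw [sum_const, nsmul_eq_mul]
    _ = (#𝒟 : ℝ) ^ 4 * x ^ 29902 := by ring
    _ ≤ (x ^ 2) ^ 4 * x ^ 29902 := by gcongr
    _ = x ^ 29910 := by rw [← pow_mul, ← pow_add]

end Head

section Tail

variable {a b : ℕ → ℝ} (ha : ∀ p, |a p| ≤ 2) (hb : ∀ p, |b p| ≤ 2) {P : Finset ℕ}
  (hP : ∀ p ∈ P, p.Prime) (hP6 : ∀ p ∈ P, 10 ^ 6 ≤ p) {H : ℕ} (hH : (4096 : ℝ) ≤ H)
  (hPH : (3 / 2 : ℝ) ^ #P ≤ H)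

lemma tail_periodic (a b : ℕ → ℝ) (P : Finset ℕ) (T : ℝ) :
    Function.Periodic (tail a b P T) ((∏ p ∈ P, p : ℕ) : ℤ) :=
  _root_.periodic_sum _ fun D hD x => by
    have h1 : Function.Periodic (Phi a b D) ((∏ p ∈ P, p : ℕ) : ℤ) :=
      periodic_of_dvd (prod_dvd_prod_of_subset _ _ _ (mem_powerset.1 hD)) (Phi_periodic a b D)
    simp only [h1 x]

include ha hb hP hP6 hH hPH

lemma avg_win_tail_sq_le :
    avg (∏ p ∈ P, p) (fun y => win (tail a b P ((H : ℝ) ^ 1600)) H y ^ 2) ≤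
      avg (∏ p ∈ P, p) (win (fun n => tail a b P ((H : ℝ) ^ 1600) n ^ 2) H) + 1 := by
  set u := tail a b P ((H : ℝ) ^ 1600) with hu
  set m := ∏ p ∈ P, p with hm
  have hH0 : (0 : ℝ) < H := by linarith
  have h1 : ∀ y, win u H y ^ 2 = ∑ i ∈ range H, ∑ j ∈ range H, u (y + i) * u (y + j) := by
    intro y; rw [sq, win, sum_mul_sum]
  have h2 : ∀ i ∈ range H, ∀ j ∈ range H, avg m (fun y => u (y + i) * u (y + j)) ≤
      (if i = j then avg m (fun y => u (y + i) ^ 2) else 0) + ((H : ℝ) ^ 100)⁻¹ := by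
    intro i hi j hj
    have hi' := mem_range.1 hi
    have hj' := mem_range.1 hj
    split_ifs with hij
    · subst hij
      simp only [← sq]
      linarith [show 0 ≤ ((H : ℝ) ^ 100)⁻¹ by positivity]
    · have h3 := abs_avg_prod_tail_le ha hb (ι := Fin 2) (by simp) ![(i : ℤ), (j : ℤ)] hP hP6 hH hPH
        (by
          intro k l
          rw [← Int.cast_abs]
          have : |![(i : ℤ), (j : ℤ)] l - ![(i : ℤ), (j : ℤ)] k| ≤ 2 * (H : ℤ) := by
            rw [abs_le]
            fin_cases k <;> fin_cases l <;> simp <;> omega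
          exact_mod_cast this)
        ⟨0, 1, by simp, by
          intro k hk; have : k = 1 := by omega
          subst this; simp; omega, by
          intro k hk; have : k = 0 := by omega
          subst this; simp; omega⟩
      simp only [Fin.prod_univ_two, Matrix.cons_val_zero, Matrix.cons_val_one] at h3
      rw [zero_add]
      exact (le_abs_self _).trans h3
  simp only [h1]
  rw [avg_sum]
  simp only [avg_sum]
  have h4 : avg m (win (fun n => u n ^ 2) H) = ∑ i ∈ range H, avg m (fun y => u (y + i) ^ 2) := by
    rw [← avg_sum]; rfl
  refine (sum_le_sum fun i hi => sum_le_sum fun j hj => h2 i hi j hj).trans ?_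
  simp only [sum_add_distrib, sum_ite_eq, sum_const, card_range, nsmul_eq_mul]
  rw [h4]
  refine add_le_add (sum_le_sum fun i hi => by rw [if_pos hi]) ?_
  rw [← mul_assoc, ← sq, mul_inv_le_iff₀ (by positivity), one_mul]
  exact pow_le_pow_right₀ (by linarith) (by norm_num)

lemma avg_win_tail_sq_mul_sq_le :
    avg (∏ p ∈ P, p) (fun y => win (tail a b P ((H : ℝ) ^ 1600)) H y ^ 2 *
        win (tail a b P ((H : ℝ) ^ 1600)) H (y + H) ^ 2) ≤
      avg (∏ p ∈ P, p) (fun y => win (fun n => tail a b P ((H : ℝ) ^ 1600) n ^ 2) H y *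
        win (fun n => tail a b P ((H : ℝ) ^ 1600) n ^ 2) H (y + H)) + 1 := by
  set u := tail a b P ((H : ℝ) ^ 1600) with hu
  set m := ∏ p ∈ P, p with hm
  have hH0 : (0 : ℝ) < H := by linarith
  have h1 : ∀ y, win u H y ^ 2 * win u H (y + H) ^ 2 =
      ∑ i ∈ range H, ∑ j ∈ range H, ∑ k ∈ range H, ∑ l ∈ range H,
        u (y + i) * u (y + j) * (u (y + H + k) * u (y + H + l)) := by
    intro y
    rw [sq, sq, win, sum_mul_sum, win, sum_mul_sum, sum_mul]
    refine sum_congr rfl fun i _ => ?_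
    rw [sum_mul]
    refine sum_congr rfl fun j _ => ?_
    rw [mul_sum]
    refine sum_congr rfl fun k _ => ?_
    rw [mul_sum]
  have h2 : ∀ i ∈ range H, ∀ j ∈ range H, ∀ k ∈ range H, ∀ l ∈ range H,
      avg m (fun y => u (y + i) * u (y + j) * (u (y + H + k) * u (y + H + l))) ≤
      (if i = j then (if k = l then avg m (fun y => u (y + i) ^ 2 * u (y + H + k) ^ 2) else 0)
        else 0) + ((H : ℝ) ^ 100)⁻¹ := by
    intro i hi j hj k hk l hl
    have hi' := mem_range.1 hi
    have hj' := mem_range.1 hj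
    have hk' := mem_range.1 hk
    have hl' := mem_range.1 hl
    by_cases hijkl : i = j ∧ k = l
    · obtain ⟨rfl, rfl⟩ := hijkl
      simp only [← sq, if_true]
      linarith [show 0 ≤ ((H : ℝ) ^ 100)⁻¹ by positivity]
    · have h0 : (if i = j then (if k = l then avg m (fun y => u (y + i) ^ 2 * u (y + H + k) ^ 2)
          else 0) else 0) = 0 := by
        split_ifs with e1 e2
        · exact absurd ⟨e1, e2⟩ hijkl
        · rfl
        · rfl
      have h3 := abs_avg_prod_tail_le ha hb (ι := Fin 4) (by simp)
        ![(i : ℤ), (j : ℤ), (H + k : ℤ), (H + l : ℤ)] hP hP6 hH hPH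
        (by
          intro s t
          rw [← Int.cast_abs]
          have : |![(i : ℤ), (j : ℤ), (H + k : ℤ), (H + l : ℤ)] t -
              ![(i : ℤ), (j : ℤ), (H + k : ℤ), (H + l : ℤ)] s| ≤ 2 * (H : ℤ) := by
            rw [abs_le]
            fin_cases s <;> fin_cases t <;> simp <;> omega
          exact_mod_cast this)
        (by
          rcases not_and_or.1 hijkl with hij | hkl
          · refine ⟨0, 1, by simp, ?_, ?_⟩ <;>
            · intro s hs
              fin_cases s <;> simp at hs ⊢ <;> omega
          · refine ⟨2, 3, by decide, ?_, ?_⟩ <;>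
            · intro s hs
              fin_cases s <;> simp at hs ⊢ <;> omega)
      rw [h0, zero_add]
      refine (le_abs_self _).trans (le_trans (le_of_eq ?_) h3)
      congr 2
      funext y
      simp [hu, Fin.prod_univ_four, add_assoc, mul_assoc]
  simp only [h1, avg_sum]
  have h4 : avg m (fun y => win (fun n => u n ^ 2) H y * win (fun n => u n ^ 2) H (y + H)) =
      ∑ i ∈ range H, ∑ k ∈ range H, avg m (fun y => u (y + i) ^ 2 * u (y + H + k) ^ 2) := by
    simp only [← avg_sum, win, sum_mul_sum]
  refine (sum_le_sum fun i hi => sum_le_sum fun j hj => sum_le_sum fun k hk => sum_le_sum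
    fun l hl => h2 i hi j hj k hk l hl).trans ?_
  simp only [sum_add_distrib, sum_const, card_range, nsmul_eq_mul]
  rw [h4]
  refine add_le_add (sum_le_sum fun i hi => ?_) ?_
  · rw [sum_eq_single_of_mem i hi fun j _ hj => by simp [hj.symm]]
    refine sum_le_sum fun k hk => ?_
    simp [mem_range.1 hk]
  · rw [← mul_assoc, ← mul_assoc, ← mul_assoc, mul_inv_le_iff₀ (by positivity), one_mul]
    calc (H : ℝ) * H * H * H = (H : ℝ) ^ 4 := by ring
      _ ≤ _ := pow_le_pow_right₀ (by linarith) (by norm_num)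

end Tail

section Sieve

lemma one_le_of_add_eq_neg {H L₁ L₂ U₁ U₂ : ℝ} (hH : 0 < H) (h1 : H + L₁ + U₁ = 0)
    (h2 : H + L₂ + U₂ = 0) :
    1 ≤ 16 / H ^ 4 * (L₁ ^ 4 + L₂ ^ 4 + U₁ ^ 2 * U₂ ^ 2) := by
  have hsq : ∀ z : ℝ, H / 2 ≤ |z| → H ^ 2 / 4 ≤ z ^ 2 := by
    intro z hz
    rw [← sq_abs z]
    have := pow_le_pow_left₀ (by positivity) hz 2
    linarith [show (H / 2) ^ 2 = H ^ 2 / 4 by ring]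
  have h4 : ∀ z : ℝ, z ^ 4 = z ^ 2 * z ^ 2 := fun z => by ring
  have hdi : ∀ L U : ℝ, H + L + U = 0 → H / 2 ≤ |L| ∨ H / 2 ≤ |U| := by
    intro L U h
    by_contra hcon
    push Not at hcon
    have e1 := neg_abs_le L
    have e2 := neg_abs_le U
    linarith [hcon.1, hcon.2]
  rw [div_mul_eq_mul_div, one_le_div (by positivity)]
  have p1 : 0 ≤ L₁ ^ 4 := by positivity
  have p2 : 0 ≤ L₂ ^ 4 := by positivity
  have p3 : 0 ≤ U₁ ^ 2 * U₂ ^ 2 := by positivity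
  have e : H ^ 4 = 16 * (H ^ 2 / 4 * (H ^ 2 / 4)) := by ring
  have hp : 0 ≤ H ^ 2 / 4 := by positivity
  rcases hdi _ _ h1 with h | h
  · have := mul_le_mul (hsq _ h) (hsq _ h) hp (by positivity)
    rw [← h4] at this; linarith
  rcases hdi _ _ h2 with h' | h'
  · have := mul_le_mul (hsq _ h') (hsq _ h') hp (by positivity)
    rw [← h4] at this; linarith
  · have := mul_le_mul (hsq _ h) (hsq _ h') hp (by positivity)
    linarith

/-- For most `y`, the interval `[y, y + 2 * H)` meets the support of `∏ p ∈ P, (1 + phi a b p)`. -/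
theorem avg_empty_le {a b : ℕ → ℝ} (ha : ∀ p, |a p| ≤ 2) (hb : ∀ p, |b p| ≤ 2) {P : Finset ℕ}
    (hP : ∀ p ∈ P, p.Prime) (hP6 : ∀ p ∈ P, 10 ^ 6 ≤ p) {x δ : ℝ} (hx : 10 ^ 6 ≤ x) {H : ℕ}
    (hH : (H : ℝ) = x ^ 10000) (hPH : (3 / 2 : ℝ) ^ #P ≤ H)
    (hK : ∀ D ⊆ P, ((∏ p ∈ D, p : ℕ) : ℝ) ≤ (H : ℝ) ^ 1600 → ((10 : ℝ) ^ 6) ^ #D ≤ x)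
    (hδ : 0 < δ) (hδH : 1 ≤ δ * H)
    (hf2 : ∀ n, (∏ p ∈ P, (1 + phi a b p n)) ^ 2 ≤ (∏ p ∈ P, (1 + phi a b p n)) / δ) :
    avg (∏ p ∈ P, p) (fun y => if ∀ h : ℕ, h < 2 * H → ∏ p ∈ P, (1 + phi a b p (y + h)) = 0
      then 1 else 0) ≤ 2000 / (δ * H) ^ 2 + (x ^ 10080)⁻¹ := by
  have hP2 : ∀ p ∈ P, p ≠ 2 := fun p hp h => by have := hP6 p hp; omega
  have hx0 : 0 < x := by linarith
  have hx1 : 1 ≤ x := by linarith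
  have hH6 : (10 : ℝ) ^ 6 ≤ H := by rw [hH]; exact hx.trans (le_self_pow₀ hx1 (by norm_num))
  have hH0 : (0 : ℝ) < H := by linarith
  have hH1 : (1 : ℝ) ≤ H := by linarith
  have hHx : ∀ k, k ≤ 10000 → x ^ k ≤ H := fun k hk => by
    rw [hH]; exact pow_le_pow_right₀ hx1 hk
  set m := ∏ p ∈ P, p with hm
  have hm0 : 0 < m := prod_pos fun p hp => (hP p hp).pos
  set T := (H : ℝ) ^ 1600 with hT
  have hT1 : 1 ≤ T := one_le_pow₀ hH1
  set f : ℤ → ℝ := fun n => ∏ p ∈ P, (1 + phi a b p n) with hf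
  set l := head a b P T with hl
  set u := tail a b P T with hu
  have hflu : ∀ n, f n = 1 + l n + u n := fun n => prod_one_add_phi_eq a b P hT1 n
  have hPx : (3 / 2 : ℝ) ^ #P ≤ x ^ 10000 := hH ▸ hPH
  have hlx : ∀ n, |l n| ≤ x ^ 3 := abs_head_le ha hb hP hx hPx hK
  have hu2 : ∀ n, u n ^ 2 ≤ 2 / δ * f n + 8 * x ^ 6 := by
    intro n
    have h1 : u n = f n - (1 + l n) := by rw [hflu]; ring
    have h2 : (1 + l n) ^ 2 ≤ (2 * x ^ 3) ^ 2 := by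
      refine sq_le_sq.2 ?_
      rw [abs_of_pos (show 0 < 2 * x ^ 3 by positivity)]
      refine (abs_add_le _ _).trans ?_
      rw [abs_one]
      linarith [hlx n, show 1 ≤ x ^ 3 from one_le_pow₀ hx1]
    have h3 : f n ^ 2 ≤ f n / δ := hf2 n
    rw [h1]
    calc (f n - (1 + l n)) ^ 2 ≤ 2 * f n ^ 2 + 2 * (1 + l n) ^ 2 := by
          nlinarith [sq_nonneg (f n + (1 + l n))]
      _ ≤ 2 * (f n / δ) + 2 * (2 * x ^ 3) ^ 2 := by gcongr
      _ = 2 / δ * f n + 8 * x ^ 6 := by ring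
  set N := win f H with hN
  set L := win l H with hL
  set U := win u H with hU
  set V := win (fun n => u n ^ 2) H with hV
  have hNLU : ∀ y, N y = H + L y + U y := by
    intro y
    simp only [hN, hL, hU, win, hflu, sum_add_distrib]
    simp
  have hV0 : ∀ y, 0 ≤ V y := fun y => sum_nonneg fun _ _ => sq_nonneg _
  have hVN : ∀ y, V y ≤ 2 / δ * N y + 8 * x ^ 6 * H := by
    intro y
    refine (sum_le_sum (s := range H) fun i _ => hu2 (y + i)).trans_eq ?_
    rw [sum_add_distrib, ← mul_sum, sum_const, card_range, nsmul_eq_mul]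
    simp only [hN, win]; ring
  have hEf : avg m f = 1 := avg_prod_one_add_phi a b hP hP2
  have hfper : Function.Periodic f (m : ℤ) := by
    refine _root_.periodic_prod P fun p hp y => ?_
    have := periodic_of_dvd (dvd_prod_of_mem (fun p => p) hp) (phi_periodic a b p) y
    rw [this]
  have hEN : avg m N = H := by
    have : avg m N = ∑ h ∈ range H, avg m (fun y => f (y + h)) := by rw [← avg_sum]; rfl
    have e : ∀ h ∈ range H, avg m (fun y => f (y + h)) = 1 := fun h _ =>
      (avg_shift hfper (h : ℤ)).trans hEf
    rw [this, sum_congr rfl e]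
    simp
  have hδi : 1 / δ ≤ H := by
    rw [div_le_iff₀ hδ, mul_comm]; exact hδH
  have hEL4 : avg m (fun y => L y ^ 4) ≤ x ^ 29910 := avg_win_head_pow_four_le ha hb hP hP2 hx hPx hK hH
  have hH3 : (H : ℝ) ^ 3 = x ^ 30000 := by rw [hH, ← pow_mul]
  have hEU2 : avg m (fun y => U y ^ 2) ≤ 3 * (H : ℝ) ^ 2 := by
    have h1 := avg_win_tail_sq_le ha hb hP hP6 (by linarith) hPH
    refine h1.trans ?_
    have h2 : avg m V ≤ 2 / δ * H + 8 * x ^ 6 * H := by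
      refine (avg_mono hVN).trans_eq ?_
      rw [avg_add, avg_const_mul, hEN, avg_const hm0]
    have h3 : 2 / δ * H ≤ 2 * (H : ℝ) ^ 2 := by
      calc 2 / δ * H = 2 * (1 / δ) * H := by ring
        _ ≤ 2 * H * H := by gcongr
        _ = _ := by ring
    have h4 : 8 * x ^ 6 + 1 ≤ H := by
      calc 8 * x ^ 6 + 1 ≤ 8 * x ^ 6 + x ^ 6 := by gcongr; exact one_le_pow₀ hx1
        _ = 9 * x ^ 6 := by ring
        _ ≤ x * x ^ 6 := by gcongr; linarith
        _ = x ^ 7 := by ring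
        _ ≤ H := hHx 7 (by norm_num)
    have h5 : 8 * x ^ 6 * H + 1 ≤ (H : ℝ) ^ 2 := by
      calc 8 * x ^ 6 * H + 1 ≤ 8 * x ^ 6 * H + 1 * H := by linarith
        _ = (8 * x ^ 6 + 1) * H := by ring
        _ ≤ H * H := by gcongr
        _ = _ := by ring
    change avg m V + 1 ≤ _
    linarith
  have hEN2 : avg m (fun y => N y ^ 2) ≤ 15 * (H : ℝ) ^ 2 := by
    have h1 : ∀ y, N y ^ 2 ≤ 5 * (H : ℝ) ^ 2 + (2 / (H : ℝ) ^ 2 * L y ^ 4 + 3 * U y ^ 2) := by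
      intro y
      have e1 : 2 * L y ^ 2 ≤ (H : ℝ) ^ 2 / 2 + 2 / (H : ℝ) ^ 2 * L y ^ 4 := by
        have : 0 ≤ ((H : ℝ) - 2 / H * L y ^ 2) ^ 2 := sq_nonneg _
        have e : ((H : ℝ) - 2 / H * L y ^ 2) ^ 2 =
            (H : ℝ) ^ 2 - 4 * L y ^ 2 + 4 / (H : ℝ) ^ 2 * L y ^ 4 := by
          field_simp; ring
        rw [e] at this
        have e' : 4 / (H : ℝ) ^ 2 * L y ^ 4 = 2 * (2 / (H : ℝ) ^ 2 * L y ^ 4) := by ring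
        linarith
      have e3 : 0 ≤ 2 / (H : ℝ) ^ 2 * L y ^ 4 := by positivity
      have e4 : 3 * L y ^ 2 ≤ 2 * (H : ℝ) ^ 2 + 2 / (H : ℝ) ^ 2 * L y ^ 4 := by
        have : 0 ≤ ((H : ℝ) - 1 / H * L y ^ 2) ^ 2 := sq_nonneg _
        have e : ((H : ℝ) - 1 / H * L y ^ 2) ^ 2 =
            (H : ℝ) ^ 2 - 2 * L y ^ 2 + 1 / 2 * (2 / (H : ℝ) ^ 2 * L y ^ 4) := by
          field_simp; ring
        rw [e] at this
        linarith [sq_nonneg (H : ℝ)]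
      have e5 : ∀ r s t : ℝ, (r + s + t) ^ 2 ≤ 3 * r ^ 2 + 3 * s ^ 2 + 3 * t ^ 2 := fun r s t => by
        linarith [sq_nonneg (r - s), sq_nonneg (r - t), sq_nonneg (s - t),
          show 3 * r ^ 2 + 3 * s ^ 2 + 3 * t ^ 2 - (r + s + t) ^ 2 =
            (r - s) ^ 2 + (r - t) ^ 2 + (s - t) ^ 2 by ring]
      have e6 := e5 H (L y) (U y)
      rw [hNLU]
      linarith
    refine (avg_mono h1).trans ?_
    rw [avg_add, avg_add, avg_const hm0, avg_const_mul, avg_const_mul]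
    have h2 : 2 / (H : ℝ) ^ 2 * avg m (fun y => L y ^ 4) ≤ (H : ℝ) ^ 2 := by
      have e1 : avg m (fun y => L y ^ 4) ≤ (H : ℝ) ^ 3 :=
        hEL4.trans (by rw [hH3]; exact pow_le_pow_right₀ hx1 (by norm_num))
      rw [div_mul_eq_mul_div, div_le_iff₀ (by positivity)]
      calc 2 * avg m (fun y => L y ^ 4) ≤ H * (H : ℝ) ^ 3 :=
            mul_le_mul (by linarith) e1 (avg_nonneg fun y => by positivity) hH0.le
        _ = _ := by ring
    linarith
  have hEV2 : avg m (fun y => V y ^ 2) ≤ 120 * (H : ℝ) ^ 2 / δ ^ 2 + 128 * x ^ 12 * (H : ℝ) ^ 2 := by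
    have h1 : ∀ y, V y ^ 2 ≤ 8 / δ ^ 2 * N y ^ 2 + 128 * x ^ 12 * (H : ℝ) ^ 2 := by
      intro y
      have e1 := pow_le_pow_left₀ (hV0 y) (hVN y) 2
      refine e1.trans ?_
      have e2 : 0 ≤ (2 / δ * N y - 8 * x ^ 6 * H) ^ 2 := sq_nonneg _
      have e3 : 8 / δ ^ 2 * N y ^ 2 + 128 * x ^ 12 * (H : ℝ) ^ 2 =
          2 * (2 / δ * N y) ^ 2 + 2 * (8 * x ^ 6 * H) ^ 2 := by ring
      rw [e3]
      nlinarith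
    refine (avg_mono h1).trans ?_
    rw [avg_add, avg_const_mul, avg_const hm0]
    calc 8 / δ ^ 2 * avg m (fun y => N y ^ 2) + 128 * x ^ 12 * (H : ℝ) ^ 2
        ≤ 8 / δ ^ 2 * (15 * (H : ℝ) ^ 2) + 128 * x ^ 12 * (H : ℝ) ^ 2 := by gcongr
      _ = _ := by ring
  have huper : Function.Periodic u (m : ℤ) := tail_periodic a b P T
  have hVper : Function.Periodic V (m : ℤ) :=
    win_periodic (fun y => by simp only [huper y]) H
  have hLper : Function.Periodic L (m : ℤ) := by
    have : Function.Periodic l (m : ℤ) := by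
      intro y
      have e1 := hflu (y + m)
      rw [hfper y, huper y, hflu] at e1
      linarith
    exact win_periodic this H
  have hV2per : Function.Periodic (fun y => V y ^ 2) (m : ℤ) := fun y => by simp only [hVper y]
  have hL4per : Function.Periodic (fun y => L y ^ 4) (m : ℤ) := fun y => by simp only [hLper y]
  have hEUU : avg m (fun y => U y ^ 2 * U (y + H) ^ 2) ≤
      120 * (H : ℝ) ^ 2 / δ ^ 2 + 128 * x ^ 12 * (H : ℝ) ^ 2 + 1 := by
    refine (avg_win_tail_sq_mul_sq_le ha hb hP hP6 (by linarith) hPH).trans ?_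
    refine add_le_add_left ?_ 1
    have h1 : ∀ y, V y * V (y + H) ≤ 1 / 2 * V y ^ 2 + 1 / 2 * V (y + H) ^ 2 := fun y => by
      nlinarith [sq_nonneg (V y - V (y + H))]
    refine (avg_mono h1).trans ?_
    rw [avg_add, avg_const_mul, avg_const_mul (F := fun y => V (y + H) ^ 2),
      avg_shift hV2per (H : ℤ)]
    linarith
  have hpt : ∀ y : ℤ, (if ∀ h : ℕ, h < 2 * H → f (y + h) = 0 then (1 : ℝ) else 0) ≤
      16 / (H : ℝ) ^ 4 * (L y ^ 4 + L (y + H) ^ 4 + U y ^ 2 * U (y + H) ^ 2) := by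
    intro y
    split_ifs with hy
    · have h1 : N y = 0 := sum_eq_zero fun h hh => hy h (by have := mem_range.1 hh; omega)
      have h2 : N (y + H) = 0 := sum_eq_zero fun h hh => by
        have := hy (H + h) (by have := mem_range.1 hh; omega)
        rwa [Nat.cast_add, ← add_assoc] at this
      exact one_le_of_add_eq_neg hH0 (by rw [← hNLU, h1]) (by rw [← hNLU, h2])
    · positivity
  refine (avg_mono hpt).trans ?_
  rw [avg_const_mul, avg_add, avg_add,
    avg_shift hL4per (H : ℤ)]
  have hH4 : (H : ℝ) ^ 4 = x ^ 40000 := by rw [hH, ← pow_mul]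
  have hfin : 2 * x ^ 29910 + 128 * x ^ 12 * (H : ℝ) ^ 2 + 1 ≤ x ^ 29911 := by
    have e1 : (H : ℝ) ^ 2 = x ^ 20000 := by rw [hH, ← pow_mul]
    have e2 : x ^ 12 * x ^ 20000 ≤ x ^ 29910 := by
      rw [← pow_add]; exact pow_le_pow_right₀ hx1 (by norm_num)
    have e3 : 1 ≤ x ^ 29910 := one_le_pow₀ hx1
    rw [e1, mul_assoc]
    calc 2 * x ^ 29910 + 128 * (x ^ 12 * x ^ 20000) + 1
        ≤ 2 * x ^ 29910 + 128 * x ^ 29910 + x ^ 29910 := by gcongr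
      _ = 131 * x ^ 29910 := by ring
      _ ≤ x * x ^ 29910 := by gcongr; linarith
      _ = x ^ 29911 := by rw [← pow_succ']
  have hfin2 : 16 / (H : ℝ) ^ 4 * x ^ 29911 ≤ (x ^ 10080)⁻¹ := by
    rw [hH4, div_mul_eq_mul_div, div_le_iff₀ (by positivity), inv_mul_eq_div,
      pow_div_pow_eq (k := 29920) hx0.ne' (by norm_num)]
    calc 16 * x ^ 29911 ≤ x * x ^ 29911 := by gcongr; linarith
      _ = x ^ 29912 := by rw [← pow_succ']
      _ ≤ _ := pow_le_pow_right₀ hx1 (by norm_num)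
  calc 16 / (H : ℝ) ^ 4 * (avg m (fun y => L y ^ 4) + avg m (fun y => L y ^ 4) +
        avg m (fun y => U y ^ 2 * U (y + H) ^ 2))
      ≤ 16 / (H : ℝ) ^ 4 * (x ^ 29910 + x ^ 29910 +
        (120 * (H : ℝ) ^ 2 / δ ^ 2 + 128 * x ^ 12 * (H : ℝ) ^ 2 + 1)) := by gcongr
    _ = 16 / (H : ℝ) ^ 4 * (120 * (H : ℝ) ^ 2 / δ ^ 2) +
        16 / (H : ℝ) ^ 4 * (2 * x ^ 29910 + 128 * x ^ 12 * (H : ℝ) ^ 2 + 1) := by ring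
    _ ≤ 2000 / (δ * H) ^ 2 + (x ^ 10080)⁻¹ := by
        refine add_le_add ?_ (le_trans (by gcongr) hfin2)
        rw [le_div_iff₀ (by positivity)]
        have : 16 / (H : ℝ) ^ 4 * (120 * (H : ℝ) ^ 2 / δ ^ 2) * (δ * H) ^ 2 = 1920 := by
          field_simp; norm_num
        rw [this]; norm_num

end Sieve

section Density

/-- The sign that distinguishes the primes whose square divides `M`. -/
noncomputable def sqSign (M p : ℕ) : ℝ := if p ^ 2 ∣ M then -1 else 1

/-- The density of the local condition at `p`. -/
noncomputable def localDens (M p : ℕ) : ℝ := (1 + sqSign M p / p) / 2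

/-- The coefficient of the quadratic character in the normalised local indicator. -/
noncomputable def chiCoeff (M Q p : ℕ) : ℝ := chi p Q / (1 + sqSign M p / p)

/-- The coefficient of `kap` in the normalised local indicator. -/
noncomputable def kapCoeff (M p : ℕ) : ℝ := sqSign M p / (1 + sqSign M p / p)

lemma sqSign_eq (M p : ℕ) : sqSign M p = -1 ∨ sqSign M p = 1 := by
  unfold sqSign; split_ifs <;> simp

lemma abs_sqSign (M p : ℕ) : |sqSign M p| = 1 := by
  rcases sqSign_eq M p with h | h <;> simp [h]

lemma one_add_ge {M p : ℕ} {B : ℝ} (hB : 0 < B) (hp : B ≤ p) : 1 - 1 / B ≤ 1 + sqSign M p / p := by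
  have h1 : |sqSign M p / p| ≤ 1 / B := by
    rw [abs_div, abs_sqSign, Nat.abs_cast]; gcongr
  linarith [abs_le.1 h1]

lemma one_add_le {M p : ℕ} {B : ℝ} (hB : 0 < B) (hp : B ≤ p) : 1 + sqSign M p / p ≤ 1 + 1 / B := by
  have h1 : |sqSign M p / p| ≤ 1 / B := by
    rw [abs_div, abs_sqSign, Nat.abs_cast]; gcongr
  linarith [abs_le.1 h1]

lemma inv_abs_one_add_le (M p : ℕ) : |1 + sqSign M p / p|⁻¹ ≤ 2 := by
  rcases Nat.lt_or_ge p 2 with h | h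
  · interval_cases p
    · simp
    · simp [sqSign]
  · have := one_add_ge (M := M) (p := p) two_pos (by exact_mod_cast h)
    rw [abs_of_pos (by linarith)]
    rw [inv_le_comm₀ (by linarith) two_pos]
    linarith

lemma abs_chiCoeff_le (M Q p : ℕ) : |chiCoeff M Q p| ≤ 2 := by
  rw [chiCoeff, div_eq_mul_inv, abs_mul, abs_inv]
  calc _ ≤ 1 * 2 := mul_le_mul (abs_chi_le p Q) (inv_abs_one_add_le M p) (by positivity) zero_le_one
    _ = 2 := one_mul 2

lemma abs_kapCoeff_le (M p : ℕ) : |kapCoeff M p| ≤ 2 := by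
  rw [kapCoeff, div_eq_mul_inv, abs_mul, abs_inv, abs_sqSign, one_mul]
  exact inv_abs_one_add_le M p

lemma localDens_ge {M p : ℕ} (hp : 2 ≤ p) : 1 / 4 ≤ localDens M p := by
  have := one_add_ge (M := M) (p := p) two_pos (by exact_mod_cast hp)
  rw [localDens]; linarith

lemma localDens_le {M p : ℕ} (hp : 3 ≤ p) : localDens M p ≤ 2 / 3 := by
  have := one_add_le (M := M) (p := p) three_pos (by exact_mod_cast hp)
  rw [localDens]; linarith

lemma one_add_phi {M Q p : ℕ} (hp : 2 ≤ p) (n : ℤ) :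
    1 + phi (chiCoeff M Q) (kapCoeff M) p n =
      (1 + chi p (Q * n) + sqSign M p * (if (p : ℤ) ∣ n then 1 else 0)) / (2 * localDens M p) := by
  have h0 := localDens_ge (M := M) hp
  have h1 : 2 * localDens M p = 1 + sqSign M p / p := by rw [localDens]; ring
  have h2 : 1 + sqSign M p / p ≠ 0 := by rw [← h1]; linarith
  rw [phi, kap, chiCoeff, kapCoeff, h1, chi_mul, eq_div_iff h2]
  obtain ⟨c, hc⟩ : ∃ c, c = 1 + sqSign M p / p := ⟨_, rfl⟩
  have h3 : sqSign M p * (1 / p) = c - 1 := by rw [hc]; ring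
  rw [← hc] at h2 ⊢
  field_simp at h3 ⊢
  linear_combination -h3

lemma chi_eq_zero {p : ℕ} (hp : p.Prime) {n : ℤ} (h : (p : ℤ) ∣ n) : chi p n = 0 := by
  have := Fact.mk hp
  rw [chi, ← jacobiSym.legendreSym.to_jacobiSym, (legendreSym.eq_zero_iff p n).2
    ((ZMod.intCast_zmod_eq_zero_iff_dvd n p).2 h)]
  simp

lemma chi_eq_or {p : ℕ} (hp : p.Prime) {n : ℤ} (h : ¬(p : ℤ) ∣ n) : chi p n = 1 ∨ chi p n = -1 := by
  have := Fact.mk hp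
  rw [chi, ← jacobiSym.legendreSym.to_jacobiSym]
  rcases legendreSym.eq_one_or_neg_one p (a := n)
    (fun h' => h ((ZMod.intCast_zmod_eq_zero_iff_dvd n p).1 h')) with h | h <;> simp [h]

lemma one_add_phi_cases {M Q p : ℕ} (hp : p.Prime) (hQ : ¬p ∣ Q) (n : ℤ) :
    1 + phi (chiCoeff M Q) (kapCoeff M) p n = 0 ∨
      1 + phi (chiCoeff M Q) (kapCoeff M) p n = (localDens M p)⁻¹ ∧
        (chi p (Q * n) = 1 ∨ ((p : ℤ) ∣ Q * n ∧ ¬p ^ 2 ∣ M)) := by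
  have hd := localDens_ge (M := M) hp.two_le
  have hpZ : Prime (p : ℤ) := Nat.prime_iff_prime_int.1 hp
  rw [one_add_phi hp.two_le]
  have e : ∀ u : ℝ, u = 2 → u / (2 * localDens M p) = (localDens M p)⁻¹ := by
    rintro u rfl; field_simp
  by_cases hn : (p : ℤ) ∣ n
  · have h1 : (p : ℤ) ∣ Q * n := hn.mul_left _
    rw [chi_eq_zero hp h1, if_pos hn]
    by_cases hM : p ^ 2 ∣ M
    · left; simp [sqSign, hM]
    · right; exact ⟨e _ (by simp [sqSign, hM]; norm_num), Or.inr ⟨h1, hM⟩⟩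
  · have h1 : ¬(p : ℤ) ∣ Q * n := fun h => (hpZ.dvd_or_dvd h).elim
      (fun h => hQ (by exact_mod_cast h)) hn
    rw [if_neg hn]
    rcases chi_eq_or hp h1 with h | h
    · right; rw [h]; exact ⟨e _ (by norm_num), Or.inl rfl⟩
    · left; rw [h]; simp

variable {M Q : ℕ} {P : Finset ℕ} (hP : ∀ p ∈ P, p.Prime) (hQ : ∀ p ∈ P, ¬p ∣ Q)
include hP hQ

lemma sq_prod_one_add_phi_le (n : ℤ) :
    (∏ p ∈ P, (1 + phi (chiCoeff M Q) (kapCoeff M) p n)) ^ 2 ≤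
      (∏ p ∈ P, (1 + phi (chiCoeff M Q) (kapCoeff M) p n)) / ∏ p ∈ P, localDens M p := by
  rw [← prod_pow, ← prod_div_distrib]
  refine le_of_eq (prod_congr rfl fun p hp => ?_)
  rcases one_add_phi_cases (M := M) (hP p hp) (hQ p hp) n with h | ⟨h, -⟩ <;> rw [h]
  · simp
  · rw [sq, div_eq_mul_inv]

lemma of_prod_one_add_phi_ne_zero {n : ℤ}
    (h : ∏ p ∈ P, (1 + phi (chiCoeff M Q) (kapCoeff M) p n) ≠ 0) {p : ℕ} (hp : p ∈ P) :
    chi p (Q * n) = 1 ∨ ((p : ℤ) ∣ Q * n ∧ ¬p ^ 2 ∣ M) :=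
  ((one_add_phi_cases (M := M) (hP p hp) (hQ p hp) n).resolve_left (prod_ne_zero_iff.1 h p hp)).2

end Density

lemma isSqMod_of_local {M B : ℕ} (hM : 0 < M) {n : ℤ} (hn : ((8 * B.factorial : ℕ) : ℤ) ∣ n - 1)
    (h : ∀ p : ℕ, p.Prime → B < p → p ∣ M → chi p n = 1 ∨ ((p : ℤ) ∣ n ∧ ¬p ^ 2 ∣ M)) :
    IsSqMod M n := by
  refine isSqMod_of_prime_pow hM fun p k hp hpk => ?_
  rcases Nat.eq_zero_or_pos k with rfl | hk
  · exact ⟨0, by simp⟩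
  obtain ⟨k, rfl⟩ : ∃ j, k = j + 1 := ⟨k - 1, by omega⟩
  by_cases hp2 : p = 2
  · subst hp2
    have h8 : (8 : ℤ) ∣ n - 1 := (by exact_mod_cast Dvd.intro _ rfl : (8 : ℤ) ∣ ((8 * B.factorial : ℕ) : ℤ)).trans hn
    obtain ⟨z, hz, -⟩ := exists_sq_modEq_two_pow h8 (k + 1)
    refine isSqMod_of_dvd (pow_dvd_pow 2 (by omega : k + 1 ≤ k + 1 + 3)) ⟨z, by exact_mod_cast hz⟩
  have hpM : p ∣ M := (dvd_pow_self p k.succ_ne_zero).trans hpk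
  have lift : ∀ y : ℤ, ¬(p : ℤ) ∣ y → (p : ℤ) ∣ y ^ 2 - n → IsSqMod (p ^ (k + 1)) n := fun y hy hyn =>
    let ⟨z, hz, _⟩ := exists_sq_modEq_odd_prime_pow hp hp2 hy hyn k
    ⟨z, by exact_mod_cast hz⟩
  rcases le_or_gt p B with hpB | hpB
  · refine lift 1 (fun h' => hp.one_lt.ne' (by exact_mod_cast Int.eq_one_of_dvd_one (by positivity) h')) ?_
    have : (p : ℤ) ∣ n - 1 := (Int.natCast_dvd_natCast.2
      (((hp.dvd_factorial).2 hpB).mul_left 8)).trans hn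
    rw [one_pow, ← neg_sub]; exact this.neg_right
  rcases h p hp hpB hpM with h1 | ⟨h1, h2⟩
  · have := Fact.mk hp
    have hn0 : ¬(p : ℤ) ∣ n := fun h' => by rw [chi_eq_zero hp h'] at h1; norm_num at h1
    rw [chi, ← jacobiSym.legendreSym.to_jacobiSym] at h1
    have h3 : legendreSym p n = 1 := by exact_mod_cast h1
    rw [legendreSym.eq_one_iff p (fun h' => hn0 ((ZMod.intCast_zmod_eq_zero_iff_dvd n p).1 h'))] at h3
    obtain ⟨r, hr⟩ := h3
    have h4 : (p : ℤ) ∣ (r.val : ℤ) ^ 2 - n := by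
      rw [← ZMod.intCast_zmod_eq_zero_iff_dvd]
      push_cast
      rw [ZMod.natCast_zmod_val, hr]; ring
    refine lift r.val (fun h' => hn0 ?_) h4
    have := (h'.pow (n := 2) (by norm_num)).sub h4
    simpa using this
  · rcases Nat.eq_zero_or_pos k with rfl | hk'
    · exact ⟨0, by simpa using h1⟩
    · exact absurd ((pow_dvd_pow p (by omega)).trans hpk) h2

lemma sum_range_mul_div (Q N : ℕ) (g : ℕ → ℝ) :
    ∑ x ∈ range (Q * N), g (x / Q) = Q * ∑ y ∈ range N, g y := by
  rcases Nat.eq_zero_or_pos Q with rfl | hQ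
  · simp
  induction N with
  | zero => simp
  | succ N ih =>
    rw [Nat.mul_succ, sum_range_add, ih, sum_range_succ, mul_add]
    congr 1
    rw [sum_congr rfl fun x hx => by
      rw [Nat.mul_add_div hQ, Nat.div_eq_of_lt (mem_range.1 hx), add_zero], sum_const, card_range,
      nsmul_eq_mul]

/-- The indicator of a window of length `2 * H` starting at `y` on which `F` vanishes. -/
noncomputable def gapInd (F : ℤ → ℝ) (H : ℕ) (y : ℤ) : ℝ :=
  open Classical in if ∀ h : ℕ, h < 2 * H → F (y + h) = 0 then 1 else 0

lemma gapInd_nonneg (F : ℤ → ℝ) (H : ℕ) (y : ℤ) : 0 ≤ gapInd F H y := by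
  unfold gapInd; split_ifs <;> simp

lemma gapInd_periodic {F : ℤ → ℝ} {m : ℤ} (hF : Function.Periodic F m) (H : ℕ) :
    Function.Periodic (gapInd F H) m := fun y => by
  have : ∀ h : ℕ, F (y + m + h) = F (y + h) := fun h => by rw [add_right_comm, hF]
  simp only [gapInd, this]

lemma chi_congr {p : ℕ} {u v : ℤ} (h : (p : ℤ) ∣ u - v) : chi p u = chi p v :=
  eq_of_modEq (chi_periodic p) h

lemma not_dvd_of_lt {B p : ℕ} (hB : 2 ≤ B) (hp : p.Prime) (hpB : B < p) :
    ¬p ∣ 8 * B.factorial := fun h => by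
  rw [hp.dvd_mul, hp.dvd_factorial] at h
  rcases h with h | h
  · have := Nat.le_of_dvd two_pos (hp.dvd_of_dvd_pow (by exact h : p ∣ 2 ^ 3))
    omega
  · omega

lemma emptyCount_QR_le {M B : ℕ} [NeZero M] (hB : 2 ≤ B) {P : Finset ℕ}
    (hP : ∀ p, p ∈ P ↔ p.Prime ∧ B < p ∧ p ∣ M) (H : ℕ) :
    (emptyCount M (QR M) (2 * H * (8 * B.factorial) + 1) : ℝ) ≤
      (8 * B.factorial : ℕ) * (M * avg (∏ p ∈ P, p)
        (gapInd (fun n => ∏ p ∈ P, (1 + phi (chiCoeff M (8 * B.factorial)) (kapCoeff M) p n)) H)) := by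
  have hM : 0 < M := NeZero.pos M
  have hPp : ∀ p ∈ P, p.Prime := fun p hp => ((hP p).1 hp).1
  obtain ⟨Q, hQ⟩ : ∃ Q, Q = 8 * B.factorial := ⟨_, rfl⟩
  have hQ0 : 0 < Q := by rw [hQ]; positivity
  have hPQ : ∀ p ∈ P, ¬p ∣ Q := fun p hp =>
    hQ ▸ not_dvd_of_lt hB (hPp p hp) ((hP p).1 hp).2.1
  rw [← hQ]
  set F : ℤ → ℝ := fun n => ∏ p ∈ P, (1 + phi (chiCoeff M Q) (kapCoeff M) p n) with hF
  set m := ∏ p ∈ P, p with hm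
  have hmM : m ∣ M := Finset.prod_primes_dvd M (fun p hp => (hPp p hp).prime)
    fun p hp => ((hP p).1 hp).2.2
  have hFper : Function.Periodic F (m : ℤ) := _root_.periodic_prod P fun p hp =>
    periodic_of_dvd (dvd_prod_of_mem _ hp) fun n => by
      rw [phi_periodic (chiCoeff M Q) (kapCoeff M) p n]
  have hGper := gapInd_periodic hFper H
  have hcop : IsCoprime (Q : ℤ) (m : ℤ) := Nat.isCoprime_iff_coprime.2
    (Nat.Coprime.prod_right fun p hp => ((hPp p hp).coprime_iff_not_dvd.2 (hPQ p hp)).symm)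
  obtain ⟨c, v, hcv⟩ := hcop
  have hc : (m : ℤ) ∣ Q * c - 1 := ⟨-v, by linear_combination hcv⟩
  have key : ∀ x : ZMod M, (∀ i ∈ Icc 1 (2 * H * Q + 1), x + (i : ZMod M) ∉ QR M) →
      gapInd F H ((x.val / Q : ℕ) + (1 + c)) = 1 := by
    intro x hx
    rw [gapInd, if_pos]
    intro h hh
    by_contra hne
    obtain ⟨y, hy⟩ : ∃ y : ℕ, y = x.val / Q + 1 + h := ⟨_, rfl⟩
    have hy' : ((x.val / Q : ℕ) : ℤ) + (1 + c) + h = y + c := by rw [hy]; push_cast; ring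
    rw [hy'] at hne
    have hsq : IsSqMod M (1 + Q * y : ℤ) := by
      refine isSqMod_of_local (B := B) hM ⟨y, by rw [← hQ]; ring⟩ fun p hp hpB hpM => ?_
      have hpP := (hP p).2 ⟨hp, hpB, hpM⟩
      have hdvd : (p : ℤ) ∣ Q * (y + c) - (1 + Q * y) := by
        have : (Q * (y + c) - (1 + Q * y) : ℤ) = Q * c - 1 := by ring
        rw [this]
        exact (Int.natCast_dvd_natCast.2 (dvd_prod_of_mem _ hpP)).trans hc
      rcases of_prod_one_add_phi_ne_zero hPp hPQ hne hpP with h1 | ⟨h1, h2⟩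
      · exact Or.inl ((chi_congr hdvd).symm.trans h1)
      · exact Or.inr ⟨(dvd_iff_dvd_of_dvd_sub hdvd).1 h1, h2⟩
    have hlt : x.val < Q * (x.val / Q) + Q := by
      have := Nat.div_add_mod x.val Q; have := Nat.mod_lt x.val hQ0; omega
    have hle : Q * (x.val / Q) ≤ x.val := Nat.mul_div_le _ _
    have hQy : Q * y = Q * (x.val / Q) + Q + Q * h := by rw [hy]; ring
    have hQh : Q * h + Q ≤ 2 * H * Q := by nlinarith
    refine hx (1 + Q * y - x.val) (mem_Icc.2 ⟨by omega, by omega⟩) ?_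
    rw [Nat.cast_sub (by omega), ZMod.natCast_zmod_val, add_sub_cancel]
    have := (mem_QR_iff (M := M) _).2 hsq
    exact_mod_cast this
  calc (emptyCount M (QR M) (2 * H * Q + 1) : ℝ)
      ≤ ∑ x : ZMod M, gapInd F H ((x.val / Q : ℕ) + (1 + c)) := by
        rw [emptyCount, card_filter, Nat.cast_sum]
        refine sum_le_sum fun x _ => ?_
        split_ifs with h
        · rw [key x h]; simp
        · simpa using gapInd_nonneg _ _ _
    _ = ∑ x ∈ range M, gapInd F H ((x / Q : ℕ) + (1 + c)) := by
        have := sum_range_eq_sum_zmod M fun n : ℤ => gapInd F H ((n.toNat / Q : ℕ) + (1 + c))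
        simpa only [Int.toNat_natCast] using this.symm
    _ ≤ ∑ x ∈ range (Q * M), gapInd F H ((x / Q : ℕ) + (1 + c)) :=
        sum_le_sum_of_subset_of_nonneg (range_subset_range.2 (Nat.le_mul_of_pos_left _ hQ0))
          fun _ _ _ => gapInd_nonneg _ _ _
    _ = Q * ∑ y ∈ range M, gapInd F H ((y : ℕ) + (1 + c)) :=
        sum_range_mul_div Q M fun y => gapInd F H ((y : ℤ) + (1 + c))
    _ = Q * (M * avg M (fun y => gapInd F H (y + (1 + c)))) := by
        rw [avg, mul_div_cancel₀ _ (by exact_mod_cast hM.ne')]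
    _ = _ := by
        rw [avg_shift (periodic_of_dvd hmM hGper) (1 + c), avg_dvd hmM hM hGper]

/-- A majorant of the local condition at `p` satisfied by the squares modulo `M`. -/
noncomputable def sqMajorant (M p : ℕ) (n : ℤ) : ℝ :=
  if p ^ 2 ∣ M then
    (1 + chi p n - (if (p : ℤ) ∣ n then 1 else 0)) / 2 + (if ((p ^ 2 : ℕ) : ℤ) ∣ n then 1 else 0)
  else (1 + chi p n + (if (p : ℤ) ∣ n then 1 else 0)) / 2

/-- The period of `sqMajorant M p`. -/
def sqPeriod (M p : ℕ) : ℕ := if p ^ 2 ∣ M then p ^ 2 else p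

lemma sqPeriod_dvd {M p : ℕ} (h : p ∣ M) : sqPeriod M p ∣ M := by
  unfold sqPeriod; split_ifs <;> assumption

lemma dvd_sqPeriod (M p : ℕ) : p ∣ sqPeriod M p := by
  unfold sqPeriod; split_ifs
  · exact dvd_pow_self p two_ne_zero
  · exact dvd_rfl

lemma ite_dvd_periodic (m : ℕ) :
    Function.Periodic (fun n : ℤ => if (m : ℤ) ∣ n then (1 : ℝ) else 0) (m : ℤ) := fun n => by
  simp only [dvd_add_left (dvd_refl (m : ℤ))]

lemma avg_ite_dvd {m : ℕ} (hm : 0 < m) :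
    avg m (fun n : ℤ => if (m : ℤ) ∣ n then (1 : ℝ) else 0) = 1 / m := by
  have h := avg_kap hm
  have e : (fun n : ℤ => if (m : ℤ) ∣ n then (1 : ℝ) else 0) = fun n => kap m n + 1 / m := by
    funext n; rw [kap]; ring
  rw [e, avg_add, avg_const hm]
  rw [show avg m (fun n => kap m n) = 0 from h, zero_add]

lemma avg_chi {p : ℕ} (hp : p.Prime) (hp2 : p ≠ 2) : avg p (chi p) = 0 := by
  have h := avg_phi (a := fun _ => 1) (b := fun _ => 0) hp hp2
  have e : phi (fun _ => 1) (fun _ => 0) p = chi p := by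
    funext n; simp [phi]
  rwa [e] at h

lemma sqMajorant_periodic (M p : ℕ) : Function.Periodic (sqMajorant M p) (sqPeriod M p : ℤ) := by
  intro n
  have h1 := periodic_of_dvd (dvd_sqPeriod M p) (chi_periodic p) n
  have h2 := periodic_of_dvd (dvd_sqPeriod M p) (ite_dvd_periodic p) n
  by_cases h : p ^ 2 ∣ M
  · have h3 := ite_dvd_periodic (p ^ 2) n
    have e : sqPeriod M p = p ^ 2 := if_pos h
    rw [e] at h1 h2 ⊢
    simp only at h3
    rw [sqMajorant, sqMajorant, if_pos h, if_pos h, h1, h2, h3]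
  · rw [sqMajorant, sqMajorant, if_neg h, if_neg h, h1, h2]

lemma avg_sqMajorant_le {M p : ℕ} (hp : p.Prime) (hp2 : p ≠ 2) :
    avg (sqPeriod M p) (sqMajorant M p) ≤ localDens M p * (1 + 4 / (p : ℝ) ^ 2) := by
  have hd := localDens_ge (M := M) hp.two_le
  have hp0 : (0 : ℝ) < p := by exact_mod_cast hp.pos
  have hc := avg_chi hp hp2
  have hi := avg_ite_dvd hp.pos
  have e0 : (1 : ℝ) / p ^ 2 = 1 / 4 * (4 / (p : ℝ) ^ 2) := by ring
  by_cases h : p ^ 2 ∣ M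
  · have hp2' : 0 < p ^ 2 := pow_pos hp.pos 2
    have hdv : p ∣ p ^ 2 := dvd_pow_self p two_ne_zero
    have e : sqMajorant M p = fun n => ((1 / 2) * (1 + chi p n) +
        (-1 / 2) * (if (p : ℤ) ∣ n then 1 else 0)) + (if ((p ^ 2 : ℕ) : ℤ) ∣ n then 1 else 0) := by
      funext n; rw [sqMajorant, if_pos h]; ring
    rw [e, sqPeriod, if_pos h, avg_add, avg_add, avg_const_mul, avg_const_mul, avg_add,
      avg_const hp2', avg_dvd hdv hp2' (chi_periodic p), avg_dvd hdv hp2' (ite_dvd_periodic p),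
      avg_ite_dvd hp2', hi, hc]
    have : localDens M p = 1 / 2 * (1 + 0) + -1 / 2 * (1 / p) := by
      rw [localDens, sqSign, if_pos h]; ring
    rw [← this, Nat.cast_pow, mul_add, mul_one, e0]
    gcongr
  · have e : sqMajorant M p = fun n => (1 / 2) * (1 + chi p n) +
        (1 / 2) * (if (p : ℤ) ∣ n then 1 else 0) := by
      funext n; rw [sqMajorant, if_neg h]; ring
    rw [e, sqPeriod, if_neg h, avg_add, avg_const_mul, avg_const_mul, avg_add,
      avg_const hp.pos, hi, hc]
    have : localDens M p = 1 / 2 * (1 + 0) + 1 / 2 * (1 / p) := by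
      rw [localDens, sqSign, if_neg h]; ring
    rw [← this, mul_add, mul_one]
    have : 0 ≤ localDens M p * (4 / (p : ℝ) ^ 2) := by positivity
    linarith

lemma sqMajorant_nonneg {M p : ℕ} (hp : p.Prime) (n : ℤ) : 0 ≤ sqMajorant M p n := by
  rw [sqMajorant]
  by_cases hn : (p : ℤ) ∣ n
  · rw [chi_eq_zero hp hn, if_pos hn]
    split_ifs <;> norm_num
  · rw [if_neg hn]
    rcases chi_eq_or hp hn with h | h <;> rw [h] <;> split_ifs <;> norm_num

lemma one_le_sqMajorant {M p : ℕ} (hp : p.Prime) (hpM : p ∣ M) {n : ℤ} (hn : IsSqMod M n) :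
    1 ≤ sqMajorant M p n := by
  have hpZ : Prime (p : ℤ) := Nat.prime_iff_prime_int.1 hp
  obtain ⟨z, hz⟩ := isSqMod_of_dvd hpM hn
  rw [sqMajorant]
  by_cases hpn : (p : ℤ) ∣ n
  · rw [chi_eq_zero hp hpn, if_pos hpn]
    split_ifs with h1 h2
    · norm_num
    · refine absurd ?_ h2
      obtain ⟨w, hw⟩ := isSqMod_of_dvd h1 hn
      have h3 : (p : ℤ) ∣ w ^ 2 - n :=
        (Int.natCast_dvd_natCast.2 (dvd_pow_self p two_ne_zero)).trans hw
      have h4 : (p : ℤ) ∣ w := hpZ.dvd_of_dvd_pow ((dvd_iff_dvd_of_dvd_sub h3).2 hpn)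
      refine (dvd_iff_dvd_of_dvd_sub hw).1 ?_
      push_cast
      exact pow_dvd_pow_of_dvd h4 2
    · norm_num
  · have hzn : ¬(p : ℤ) ∣ z := fun h => hpn ((dvd_iff_dvd_of_dvd_sub hz).1 (h.pow two_ne_zero))
    have h1 : chi p n = 1 := by
      rw [← chi_congr hz, sq, chi_mul]
      rcases chi_eq_or hp hzn with h | h <;> rw [h] <;> norm_num
    rw [if_neg hpn, h1]
    split_ifs <;> norm_num

lemma prod_one_add_le_exp {P : Finset ℕ} (hP : ∀ p ∈ P, 2 ≤ p) :
    ∏ p ∈ P, (1 + 4 / (p : ℝ) ^ 2) ≤ Real.exp 4 := by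
  calc ∏ p ∈ P, (1 + 4 / (p : ℝ) ^ 2) ≤ ∏ p ∈ P, Real.exp (4 * ((p : ℝ) ^ 2)⁻¹) :=
        prod_le_prod (fun _ _ => by positivity) fun p _ => by
          rw [add_comm, div_eq_mul_inv]; exact Real.add_one_le_exp _
    _ = Real.exp (∑ p ∈ P, 4 * ((p : ℝ) ^ 2)⁻¹) := (Real.exp_sum _ _).symm
    _ ≤ Real.exp 4 := by
        rw [Real.exp_le_exp, ← mul_sum]
        have h1 : ∑ p ∈ P, ((p : ℝ) ^ 2)⁻¹ ≤ ∑ p ∈ Ioo 1 (P.sup id + 1), ((p : ℝ) ^ 2)⁻¹ :=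
          sum_le_sum_of_subset_of_nonneg (fun p hp => mem_Ioo.2
            ⟨hP p hp, Nat.lt_succ_of_le (le_sup (f := id) hp)⟩) fun _ _ _ => by positivity
        have h2 := sum_Ioo_inv_sq_le (α := ℝ) 1 (P.sup id + 1)
        norm_num at h2
        linarith

lemma card_QR_le_localDens {M : ℕ} [NeZero M] {P : Finset ℕ}
    (hP : ∀ p ∈ P, p.Prime ∧ p ≠ 2 ∧ p ∣ M) :
    (#(QR M) : ℝ) ≤ Real.exp 4 * (M * ∏ p ∈ P, localDens M p) := by
  have hM : 0 < M := NeZero.pos M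
  have hpos : ∀ p ∈ P, 0 < sqPeriod M p := fun p hp =>
    Nat.pos_of_dvd_of_pos (sqPeriod_dvd (hP p hp).2.2) hM
  have hco : (P : Set ℕ).Pairwise fun i j => (sqPeriod M i).Coprime (sqPeriod M j) := by
    intro i hi j hj hij
    have h1 : i.Coprime j := (Nat.coprime_primes (hP i hi).1 (hP j hj).1).2 hij
    unfold sqPeriod
    split_ifs
    · exact h1.pow 2 2
    · exact h1.pow_left 2
    · exact h1.pow_right 2
    · exact h1
  have hdvd : ∏ p ∈ P, sqPeriod M p ∣ M :=
    Finset.prod_dvd_of_isRelPrime (fun i hi j hj hij =>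
      Nat.coprime_iff_isRelPrime.1 (hco hi hj hij)) fun p hp => sqPeriod_dvd (hP p hp).2.2
  have hper : Function.Periodic (fun n : ℤ => ∏ p ∈ P, sqMajorant M p n)
      ((∏ p ∈ P, sqPeriod M p : ℕ) : ℤ) := _root_.periodic_prod P fun p hp =>
    periodic_of_dvd (dvd_prod_of_mem _ hp) (sqMajorant_periodic M p)
  have h1 : (#(QR M) : ℝ) ≤ ∑ x : ZMod M, ∏ p ∈ P, sqMajorant M p (x.val : ℤ) := by
    classical
    rw [← filter_mem_eq_inter.trans (univ_inter (QR M)), card_filter, Nat.cast_sum]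
    refine sum_le_sum fun x _ => ?_
    split_ifs with h
    · rw [Nat.cast_one]
      have hsq : IsSqMod M (x.val : ℤ) := by
        rw [← mem_QR_iff]; simpa using h
      simpa using prod_le_prod (s := P) (f := fun _ => (1 : ℝ)) (fun _ _ => zero_le_one)
        fun p hp => one_le_sqMajorant (hP p hp).1 (hP p hp).2.2 hsq
    · rw [Nat.cast_zero]
      exact prod_nonneg fun p hp => sqMajorant_nonneg (hP p hp).1 _
  calc (#(QR M) : ℝ) ≤ M * avg M (fun n => ∏ p ∈ P, sqMajorant M p n) := by
        rw [avg_eq_sum_zmod, mul_div_cancel₀ _ (by exact_mod_cast hM.ne')]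
        exact h1
    _ = M * ∏ p ∈ P, avg (sqPeriod M p) (sqMajorant M p) := by
        rw [avg_dvd hdvd hM hper, avg_prod P _ _ hpos hco fun p _ => sqMajorant_periodic M p]
    _ ≤ M * ∏ p ∈ P, localDens M p * (1 + 4 / (p : ℝ) ^ 2) := by
        gcongr with p hp
        · intro p hp
          exact avg_nonneg fun n => sqMajorant_nonneg (hP p hp).1 n
        · exact avg_sqMajorant_le (hP p hp).1 (hP p hp).2.1
    _ ≤ M * ((∏ p ∈ P, localDens M p) * Real.exp 4) := by
        rw [prod_mul_distrib]
        gcongr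
        · exact prod_nonneg fun p hp => by
            linarith [localDens_ge (M := M) (hP p hp).1.two_le]
        · exact prod_one_add_le_exp fun p hp => (hP p hp).1.two_le
    _ = _ := by ring

lemma exists_prime_threshold {k : ℕ} (hk : k ≠ 0) : ∃ B : ℕ, 10 ^ 6 ≤ B ∧
    ∀ (D : Finset ℕ) (x : ℝ), 1 ≤ x → (∀ p ∈ D, B ≤ p) → ((∏ p ∈ D, p : ℕ) : ℝ) ≤ x ^ k →
      ((10 : ℝ) ^ 6) ^ #D ≤ x := by
  refine ⟨(10 ^ 6) ^ k, Nat.le_self_pow hk _, fun D x hx hD h => ?_⟩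
  refine le_of_pow_le_pow_left₀ hk (by linarith) (le_trans ?_ h)
  rw [← pow_mul, mul_comm, pow_mul]
  have h1 := prod_le_prod (s := D) (f := fun _ => (10 ^ 6) ^ k) (g := fun p => p)
    (fun _ _ => Nat.zero_le _) hD
  rw [prod_const] at h1
  exact_mod_cast h1

lemma exists_le_rpow (c : ℝ) {y : ℝ} (hy : 0 < y) : ∃ N : ℕ, ∀ H : ℕ, N ≤ H → c ≤ (H : ℝ) ^ y :=
  Filter.eventually_atTop.1 (((tendsto_rpow_atTop hy).comp
    tendsto_natCast_atTop_atTop).eventually_ge_atTop c)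

lemma emptyCount_antitone (M : ℕ) [NeZero M] (U : Finset (ZMod M)) : Antitone (emptyCount M U) :=
  fun s t hst => card_le_card fun x hx => by
    simp only [mem_filter, mem_univ, true_and] at hx ⊢
    exact fun i hi => hx i (Icc_subset_Icc_right hst hi)

lemma emptyCount_le (M : ℕ) [NeZero M] (U : Finset (ZMod M)) (t : ℕ) : emptyCount M U t ≤ M := by
  simpa [emptyCount] using card_filter_le (univ : Finset (ZMod M)) _

lemma sum_inv_sq_tail_le {W : ℕ} (hW : 0 < W) (N : ℕ) :
    ∑ H ∈ range N, (if W ≤ H then ((H : ℝ) ^ 2)⁻¹ else 0) ≤ 2 / W := by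
  have h := sum_Ioo_inv_sq_le (α := ℝ) (W - 1) N
  have e : ((W - 1 : ℕ) : ℝ) + 1 = W := by
    rw [Nat.cast_sub hW]; simp
  rw [e] at h
  refine le_trans (le_of_eq ?_) h
  rw [← sum_filter]
  refine sum_congr ?_ fun _ _ => rfl
  ext H
  simp only [mem_filter, mem_range, mem_Ioo]
  omega

lemma exists_sum_le {b : ℕ} (hb : 0 < b) {K : ℝ} (hK : 0 ≤ K) (H₀ : ℕ) {c : ℕ → ℝ}
    (hc0 : ∀ H, 0 ≤ c H) (hc : Summable c) :
    ∃ C : ℝ, ∀ (M : ℕ) (δ : ℝ) (E : ℕ → ℝ), 0 < δ → δ ≤ 1 → Antitone E → (∀ t, 0 ≤ E t) →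
      (∀ t, E t ≤ M) →
      (∀ H : ℕ, H₀ ≤ H → 1 ≤ δ * H → E (b * H + 1) ≤ K * M * (1 / (δ * H) ^ 2 + c H)) →
      ∑ t ∈ range M, E t ≤ C * (M / δ) := by
  refine ⟨1 + b * ((H₀ + 2) + K * (2 + ∑' H, c H)), fun M δ E hδ hδ1 hE hE0 hEM h => ?_⟩
  have hT : 0 ≤ ∑' H, c H := tsum_nonneg hc0
  have hδi : 1 ≤ 1 / δ := by rwa [le_div_iff₀ hδ, one_mul]
  have hMδ : (M : ℝ) ≤ M / δ := by
    rw [le_div_iff₀ hδ]; exact mul_le_of_le_one_right (Nat.cast_nonneg M) hδ1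
  obtain ⟨W, hW⟩ : ∃ W, W = H₀ + ⌈1 / δ⌉₊ := ⟨_, rfl⟩
  have hWc : 1 / δ ≤ W := by
    rw [hW]; push_cast
    linarith [Nat.le_ceil (1 / δ), (Nat.cast_nonneg H₀ : (0 : ℝ) ≤ H₀)]
  have hW0 : 0 < W := by
    have : (0 : ℝ) < W := by linarith
    exact_mod_cast this
  have hWle : (W : ℝ) ≤ (H₀ + 2) / δ := by
    have h1 := Nat.ceil_lt_add_one (a := 1 / δ) (by linarith)
    have h2 : (H₀ : ℝ) ≤ H₀ * (1 / δ) := le_mul_of_one_le_right (Nat.cast_nonneg _) hδi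
    have h3 : ((H₀ : ℝ) + 2) / δ = H₀ * (1 / δ) + 2 * (1 / δ) := by ring
    rw [hW, h3]; push_cast; linarith
  have hpt : ∀ H : ℕ, E (b * H + 1) ≤ (if H < W then (M : ℝ) else 0) +
      K * M * ((1 / δ ^ 2) * (if W ≤ H then ((H : ℝ) ^ 2)⁻¹ else 0) + c H) := by
    intro H
    rcases lt_or_ge H W with hH | hH
    · rw [if_pos hH, if_neg (by omega), mul_zero, zero_add]
      have := hEM (b * H + 1)
      have := mul_nonneg (mul_nonneg hK (Nat.cast_nonneg M)) (hc0 H)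
      linarith
    · rw [if_neg (by omega), if_pos hH, zero_add]
      refine (h H (by omega) ?_).trans (le_of_eq ?_)
      · have : 1 / δ ≤ H := hWc.trans (by exact_mod_cast hH)
        rwa [div_le_iff₀' hδ] at this
      · rw [mul_pow, one_div, one_div, mul_inv]
  have hmain : ∑ H ∈ range M, E (b * H + 1) ≤ ((H₀ + 2) + K * (2 + ∑' H, c H)) * (M / δ) := by
    have h1 : ∑ H ∈ range M, (if H < W then (M : ℝ) else 0) ≤ W * M := by
      rw [← sum_filter, sum_const, nsmul_eq_mul]
      gcongr
      calc #{H ∈ range M | H < W} ≤ #(range W) := card_le_card fun H hH => by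
            simp only [mem_filter, mem_range] at hH ⊢; exact hH.2
        _ = W := card_range W
    have h2 := sum_inv_sq_tail_le hW0 M
    have h3 : ∑ H ∈ range M, c H ≤ ∑' H, c H := hc.sum_le_tsum _ fun H _ => hc0 H
    have h4 : (2 : ℝ) / W ≤ 2 * δ := by
      rw [div_le_iff₀ (by exact_mod_cast hW0)]
      have := (div_le_iff₀' hδ).1 hWc
      nlinarith
    calc ∑ H ∈ range M, E (b * H + 1) ≤ ∑ H ∈ range M, ((if H < W then (M : ℝ) else 0) +
          K * M * ((1 / δ ^ 2) * (if W ≤ H then ((H : ℝ) ^ 2)⁻¹ else 0) + c H)) :=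
          sum_le_sum fun H _ => hpt H
      _ = ∑ H ∈ range M, (if H < W then (M : ℝ) else 0) + K * M * ((1 / δ ^ 2) *
          ∑ H ∈ range M, (if W ≤ H then ((H : ℝ) ^ 2)⁻¹ else 0) + ∑ H ∈ range M, c H) := by
          rw [sum_add_distrib, ← mul_sum, sum_add_distrib, ← mul_sum]
      _ ≤ (H₀ + 2) / δ * M + K * M * ((1 / δ ^ 2) * (2 * δ) + (∑' H, c H) * (1 / δ)) := by
          refine add_le_add (h1.trans (by gcongr)) ?_
          gcongr
          · exact h2.trans h4
          · exact h3.trans (le_mul_of_one_le_right hT hδi)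
      _ = _ := by field_simp
  have hb1 : (1 : ℝ) ≤ b := by exact_mod_cast hb
  calc ∑ t ∈ range M, E t ≤ ∑ t ∈ range (b * M + 1), E t :=
        sum_le_sum_of_subset_of_nonneg (range_subset_range.2 (by nlinarith)) fun _ _ _ => hE0 _
    _ = ∑ t ∈ range (b * M), E (t + 1) + E 0 := sum_range_succ' _ _
    _ ≤ ∑ t ∈ range (b * M), E (b * (t / b) + 1) + M := by
        gcongr with t
        · exact hE (by have := Nat.mul_div_le t b; omega)
        · exact hEM 0
    _ = b * ∑ H ∈ range M, E (b * H + 1) + M := by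
        rw [sum_range_mul_div b M fun H => E (b * H + 1)]
    _ ≤ b * (((H₀ + 2) + K * (2 + ∑' H, c H)) * (M / δ)) + M / δ := by gcongr
    _ = _ := by ring

theorem stoch_QR_bounded : ∃ C : ℝ, ∀ M : ℕ, 0 < M →
    (stoch M (QR M) : ℝ) ≤ C * ((M : ℝ) ^ 2 / #(QR M)) := by
  obtain ⟨B, hB, hBD⟩ := exists_prime_threshold (k := 10000 * 1600) (by norm_num)
  obtain ⟨H₀, hH₀⟩ := exists_le_rpow (10 ^ 6) (y := 1 / 10000) (by norm_num)
  obtain ⟨Q, hQ⟩ : ∃ Q, Q = 8 * B.factorial := ⟨_, rfl⟩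
  have hQ0 : 0 < Q := by rw [hQ]; positivity
  obtain ⟨C, hC⟩ := exists_sum_le (b := 2 * Q) (by omega) (K := 2000 * Q) (by positivity) H₀
    (c := fun H => ((H : ℝ) ^ ((1 / 10000 : ℝ) * (10080 : ℕ)))⁻¹) (fun H => by positivity)
    (Real.summable_nat_rpow_inv.2 (by norm_num))
  refine ⟨2 * |C| * Real.exp 4, fun M hM => ?_⟩
  have : NeZero M := ⟨hM.ne'⟩
  obtain ⟨P, hP⟩ : ∃ P : Finset ℕ, ∀ p, p ∈ P ↔ p.Prime ∧ B < p ∧ p ∣ M :=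
    ⟨M.primeFactors.filter (B < ·), fun p => by
      simp only [mem_filter, Nat.mem_primeFactors]; have := hM.ne'; tauto⟩
  have hPp : ∀ p ∈ P, p.Prime := fun p hp => ((hP p).1 hp).1
  have hPB : ∀ p ∈ P, B < p := fun p hp => ((hP p).1 hp).2.1
  have hPQ : ∀ p ∈ P, ¬p ∣ Q := fun p hp => hQ ▸ not_dvd_of_lt (by omega) (hPp p hp) (hPB p hp)
  set δ := ∏ p ∈ P, localDens M p with hδdef
  have hδ : 0 < δ := prod_pos fun p hp => by
    linarith [localDens_ge (M := M) (hPp p hp).two_le]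
  have hδP : δ ≤ (2 / 3) ^ #P := by
    rw [← prod_const]
    refine prod_le_prod (fun p hp => by linarith [localDens_ge (M := M) (hPp p hp).two_le])
      fun p hp => localDens_le ?_
    have := hPB p hp; omega
  have hδ1 : δ ≤ 1 := hδP.trans (pow_le_one₀ (by norm_num) (by norm_num))
  have hcard := card_QR_le_localDens (M := M) (P := P) fun p hp =>
    ⟨hPp p hp, by have := hPB p hp; omega, ((hP p).1 hp).2.2⟩
  have hE := hC M δ (fun t => (emptyCount M (QR M) t : ℝ)) hδ hδ1
    (fun s t hst => Nat.cast_le.2 (emptyCount_antitone M (QR M) hst))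
    (fun t => Nat.cast_nonneg _) (fun t => by exact_mod_cast emptyCount_le M (QR M) t) ?_
  · have h1 : (stoch M (QR M) : ℝ) ≤ 2 * (|C| * (M / δ)) := by
      have h2 : (stoch M (QR M) : ℝ) = 2 * (∑ t ∈ range M, (emptyCount M (QR M) t : ℝ)) - M := by
        exact_mod_cast stoch_eq_emptyCount (QR_nonempty M)
      have h3 : C * (M / δ) ≤ |C| * (M / δ) := by
        gcongr; exact le_abs_self C
      have : (0 : ℝ) ≤ M := Nat.cast_nonneg M
      linarith
    have hq : (0 : ℝ) < #(QR M) := by exact_mod_cast card_pos.2 (QR_nonempty M)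
    have hM0 : (0 : ℝ) < M := by exact_mod_cast hM
    have h4 : (M : ℝ) / δ ≤ Real.exp 4 * ((M : ℝ) ^ 2 / #(QR M)) := by
      rw [div_le_iff₀ hδ, mul_div_assoc', div_mul_eq_mul_div, le_div_iff₀ hq]
      calc (M : ℝ) * #(QR M) ≤ M * (Real.exp 4 * (M * δ)) := by gcongr
        _ = _ := by ring
    calc (stoch M (QR M) : ℝ) ≤ 2 * (|C| * (M / δ)) := h1
      _ ≤ 2 * (|C| * (Real.exp 4 * ((M : ℝ) ^ 2 / #(QR M)))) := by gcongr
      _ = _ := by ring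
  · intro H hH hδH
    obtain ⟨x, hx⟩ : ∃ x : ℝ, x = (H : ℝ) ^ (1 / 10000 : ℝ) := ⟨_, rfl⟩
    have hx6 : 10 ^ 6 ≤ x := hx ▸ hH₀ H hH
    have hxH : (H : ℝ) = x ^ 10000 := by
      rw [hx, ← Real.rpow_natCast, ← Real.rpow_mul (Nat.cast_nonneg H)]; norm_num
    have hxc : x ^ 10080 = (H : ℝ) ^ ((1 / 10000 : ℝ) * (10080 : ℕ)) := by
      rw [hx, ← Real.rpow_natCast, ← Real.rpow_mul (Nat.cast_nonneg H)]
    have hH0 : (0 : ℝ) ≤ H := Nat.cast_nonneg H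
    have hPH : (3 / 2 : ℝ) ^ #P ≤ H := by
      refine le_of_mul_le_mul_left ?_ hδ
      calc δ * (3 / 2) ^ #P ≤ (2 / 3) ^ #P * (3 / 2) ^ #P := by gcongr
        _ = 1 := by rw [← mul_pow]; norm_num
        _ ≤ δ * H := hδH
    have h1 := avg_empty_le (fun p => abs_chiCoeff_le M Q p) (fun p => abs_kapCoeff_le M p) hPp
      (fun p hp => hB.trans (hPB p hp).le) hx6 hxH hPH
      (fun D hD hDH => hBD D x (by linarith) (fun p hp => (hPB p (hD hp)).le)
        (by rw [pow_mul, ← hxH]; exact hDH))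
      hδ hδH (sq_prod_one_add_phi_le hPp hPQ)
    have h2 := emptyCount_QR_le (M := M) (B := B) (by omega) hP H
    rw [← hQ] at h2
    have e : 2 * Q * H + 1 = 2 * H * Q + 1 := by ring
    rw [e, ← hxc]
    refine h2.trans ?_
    have h3 : avg (∏ p ∈ P, p) (gapInd (fun n => ∏ p ∈ P,
        (1 + phi (chiCoeff M Q) (kapCoeff M) p n)) H) ≤ 2000 / (δ * H) ^ 2 + (x ^ 10080)⁻¹ := by
      refine le_trans (le_of_eq ?_) h1
      unfold gapInd
      congr
    have hx0 : (0 : ℝ) ≤ (x ^ 10080)⁻¹ := by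
      have : 0 ≤ x := by linarith
      positivity
    calc (Q : ℝ) * (M * avg (∏ p ∈ P, p) (gapInd (fun n => ∏ p ∈ P,
          (1 + phi (chiCoeff M Q) (kapCoeff M) p n)) H))
        ≤ Q * (M * (2000 / (δ * H) ^ 2 + 2000 * (x ^ 10080)⁻¹)) := by
          gcongr; linarith
      _ = _ := by ring

/-- liminf S(R_M)/s(|R_M|) < 1 < limsup S(R_M)/s(|R_M|) as M → ∞ over positive integers. -/
theorem stmt_0 :
    Filter.liminf
        (fun M : ℕ => (stoch M (QR M) : ℝ) / ((savg M (QR M).card : ℚ) : ℝ)) Filter.atTop < 1 ∧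
    1 < Filter.limsup
        (fun M : ℕ => (stoch M (QR M) : ℝ) / ((savg M (QR M).card : ℚ) : ℝ)) Filter.atTop :=
  main_of_bounded stoch_QR_bounded
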